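/- For every β∈Δ⁺, s∈ℤ, and for any choices of the parameters λ∈v^ℤ and decompositions defining the quantum root vector E_{β,s}, there exist c∈ℚ^× and m∈ℤ such that φ_β(Ψ(E_{β,s})) = c·v^m·c_β·w_{β,1}^{s+κ_β}, where: κ_{[i,j]}=j−i for 1≤i≤j≤n; κ_{[i,n,j]}=4n−i−3j−1 for 1≤i<j≤n−1; κ_{[i,n,i]}=2n−2i; and c_β=⟨1⟩_v^{|β|−1} if β=[i,j] with j≤n−1 or β=[n], c_β=⟨1⟩_v^{|β|−2}·⟨2⟩_v if β=[i,n] with i<n, c_β=⟨1⟩_v^{|β|−3}·⟨2⟩_v·∏_{ℓ=j}^{n−1}(v^{2n−2ℓ}−1)(v^{2n−2ℓ+4}−1) if β=[i,n,j] with i<j<n, and c_β=⟨1⟩_v^{|β|−3}·⟨2⟩_v^2 if β=[i,n,i]. -/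

import Mathlib

noncomputable section
open scoped BigOperators DirectSum

/-! ### Base field ℚ(v) and quantum numbers -/

/-- the base field `ℚ(v)`. -/
abbrev KK : Type := RatFunc ℚ
/-- the variable `v ∈ ℚ(v)`. -/
def vv : KK := RatFunc.X
/-- integer powers of `v`. -/
def vpow (m : ℤ) : KK := vv ^ m
/-- the quantum integer `[m]_u = (uᵐ - u⁻ᵐ)/(u - u⁻¹)`. -/
def qInt (u : KK) (m : ℕ) : KK := (u ^ (m : ℤ) - u ^ (-(m : ℤ))) / (u - u⁻¹)
/-- the quantum factorial `[m]_u!`. -/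
def qFact (u : KK) (m : ℕ) : KK := ∏ k ∈ Finset.range m, qInt u (k + 1)
/-- the quantum binomial coefficient. -/
def qBinom (u : KK) (m k : ℕ) : KK := qFact u m / (qFact u k * qFact u (m - k))
/-- `⟨m⟩_v = vᵐ - v⁻ᵐ`. -/
def qBrack (m : ℕ) : KK := vpow (m : ℤ) - vpow (-(m : ℤ))
/-- the sign `ε ∈ {+,-}` as `±1`. -/
def sgn (ε : Bool) : ℤ := if ε then 1 else -1
/-- `l` is an integer power of `v`. -/
def IsVpow (l : KK) : Prop := ∃ m : ℤ, l = vpow m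

/-! ### Cartan data of types `C_n` and `D_n` (1-based indices) -/

/-- the Cartan matrix of type `C_n` (1-based indices). -/
def aC (n i j : ℕ) : ℤ :=
  if i = j then 2 else if i + 1 = n ∧ j = n then -2
  else if i + 1 = j ∨ j + 1 = i then -1 else 0
/-- the symmetrizing integers `d_i` of type `C_n`. -/
def dC (n i : ℕ) : ℕ := if i = n then 2 else 1
/-- the Cartan matrix of type `D_n` (1-based indices). -/
def aD (n i j : ℕ) : ℤ :=
  if i = j then 2
  else if (i + 1 = j ∧ j + 1 ≤ n) ∨ (j + 1 = i ∧ i + 1 ≤ n) then -1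
  else if (i + 2 = n ∧ j = n) ∨ (j + 2 = n ∧ i = n) then -1 else 0
/-- the symmetrizing integers `d_i` of type `D_n` (all equal to `1`). -/
def dD (n i : ℕ) : ℕ := 1

/-! ### The positive subalgebra of the quantum loop algebra, for Cartan data `(A, Dd)` -/

section Ualg
variable (n : ℕ) (A : ℕ → ℕ → ℤ) (Dd : ℕ → ℕ)

/-- the free `ℚ(v)`-algebra on generators `e_{i,r}`, `i ∈ I`, `r ∈ ℤ`. -/
abbrev FA := FreeAlgebra KK (Fin n × ℤ)
/-- the free generator `e_{i,r}`. -/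
def fg (i : Fin n) (r : ℤ) : FA n := FreeAlgebra.ι KK (i, r)

/-- the `z^{-r₁}⋯z^{-r_m}w^{-t}`-coefficient of the Serre relation between colors `i ≠ j`. -/
def serreElt (i j : Fin n) (m : ℕ) (r : Fin m → ℤ) (t : ℤ) : FA n :=
  ∑ σ : Equiv.Perm (Fin m), ∑ k ∈ Finset.range (m + 1),
    ((-1 : KK) ^ k * qBinom (vpow (Dd (i.1 + 1))) m k) •
      (((List.ofFn fun l => fg n i (r (σ l))).take k
        ++ fg n j t :: (List.ofFn fun l => fg n i (r (σ l))).drop k).prod)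

/-- the defining relations of `U_v^>(Lg)` in the new Drinfeld realization: the coefficients of
`(z - v_i^{a_ij} w) e_i(z) e_j(w) = (v_i^{a_ij} z - w) e_j(w) e_i(z)` and of the Serre relations. -/
inductive URel : FA n → FA n → Prop
  | loop (i j : Fin n) (r s : ℤ) :
      URel (fg n i (r + 1) * fg n j s
             - vpow ((Dd (i.1 + 1) : ℤ) * A (i.1 + 1) (j.1 + 1)) • (fg n i r * fg n j (s + 1)))
           (vpow ((Dd (i.1 + 1) : ℤ) * A (i.1 + 1) (j.1 + 1)) • (fg n j s * fg n i (r + 1))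
             - fg n j (s + 1) * fg n i r)
  | serre (i j : Fin n) (hij : i ≠ j) (r : Fin (1 - A (i.1 + 1) (j.1 + 1)).toNat → ℤ) (t : ℤ) :
      URel (serreElt n Dd i j _ r t) 0

/-- the positive subalgebra `U_v^>(Lg)` of the quantum loop algebra. -/
abbrev UA := RingQuot (URel n A Dd)
/-- the generator `e_{i,r}` of `U_v^>(Lg)`. -/
def ug (i : Fin n) (r : ℤ) : UA n A Dd := RingQuot.mkAlgHom KK (URel n A Dd) (fg n i r)
/-- the generator `e_{i,r}` with a 1-based index `1 ≤ i ≤ n` (and junk value `0` otherwise). -/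
def g1 (i : ℕ) (r : ℤ) : UA n A Dd := if h : 1 ≤ i ∧ i ≤ n then ug n A Dd ⟨i - 1, by omega⟩ r else 0

end Ualg

/-! ### `q`-brackets, ordered monomials, and ℤ[v,v⁻¹]-forms -/

section Aux
variable {B : Type} [Ring B] [Module KK B]

/-- the `u`-commutator `[x,y]_u = xy - u · yx`. -/
def qcm (u : KK) (x y : B) : B := x * y - u • (y * x)

/-- the iterated `q`-bracket `[⋯[[g i₁ s₁, g i₂ s₂]_{λ₁}, g i₃ s₃]_{λ₂}, ⋯]_{λ_{ℓ-1}}`. -/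
def chainE (g : ℕ → ℤ → B) (w : List ℕ) (ss : List ℤ) (ls : List KK) : B :=
  match w, ss with
  | i :: w', s :: ss' =>
      ((w'.zip ss').zip ls).foldl
        (fun acc p => acc * g p.1.1 p.1.2 - p.2 • (g p.1.1 p.1.2 * acc)) (g i s)
  | _, _ => 0
end Aux

section Mon
variable {B : Type} [Ring B] {ι : Type} [LinearOrder ι]
/-- the ordered monomial `∏→ (E p)^(h p)`, the product taken in increasing order of `p`. -/
def ordMon (E : ι → B) (h : ι →₀ ℕ) : B := ((h.support.sort (· ≤ ·)).map (fun p => E p ^ h p)).prod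
end Mon

/-- the subring `ℤ[v,v⁻¹] ⊆ ℚ(v)`. -/
def Rint : Subring KK := Subring.closure {vv, vv⁻¹}

section Forms
variable {B : Type} [Ring B] [Algebra KK B]
/-- the `ℤ[v,v⁻¹]`-subalgebra of a `ℚ(v)`-algebra generated by a set `X`, realized as the subring
generated by `X` together with the central scalars `v^{±1}`. -/
def zvForm (X : Set B) : Subring B :=
  Subring.closure ({algebraMap KK B vv, algebraMap KK B vv⁻¹} ∪ X)
end Forms

/-! ### Positive roots of type `C_n` with the fixed convex (lexicographic) order -/

section RootsC
variable (n : ℕ)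

/-- Positive roots of type `C_n`, encoded as lexicographically ordered pairs `(i,t)`:
`[i,i+t]` for `i+t<n` or `i=n`; `[i,n,i]` for `i+t=n`, `i<n`; `[i,n]` for `i+t=n+1`;
`[i,n,j]` with `j = 2n+1-i-t` for `i+t ≥ n+2`.  The induced linear order is exactly the
convex order coming from standard Lyndon words. -/
def IsPosRootC (p : Fin (n + 1) ×ₗ Fin (2 * n + 1)) : Prop :=
  1 ≤ ((ofLex p).1 : ℕ) ∧ (((ofLex p).1 : ℕ) = n → ((ofLex p).2 : ℕ) = 0) ∧
    ((ofLex p).2 : ℕ) + 2 * ((ofLex p).1 : ℕ) ≤ 2 * n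

instance : DecidablePred (IsPosRootC n) := fun p => by unfold IsPosRootC; infer_instance

/-- the set `Δ⁺` of positive roots of type `C_n`, with its convex linear order. -/
abbrev PosRootC := {p : Fin (n + 1) ×ₗ Fin (2 * n + 1) // IsPosRootC n p}

variable {n}
/-- the first index `i` of a positive root. -/
def ri (β : PosRootC n) : ℕ := ((ofLex β.1).1 : ℕ)
/-- the offset `t` of a positive root within its block. -/
def rt (β : PosRootC n) : ℕ := ((ofLex β.1).2 : ℕ)

/-- multiplicity of `α_c` (1-based color `c`) in the positive root `β` (type `C_n`). -/
def nuC (β : PosRootC n) (c : ℕ) : ℕ :=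
  let i := ri β; let t := rt β
  if i + t < n ∨ i = n then (if i ≤ c ∧ c ≤ i + t then 1 else 0)
  else if i + t = n then (if i ≤ c ∧ c ≤ n - 1 then 2 else if c = n then 1 else 0)
  else if i + t = n + 1 then (if i ≤ c ∧ c ≤ n then 1 else 0)
  else (if i ≤ c ∧ c < 2 * n + 1 - i - t then 1
        else if 2 * n + 1 - i - t ≤ c ∧ c ≤ n - 1 then 2
        else if c = n then 1 else 0)

/-- standard Lyndon word (list of 1-based simple-root indices) of `β` (type `C_n`). -/
def wordC (β : PosRootC n) : List ℕ :=
  let i := ri β; let t := rt β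
  if i + t < n ∨ i = n then List.range' i (t + 1)
  else if i + t = n then List.range' i (n - i) ++ List.range' i (n - i) ++ [n]
  else if i + t = n + 1 then List.range' i (n - i + 1)
  else List.range' i (n - i + 1) ++ (List.range' (2 * n + 1 - i - t) (n - (2 * n + 1 - i - t))).reverse

/-- the height `|β|` of a positive root (type `C_n`). -/
def heightC (β : PosRootC n) : ℕ := (wordC β).length

/-- `β` is a root of the form `[i,n,i]`. -/
def isINI (β : PosRootC n) : Prop := ri β + rt β = n ∧ ri β < n
instance (β : PosRootC n) : Decidable (isINI β) := by unfold isINI; infer_instance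
end RootsC

/-! ### General quantum root vectors of type `C_n` -/

section RVC
variable (n : ℕ)

/-- the positive subalgebra `U_v^>(Lsp_{2n})`. -/
abbrev UC := UA n (aC n) (dC n)
/-- generators of `U_v^>(Lsp_{2n})` with 1-based indices. -/
def genC : ℕ → ℤ → UC n := g1 n (aC n) (dC n)

variable {n}
/-- `E` is a quantum root vector `E_{β,s}` for a root of "chain" type, i.e. obtained by an
iterated `q`-bracket along the standard Lyndon word of `β` for some choice of the parameters
`λ_k ∈ v^ℤ` and of a decomposition of `s`. -/
def IsRVCchain (β : PosRootC n) (s : ℤ) (E : UC n) : Prop :=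
  ∃ (ss : List ℤ) (ls : List KK),
    ss.length = (wordC β).length ∧ ls.length + 1 = (wordC β).length ∧ ss.sum = s ∧
    (∀ l ∈ ls, IsVpow l) ∧ E = chainE (genC n) (wordC β) ss ls

/-- `E` is a quantum root vector `E_{β,s}` of type `C_n` for some choice of the parameters:
for `β ≠ [i,n,i]` an iterated `q`-bracket along the standard Lyndon word of `β`, and for
`β = [i,n,i]` a `q`-bracket `[E_{[i,n-1],s₁}, E_{[i,n],s₂}]_λ`. -/
def IsRVC (β : PosRootC n) (s : ℤ) (E : UC n) : Prop :=
  if isINI β then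
    ∃ (β₁ β₂ : PosRootC n) (s₁ s₂ : ℤ) (lam : KK) (E₁ E₂ : UC n),
      (ri β₁ = ri β ∧ ri β₁ + rt β₁ + 1 = n) ∧ (ri β₂ = ri β ∧ ri β₂ + rt β₂ = n + 1) ∧
      IsVpow lam ∧ IsRVCchain β₁ s₁ E₁ ∧ IsRVCchain β₂ s₂ E₂ ∧
      s = s₁ + s₂ ∧ E = qcm lam E₁ E₂
  else IsRVCchain β s E
end RVC

section Shuffle
variable (n : ℕ) (A : ℕ → ℕ → ℤ) (Dd : ℕ → ℕ)

abbrev Vars (k : Fin n → ℕ) : Type := Σ i : Fin n, Fin (k i)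
abbrev Pk (k : Fin n → ℕ) := MvPolynomial (Vars n k) KK
abbrev Fk (k : Fin n → ℕ) := FractionRing (Pk n k)

def xvr {k : Fin n → ℕ} (u : Vars n k) : Fk n k := algebraMap (Pk n k) (Fk n k) (MvPolynomial.X u)
def cf {k : Fin n → ℕ} (a : KK) : Fk n k := algebraMap KK (Fk n k) a

def emb1f (k l : Fin n → ℕ) : Vars n k → Vars n (k + l) :=
  fun u => ⟨u.1, ⟨u.2.1, by have h := u.2.2; show u.2.1 < k u.1 + l u.1; omega⟩⟩
def emb2f (k l : Fin n → ℕ) : Vars n l → Vars n (k + l) :=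
  fun u => ⟨u.1, ⟨k u.1 + u.2.1, by have h := u.2.2; show k u.1 + u.2.1 < k u.1 + l u.1; omega⟩⟩

lemma emb1f_inj (k l : Fin n → ℕ) : Function.Injective (emb1f n k l) := by
  rintro ⟨i, r⟩ ⟨j, s⟩ h
  simp only [emb1f, Sigma.mk.inj_iff] at h
  obtain ⟨rfl, h2⟩ := h
  rw [heq_iff_eq, Fin.mk.injEq] at h2
  exact congrArg _ (Fin.ext h2)

lemma emb2f_inj (k l : Fin n → ℕ) : Function.Injective (emb2f n k l) := by
  rintro ⟨i, r⟩ ⟨j, s⟩ h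
  simp only [emb2f, Sigma.mk.inj_iff] at h
  obtain ⟨rfl, h2⟩ := h
  rw [heq_iff_eq, Fin.mk.injEq] at h2
  exact congrArg _ (Fin.ext (by omega))

def permVf {m : Fin n → ℕ} (σ : ∀ i, Equiv.Perm (Fin (m i))) : Vars n m → Vars n m :=
  fun u => ⟨u.1, σ u.1 u.2⟩

lemma permVf_inj {m : Fin n → ℕ} (σ : ∀ i, Equiv.Perm (Fin (m i))) :
    Function.Injective (permVf n σ) := by
  rintro ⟨i, r⟩ ⟨j, s⟩ h
  simp only [permVf, Sigma.mk.inj_iff] at h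
  obtain ⟨rfl, h2⟩ := h
  rw [heq_iff_eq] at h2
  exact congrArg _ ((σ i).injective h2)

/-- extension of an (injective) renaming of variables to fraction fields. -/
def liftHom {k m : Fin n → ℕ} (f : Vars n k → Vars n m) (hf : Function.Injective f) :
    Fk n k →+* Fk n m :=
  IsFractionRing.lift (g := (algebraMap (Pk n m) (Fk n m)).comp
      (MvPolynomial.rename f).toRingHom)
    (by
      rw [RingHom.coe_comp]
      exact Function.Injective.comp (IsFractionRing.injective _ _)
        (by simpa using MvPolynomial.rename_injective (R := KK) f hf))

def emb1 (k l : Fin n → ℕ) : Fk n k →+* Fk n (k + l) := liftHom n (emb1f n k l) (emb1f_inj n k l)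
def emb2 (k l : Fin n → ℕ) : Fk n l →+* Fk n (k + l) := liftHom n (emb2f n k l) (emb2f_inj n k l)
def permF {m : Fin n → ℕ} (σ : ∀ i, Equiv.Perm (Fin (m i))) : Fk n m →+* Fk n m :=
  liftHom n (permVf n σ) (permVf_inj n σ)

/-- the product of `ζ`-factors in the shuffle product. -/
def zfac (k l : Fin n → ℕ) : Fk n (k + l) :=
  ∏ i : Fin n, ∏ j : Fin n, ∏ r : Fin (k i), ∏ s : Fin (l j),
    (xvr n (emb1f n k l ⟨i, r⟩) -
        cf n (vpow (-((Dd (i.1 + 1) : ℤ) * A (i.1 + 1) (j.1 + 1)))) * xvr n (emb2f n k l ⟨j, s⟩)) /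
      (xvr n (emb1f n k l ⟨i, r⟩) - xvr n (emb2f n k l ⟨j, s⟩))

/-- the shuffle product on homogeneous components. -/
def shufMul (k l : Fin n → ℕ) (F : Fk n k) (G : Fk n l) : Fk n (k + l) :=
  (((∏ i, Nat.factorial (k i)) * (∏ i, Nat.factorial (l i)) : ℕ) : KK)⁻¹ •
    ∑ σ : ∀ i : Fin n, Equiv.Perm (Fin ((k + l) i)),
      permF n σ (emb1 n k l F * emb2 n k l G * zfac n A Dd k l)

abbrev BigS := ⨁ k : Fin n → ℕ, Fk n k

open Classical in
/-- the shuffle product, extended bilinearly to the direct sum. -/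
def bstar (x y : BigS n) : BigS n :=
  DFinsupp.sum x fun k xk => DFinsupp.sum y fun l yl =>
    DirectSum.of (fun k => Fk n k) (k + l) (shufMul n A Dd k l xk yl)

def Dpoly (k : Fin n → ℕ) : Pk n k :=
  ∏ i : Fin n, ∏ j : Fin n,
    if i < j ∧ A (i.1 + 1) (j.1 + 1) ≠ 0 then
      ∏ r : Fin (k i), ∏ s : Fin (k j), (MvPolynomial.X ⟨i, r⟩ - MvPolynomial.X (⟨j, s⟩ : Vars n k))
    else 1

def xProd (k : Fin n → ℕ) : Pk n k := ∏ u : Vars n k, MvPolynomial.X u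

/-- `f` is symmetric in the variables of each color. -/
def symmQ {k : Fin n → ℕ} (f : Pk n k) : Prop :=
  ∀ σ : ∀ i, Equiv.Perm (Fin (k i)), MvPolynomial.rename (permVf n σ) f = f

def wheelSub {k : Fin n → ℕ} (i j : Fin n) (m : ℕ) (hm : 0 < m)
    (s : Fin m → Fin (k i)) (r : Fin (k j)) : Vars n k → Pk n k := fun u =>
  if u = ⟨j, r⟩ then
    MvPolynomial.C (vpow ((Dd (i.1 + 1) : ℤ) * A (i.1 + 1) (j.1 + 1))) *
      MvPolynomial.X ⟨i, s ⟨0, hm⟩⟩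
  else if h : ∃ t : Fin m, u = ⟨i, s t⟩ then
    MvPolynomial.C (vpow ((Dd (i.1 + 1) : ℤ) * (-2 * (h.choose.1 : ℤ)))) *
      MvPolynomial.X ⟨i, s ⟨0, hm⟩⟩
  else MvPolynomial.X u

/-- the wheel conditions. -/
def wheelQ {k : Fin n → ℕ} (f : Pk n k) : Prop :=
  ∀ (i j : Fin n), i ≠ j → ∀ hA : A (i.1 + 1) (j.1 + 1) < 0,
    ∀ s : Fin (1 - A (i.1 + 1) (j.1 + 1)).toNat → Fin (k i), Function.Injective s →
      ∀ r : Fin (k j),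
        MvPolynomial.aeval (wheelSub n A Dd i j _ (by omega) s r) f = 0

/-- membership in the component `S_k` of the shuffle algebra: `F = f / (denominator)` with `f`
a symmetric Laurent polynomial satisfying the wheel conditions. -/
def inS {k : Fin n → ℕ} (F : Fk n k) : Prop :=
  ∃ (f : Pk n k) (m : ℕ), symmQ n f ∧ wheelQ n A Dd f ∧
    F * algebraMap (Pk n k) (Fk n k) (Dpoly n A k * xProd n k ^ m) = algebraMap (Pk n k) (Fk n k) f

end Shuffle

section Slots
variable {R : Type} [Fintype R] [LinearOrder R]
/-- ordered enumeration of the variable slots of color `c` determined by a Kostant partition. -/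
def slots (νf : R → ℕ → ℕ) (d : R → ℕ) (c : ℕ) : List (R × ℕ × ℕ) :=
  ((Finset.univ : Finset R).sort (· ≤ ·)).flatMap fun β =>
    (List.range (d β)).flatMap fun s => (List.range (νf β c)).map fun tt => (β, s, tt)
end Slots

section SpecC
variable (n : ℕ)
abbrev WRC := MvPolynomial (PosRootC n × ℕ) KK
abbrev FWC := FractionRing (WRC n)
abbrev WR2C := MvPolynomial ((PosRootC n × ℕ) ⊕ (PosRootC n × ℕ)) KK

def wXC (p : PosRootC n × ℕ) : FWC n := algebraMap (WRC n) (FWC n) (MvPolynomial.X p)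
def cwC (a : KK) : FWC n := algebraMap KK (FWC n) a

/-- the value assigned to the variable `x^{(β,s)}_{c,t+1}` by the first-step specialization
map `φ^{(1)}` in type `C_n`. -/
def specValC (β : PosRootC n) (s tt c : ℕ) : WR2C n :=
  if isINI β then
    (if c = n then MvPolynomial.C (vpow (-(n : ℤ))) * MvPolynomial.X (Sum.inr (β, s))
     else if tt = 0 then MvPolynomial.C (vpow (1 - (c : ℤ))) * MvPolynomial.X (Sum.inl (β, s))
     else MvPolynomial.C (vpow (1 - (c : ℤ))) * MvPolynomial.X (Sum.inr (β, s)))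
  else
    (if c = n then MvPolynomial.C (vpow (-(n : ℤ))) * MvPolynomial.X (Sum.inl (β, s))
     else if tt = 0 then MvPolynomial.C (vpow (1 - (c : ℤ))) * MvPolynomial.X (Sum.inl (β, s))
     else MvPolynomial.C (vpow ((c : ℤ) - 1 - 2 * n)) * MvPolynomial.X (Sum.inl (β, s)))

def phi1subC {k : Fin n → ℕ} (d : PosRootC n → ℕ) : Vars n k → WR2C n := fun u =>
  match (slots (nuC (n := n)) d (u.1.1 + 1))[(u.2.1)]? with
  | some (β, s, tt) => specValC n β s tt (u.1.1 + 1)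
  | none => 0

def BoneC (β : PosRootC n) (s : ℕ) : WR2C n :=
  if isINI β then
    ((MvPolynomial.X (Sum.inl (β, s)) -
        MvPolynomial.C (vpow (-2)) * MvPolynomial.X (Sum.inr (β, s))) *
      (MvPolynomial.X (Sum.inl (β, s)) -
        MvPolynomial.C (vpow 2) * MvPolynomial.X (Sum.inr (β, s)))) ^ (n - ri β - 1)
  else 1

def BprodC (d : PosRootC n → ℕ) : WR2C n :=
  ∏ β : PosRootC n, ∏ s ∈ Finset.range (d β), BoneC n β s

/-- second-step substitution `w'_{β,s} ↦ v² w_{β,s}` (type `C_n`). -/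
def psi2C : WR2C n →ₐ[KK] WRC n :=
  MvPolynomial.aeval fun u => match u with
    | Sum.inl p => MvPolynomial.X p
    | Sum.inr p => MvPolynomial.C (vpow 2) * MvPolynomial.X p

/-- `PhiRelC n d F P` holds iff `P = φ_d(F)`, where `φ_d` is the (normalized, two-step)
specialization map of type `C_n` applied to the canonical Laurent numerator of `F`. -/
def PhiRelC {k : Fin n → ℕ} (d : PosRootC n → ℕ) (F : Fk n k) (P : FWC n) : Prop :=
  ∃ (m : ℕ) (g : Pk n k) (q : WR2C n),
    F * algebraMap (Pk n k) (Fk n k) (Dpoly n (aC n) k * xProd n k ^ m) =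
        algebraMap (Pk n k) (Fk n k) g ∧
    MvPolynomial.aeval (phi1subC n d) g = BprodC n d * q ∧
    P * algebraMap (WRC n) (FWC n) (psi2C n (MvPolynomial.aeval (phi1subC n d) (xProd n k ^ m)))
      = algebraMap (WRC n) (FWC n) (psi2C n q)

def nuVecC (β : PosRootC n) : Fin n → ℕ := fun i => nuC β (i.1 + 1)

def KPmemC (k : Fin n → ℕ) (d : PosRootC n → ℕ) : Prop :=
  ∀ i : Fin n, (∑ β : PosRootC n, d β * nuC β (i.1 + 1)) = k i

def KPltC (d' d : PosRootC n → ℕ) : Prop :=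
  ∃ γ : PosRootC n, d' γ < d γ ∧ ∀ β : PosRootC n, β < γ → d' β = d β
end SpecC

/-- the `i`-th coordinate vector `1_i ∈ ℕ^n`. -/
def unitVec {n : ℕ} (i : Fin n) : Fin n → ℕ := fun j => if j = i then 1 else 0

/-- the Kostant partition `δ_β` consisting of the single root `β`. -/
def dOne {R : Type} [DecidableEq R] (β : R) : R → ℕ := fun γ => if γ = β then 1 else 0

/-- the constant `c_β` of type `C_n`. -/
def cBetaC {n : ℕ} (β : PosRootC n) : KK :=
  if isINI β then qBrack 1 ^ (heightC β - 3) * qBrack 2 ^ 2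
  else if ri β + rt β = n + 1 ∧ ri β < n then qBrack 1 ^ (heightC β - 2) * qBrack 2
  else if n + 2 ≤ ri β + rt β then
    qBrack 1 ^ (heightC β - 3) * qBrack 2 *
      ∏ l ∈ Finset.Icc (2 * n + 1 - ri β - rt β) (n - 1),
        ((vpow (2 * (n : ℤ) - 2 * l) - 1) * (vpow (2 * (n : ℤ) - 2 * l + 4) - 1))
  else qBrack 1 ^ (heightC β - 1)

/-- the exponent `κ_β` of type `C_n`. -/
def kappaC {n : ℕ} (β : PosRootC n) : ℤ :=
  if isINI β then 2 * (n : ℤ) - 2 * (ri β : ℤ)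
  else if n + 2 ≤ ri β + rt β then 2 * (ri β : ℤ) + 3 * (rt β : ℤ) - 2 * (n : ℤ) - 4
  else if ri β + rt β = n + 1 then (rt β : ℤ) - 1
  else (rt β : ℤ)

/-! ### Products over ordered pairs of list entries -/

section PairProd
variable {α γ M : Type} [CommMonoid M]

/-- the product of `e p q` over all pairs of entries of a list with `p` occurring before `q`. -/
def pairProd (e : α → α → M) : List α → M
  | [] => 1
  | p :: L => (L.map (e p)).prod * pairProd e L

lemma pairProd_append (e : α → α → M) (L₁ L₂ : List α) :
    pairProd e (L₁ ++ L₂) =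
      pairProd e L₁ * pairProd e L₂ * (L₁.map fun p => (L₂.map (e p)).prod).prod := by
  induction L₁ with
  | nil => simp [pairProd]
  | cons p L ih =>
    simp only [List.cons_append, pairProd, List.map_append, List.prod_append, ih, List.map_cons,
      List.prod_cons]
    ac_rfl

lemma pairProd_map (e : α → α → M) (f : γ → α) (L : List γ) :
    pairProd e (L.map f) = pairProd (fun p q => e (f p) (f q)) L := by
  induction L with
  | nil => rfl
  | cons p L ih => simp [pairProd, ih, Function.comp_def]

lemma map_pairProd {N F : Type} [CommMonoid N] [FunLike F M N] [MonoidHomClass F M N] (φ : F)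
    (e : α → α → M) (L : List α) :
    φ (pairProd e L) = pairProd (fun p q => φ (e p q)) L := by
  induction L with
  | nil => simp [pairProd]
  | cons p L ih => simp [pairProd, ih, map_list_prod, Function.comp_def]

lemma pairProd_mul (e e' : α → α → M) (L : List α) :
    pairProd (fun p q => e p q * e' p q) L = pairProd e L * pairProd e' L := by
  induction L with
  | nil => simp [pairProd]
  | cons p L ih =>
    simp only [pairProd, ih, List.prod_map_mul]
    ac_rfl

lemma prod_prod_eq_pairProd (d : α → α → M) (hd : ∀ p, d p p = 1) (L : List α) :
    (L.map fun p => (L.map (d p)).prod).prod = pairProd (fun p q => d p q * d q p) L := by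
  induction L with
  | nil => simp [pairProd]
  | cons p L ih =>
    simp only [List.map_cons, List.prod_cons, hd, one_mul, pairProd, List.prod_map_mul, ih]
    ac_rfl

lemma pairProd_congr {e e' : α → α → M} {L : List α} (hL : L.Nodup)
    (h : ∀ p ∈ L, ∀ q ∈ L, p ≠ q → e p q = e' p q) : pairProd e L = pairProd e' L := by
  induction L with
  | nil => rfl
  | cons p L ih =>
    rw [List.nodup_cons] at hL
    simp only [pairProd]
    congr 1
    · congr 1
      refine List.map_congr_left fun q hq => h p (by simp) q (by simp [hq]) ?_
      rintro rfl
      exact hL.1 hq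
    · exact ih hL.2 fun a ha b hb => h a (by simp [ha]) b (by simp [hb])

lemma pairwise_of_pairProd_ne_zero {R : Type} [CommRing R] {e : α → α → R} {L : List α}
    (h : pairProd e L ≠ 0) : L.Pairwise fun p q => e p q ≠ 0 := by
  induction L with
  | nil => simp
  | cons p L ih =>
    simp only [pairProd] at h
    refine List.Pairwise.cons (fun q hq h0 => h ?_) (ih (right_ne_zero_of_mul h))
    rw [List.prod_eq_zero (List.mem_map.2 ⟨q, hq, h0⟩), zero_mul]

lemma List.IsChain.exists_pred {R : α → α → Prop} {a c : α} {L : List α}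
    (h : (a :: L).IsChain R) (hn : (a :: L).Nodup) (hc : c ∈ L) :
    ∃ b ∈ a :: L, b ≠ c ∧ R b c := by
  induction L generalizing a with
  | nil => simp at hc
  | cons x L ih =>
    rw [List.isChain_cons_cons] at h
    rcases List.mem_cons.1 hc with rfl | hc
    · exact ⟨a, by simp, fun h => (List.nodup_cons.1 hn).1 (by simp [h]), h.1⟩
    · obtain ⟨b, hb, hbc⟩ := ih h.2 (List.nodup_cons.1 hn).2 hc
      exact ⟨b, List.mem_cons_of_mem _ hb, hbc⟩

/-- A list satisfying `R` pairwise is determined by its entries once `R` forbids inverting any two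
neighbours of a rearrangement of it. -/
lemma List.eq_of_perm_of_isChain {R : α → α → Prop} {L L' : List α} (hp : L.Perm L')
    (hn : L'.Nodup) (hL : L.Pairwise R) (hc : L'.IsChain fun a b => ¬ R b a) : L = L' := by
  induction L' generalizing L with
  | nil => exact hp.eq_nil
  | cons a L' ih =>
    cases L with
    | nil => simp at hp
    | cons c L =>
      have hca : c = a := by
        by_contra hne
        have hcm : c ∈ a :: L' := hp.subset (by simp)
        obtain ⟨b, hb, hne', hbc⟩ := hc.exists_pred hn ((List.mem_cons.1 hcm).resolve_left hne)
        exact hbc ((List.pairwise_cons.1 hL).1 _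
          ((List.mem_cons.1 (hp.symm.subset hb)).resolve_left hne'))
      subst hca
      rw [List.perm_cons] at hp
      rw [ih hp (List.nodup_cons.1 hn).2 (List.pairwise_cons.1 hL).2 hc.tail]

end PairProd

/-! ### Divisibility of antisymmetric polynomials -/

section Antisymm
open MvPolynomial
variable {σ K : Type} [Field K]

lemma X_sub_X_ne_zero {a b : σ} (h : a ≠ b) : (X a - X b : MvPolynomial σ K) ≠ 0 :=
  sub_ne_zero.2 fun h' => h (X_injective h')

variable [DecidableEq σ]

lemma X_sub_X_dvd_sub_rename (a b : σ) (p : MvPolynomial σ K) :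
    (X a - X b : MvPolynomial σ K) ∣ p - rename (Function.update id a b) p := by
  induction p using MvPolynomial.induction_on with
  | C r => simp
  | add p q hp hq =>
    rw [map_add, add_sub_add_comm]
    exact dvd_add hp hq
  | mul_X p i hp =>
    rw [map_mul, rename_X]
    have : p * X i - rename (Function.update id a b) p * X (Function.update id a b i) =
        (p - rename (Function.update id a b) p) * X i +
          rename (Function.update id a b) p * (X i - X (Function.update id a b i)) := by ring
    rw [this]
    refine dvd_add (hp.mul_right _) (Dvd.dvd.mul_left ?_ _)
    by_cases h : i = a
    · subst h; simp
    · simp [Function.update_of_ne h]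

lemma X_sub_X_dvd_of_antisymm [CharZero K] (a b : σ) (p : MvPolynomial σ K)
    (hp : rename (Equiv.swap a b) p = -p) : (X a - X b : MvPolynomial σ K) ∣ p := by
  have h1 : rename (Function.update id a b) (rename (Equiv.swap a b) p) =
      rename (Function.update id a b) p := by
    rw [rename_rename]
    congr 2
    funext i
    by_cases h : i = a
    · subst h; by_cases hb : b = i <;> simp [Function.update, hb]
    · by_cases h' : i = b
      · subst h'; simp [h]
      · simp [Equiv.swap_apply_of_ne_of_ne h h']
  rw [hp, map_neg] at h1
  have h2 : rename (Function.update id a b) p = 0 := self_eq_neg.1 h1.symm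
  simpa [h2] using X_sub_X_dvd_sub_rename a b p

lemma prod_X_sub_X_dvd_of_antisymm [CharZero K] {ι : Type} [DecidableEq ι] (a b : ι → σ)
    (s : Finset ι) (hab : ∀ c ∈ s, a c ≠ b c)
    (hoff : ∀ c ∈ s, ∀ c' ∈ s, c ≠ c' → a c' ≠ a c ∧ a c' ≠ b c ∧ b c' ≠ a c ∧ b c' ≠ b c)
    (p : MvPolynomial σ K) (hp : ∀ c ∈ s, rename (Equiv.swap (a c) (b c)) p = -p) :
    (∏ c ∈ s, (X (a c) - X (b c)) : MvPolynomial σ K) ∣ p := by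
  induction s using Finset.induction_on generalizing p with
  | empty => simp
  | insert c s hc ih =>
    obtain ⟨q, rfl⟩ := X_sub_X_dvd_of_antisymm (a c) (b c) p (hp c (by simp))
    rw [Finset.prod_insert hc]
    refine mul_dvd_mul_left _ (ih (fun d hd => hab d (by simp [hd]))
      (fun d hd d' hd' => hoff d (by simp [hd]) d' (by simp [hd'])) q fun d hd => ?_)
    have h := hp d (by simp [hd])
    obtain ⟨h1, h2, h3, h4⟩ := hoff d (by simp [hd]) c (by simp) (by rintro rfl; exact hc hd)
    rw [map_mul, map_sub, rename_X, rename_X, Equiv.swap_apply_of_ne_of_ne h1 h2,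
      Equiv.swap_apply_of_ne_of_ne h3 h4, ← mul_neg] at h
    exact mul_left_cancel₀ (X_sub_X_ne_zero (hab c (by simp))) h

end Antisymm

/-! ### Shuffle products of generators as symmetrized products -/

section ShuffleWords
variable (n : ℕ) (A : ℕ → ℕ → ℤ) (Dd : ℕ → ℕ)

/-- the 1-based color and the 0-based position of a variable. -/
def lab {k : Fin n → ℕ} (u : Vars n k) : ℕ × ℕ := (u.1.1 + 1, u.2.1)

lemma lab_injective (k : Fin n → ℕ) : Function.Injective (lab n (k := k)) := by
  rintro ⟨i, r⟩ ⟨j, s⟩ h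
  simp only [lab, Prod.mk.injEq, add_left_inj] at h
  obtain ⟨h1, h2⟩ := h
  obtain rfl := Fin.ext h1
  rw [Fin.ext h2]

/-- the factor `ζ(x_p / x_q)`. -/
def zetaF {k : Fin n → ℕ} (p q : Vars n k) : Fk n k :=
  (xvr n p - cf n (vpow (-((Dd (p.1.1 + 1) : ℤ) * A (p.1.1 + 1) (q.1.1 + 1)))) * xvr n q) /
    (xvr n p - xvr n q)

/-- the contribution of an ordering `L` of the variables to a shuffle product of generators
with exponents `ss`. -/
def termF {k : Fin n → ℕ} (L : List (Vars n k)) (ss : List ℤ) : Fk n k :=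
  ((L.zip ss).map fun x => xvr n x.1 ^ x.2).prod * pairProd (zetaF n A Dd) L

/-- the list `L` enumerates all variables without repetition. -/
def IsEnum {α : Type} (L : List α) : Prop := L.Nodup ∧ ∀ u, u ∈ L

lemma IsEnum.map_prod {α M : Type} [Fintype α] [CommMonoid M] {L : List α} (hL : IsEnum L)
    (h : α → M) : (L.map h).prod = ∏ u, h u := by
  classical
  rw [← List.prod_toFinset h hL.1]
  congr 1
  ext u
  simp [hL.2 u]

variable {n} in
@[simp] lemma liftHom_algebraMap {k m : Fin n → ℕ} (f : Vars n k → Vars n m)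
    (hf : Function.Injective f) (p : Pk n k) :
    liftHom n f hf (algebraMap (Pk n k) (Fk n k) p) =
      algebraMap (Pk n m) (Fk n m) (MvPolynomial.rename f p) := by
  simp [liftHom]

@[simp] lemma liftHom_xvr {k m : Fin n → ℕ} (f : Vars n k → Vars n m)
    (hf : Function.Injective f) (u : Vars n k) : liftHom n f hf (xvr n u) = xvr n (f u) := by
  simp [xvr]

lemma cf_eq {k : Fin n → ℕ} (a : KK) :
    (cf n a : Fk n k) = algebraMap (Pk n k) (Fk n k) (MvPolynomial.C a) := by
  rw [cf, IsScalarTower.algebraMap_apply KK (Pk n k) (Fk n k), MvPolynomial.algebraMap_eq]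

@[simp] lemma liftHom_cf {k m : Fin n → ℕ} (f : Vars n k → Vars n m)
    (hf : Function.Injective f) (a : KK) : liftHom n f hf (cf n a) = cf n a := by
  rw [cf_eq, cf_eq, liftHom_algebraMap, MvPolynomial.rename_C]

lemma liftHom_comp {k l m : Fin n → ℕ} (f : Vars n k → Vars n l) (hf : Function.Injective f)
    (g : Vars n l → Vars n m) (hg : Function.Injective g) (F : Fk n k) :
    liftHom n g hg (liftHom n f hf F) = liftHom n (g ∘ f) (hg.comp hf) F := by
  obtain ⟨a, b, -, rfl⟩ := IsFractionRing.div_surjective (A := Pk n k) F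
  simp [map_div₀, MvPolynomial.rename_rename]

variable {n} in
lemma liftHom_zetaF {k m : Fin n → ℕ} (f : Vars n k → Vars n m) (hf : Function.Injective f)
    (hc : ∀ u, (f u).1 = u.1) (p q : Vars n k) :
    liftHom n f hf (zetaF n A Dd p q) = zetaF n A Dd (f p) (f q) := by
  simp [zetaF, hc]

variable {n} in
lemma liftHom_termF {k m : Fin n → ℕ} (f : Vars n k → Vars n m) (hf : Function.Injective f)
    (hc : ∀ u, (f u).1 = u.1) (L : List (Vars n k)) (ss : List ℤ) :
    liftHom n f hf (termF n A Dd L ss) = termF n A Dd (L.map f) ss := by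
  rw [termF, termF, map_mul, map_pairProd, pairProd_map, map_list_prod, List.map_map]
  congr 1
  · rw [List.zip_map_left, List.map_map]
    congr 2
    funext x
    simp
  · simp only [liftHom_zetaF A Dd f hf hc]

variable {n} in
lemma permF_termF {m : Fin n → ℕ} (σ : ∀ i, Equiv.Perm (Fin (m i))) (L : List (Vars n m))
    (ss : List ℤ) :
    permF n σ (termF n A Dd L ss) = termF n A Dd (L.map (permVf n σ)) ss :=
  liftHom_termF A Dd (permVf n σ) (permVf_inj n σ) (fun _ => rfl) L ss

variable {n} in
lemma permF_permF {m : Fin n → ℕ} (σ τ : ∀ i, Equiv.Perm (Fin (m i))) (F : Fk n m) :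
    permF n σ (permF n τ F) = permF n (σ * τ) F := by
  rw [permF, permF, liftHom_comp]
  rfl

lemma liftHom_smul {k m : Fin n → ℕ} (f : Vars n k → Vars n m) (hf : Function.Injective f)
    (a : KK) (F : Fk n k) : liftHom n f hf (a • F) = a • liftHom n f hf F := by
  rw [Algebra.smul_def, Algebra.smul_def, map_mul]
  congr 1
  exact liftHom_cf n f hf a

/-- the sum of the contributions of all orderings with the same colors as `L`. -/
def symF {k : Fin n → ℕ} (L : List (Vars n k)) (ss : List ℤ) : Fk n k :=
  ∑ σ : ∀ i : Fin n, Equiv.Perm (Fin (k i)), permF n σ (termF n A Dd L ss)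

instance (c : Fin n) : Unique (Vars n (unitVec c)) where
  default := ⟨c, ⟨0, by simp [unitVec]⟩⟩
  uniq := by
    rintro ⟨i, r, hr⟩
    by_cases h : i = c
    · subst h
      have h0 : r = 0 := by simp [unitVec] at hr; exact hr
      subst h0
      rfl
    · simp [unitVec, h] at hr

lemma zfac_unitVec (c : Fin n) {k : Fin n → ℕ} {L : List (Vars n k)} (hL : IsEnum L) :
    zfac n A Dd (unitVec c) k =
      (L.map fun q => zetaF n A Dd (emb1f n (unitVec c) k default) (emb2f n (unitVec c) k q)).prod := by
  rw [hL.map_prod]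
  have h1 : zfac n A Dd (unitVec c) k = ∏ i : Fin n, ∏ r : Fin (unitVec c i), ∏ q : Vars n k,
      zetaF n A Dd (emb1f n (unitVec c) k ⟨i, r⟩) (emb2f n (unitVec c) k q) := by
    rw [zfac]
    refine Finset.prod_congr rfl fun i _ => ?_
    rw [Finset.prod_comm]
    simp only [Fintype.prod_sigma]
    rw [Finset.prod_comm' (s := Finset.univ) (t' := Finset.univ) (s' := fun _ => Finset.univ)
      (t := fun _ => Finset.univ) (by simp)]
    rw [Finset.prod_comm]
    rfl
  rw [h1, ← Fintype.prod_sigma' (fun i r => ∏ q : Vars n k,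
      zetaF n A Dd (emb1f n (unitVec c) k ⟨i, r⟩) (emb2f n (unitVec c) k q)),
    Fintype.prod_unique]

/-- extension of permutations of the last `l i` of `k i + l i` variables by the identity. -/
def extPerm (k : Fin n → ℕ) {l : Fin n → ℕ} (τ : ∀ i, Equiv.Perm (Fin (l i))) (i : Fin n) :
    Equiv.Perm (Fin ((k + l) i)) :=
  (finSumFinEquiv.symm.trans ((Equiv.refl (Fin (k i))).sumCongr (τ i))).trans finSumFinEquiv

lemma permVf_extPerm_emb1f (k : Fin n → ℕ) {l : Fin n → ℕ} (τ : ∀ i, Equiv.Perm (Fin (l i)))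
    (u : Vars n k) : permVf n (extPerm n k τ) (emb1f n k l u) = emb1f n k l u := by
  obtain ⟨i, r⟩ := u
  have h : extPerm n k τ i (Fin.castAdd (l i) r) = Fin.castAdd (l i) r := by
    simp [extPerm, -finSumFinEquiv_symm_apply_castAdd,
      (by rw [Equiv.symm_apply_eq]; rfl :
        finSumFinEquiv.symm (Fin.castAdd (l i) r) = (Sum.inl r : Fin (k i) ⊕ Fin (l i)))]
  exact Sigma.ext rfl (heq_of_eq h)

lemma permVf_extPerm_emb2f (k : Fin n → ℕ) {l : Fin n → ℕ} (τ : ∀ i, Equiv.Perm (Fin (l i)))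
    (u : Vars n l) :
    permVf n (extPerm n k τ) (emb2f n k l u) = emb2f n k l (permVf n τ u) := by
  obtain ⟨i, r⟩ := u
  have h : extPerm n k τ i (Fin.natAdd (k i) r) = Fin.natAdd (k i) (τ i r) := by
    simp [extPerm, -finSumFinEquiv_symm_apply_natAdd,
      (by rw [Equiv.symm_apply_eq]; rfl :
        finSumFinEquiv.symm (Fin.natAdd (k i) r) = (Sum.inr r : Fin (k i) ⊕ Fin (l i)))]
  exact Sigma.ext rfl (heq_of_eq h)

lemma IsEnum.map_permVf {k : Fin n → ℕ} {L : List (Vars n k)} (hL : IsEnum L)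
    (σ : ∀ i, Equiv.Perm (Fin (k i))) : IsEnum (L.map (permVf n σ)) := by
  refine ⟨hL.1.map (permVf_inj n σ), fun u => List.mem_map.2
    ⟨permVf n σ⁻¹ u, hL.2 _, ?_⟩⟩
  obtain ⟨i, r⟩ := u
  exact Sigma.ext rfl (heq_of_eq ((σ i).apply_symm_apply r))

lemma IsEnum.cons_emb {c : Fin n} {k : Fin n → ℕ} {L : List (Vars n k)} (hL : IsEnum L) :
    IsEnum (emb1f n (unitVec c) k default :: L.map (emb2f n (unitVec c) k)) := by
  constructor
  · rw [List.nodup_cons]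
    refine ⟨fun h => ?_, hL.1.map (emb2f_inj n _ _)⟩
    obtain ⟨⟨i, r⟩, -, h⟩ := List.mem_map.1 h
    have h' := congrArg (lab n) h
    simp only [lab, emb2f, emb1f, Prod.mk.injEq, add_left_inj] at h'
    obtain ⟨h1, h2⟩ := h'
    obtain rfl : i = c := Fin.ext h1
    have h3 : ((default : Vars n (unitVec i)).2 : ℕ) = 0 := rfl
    rw [h3] at h2
    simp [unitVec] at h2
  · rintro ⟨i, r, hr⟩
    by_cases h : r < unitVec c i
    · refine List.mem_cons.2 (Or.inl ?_)
      rw [← Unique.eq_default (⟨i, ⟨r, h⟩⟩ : Vars n (unitVec c))]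
      rfl
    · refine List.mem_cons.2 (Or.inr (List.mem_map.2
        ⟨⟨i, ⟨r - unitVec c i, by have : r < unitVec c i + k i := hr; omega⟩⟩, hL.2 _, ?_⟩))
      have : unitVec c i + (r - unitVec c i) = r := by omega
      simp [emb2f, this]

lemma shufMul_gen (c : Fin n) (s : ℤ) {k : Fin n → ℕ} {L : List (Vars n k)} (hL : IsEnum L)
    (ss : List ℤ) :
    shufMul n A Dd (unitVec c) k (xvr n (default : Vars n (unitVec c)) ^ s) (symF n A Dd L ss) =
      symF n A Dd (emb1f n (unitVec c) k default :: L.map (emb2f n (unitVec c) k)) (s :: ss) := by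
  set T := termF n A Dd (emb1f n (unitVec c) k default :: L.map (emb2f n (unitVec c) k)) (s :: ss)
    with hT
  have h1 : emb1 n (unitVec c) k (xvr n (default : Vars n (unitVec c)) ^ s) *
      emb2 n (unitVec c) k (symF n A Dd L ss) * zfac n A Dd (unitVec c) k =
      ∑ τ : ∀ i : Fin n, Equiv.Perm (Fin (k i)), permF n (extPerm n (unitVec c) τ) T := by
    rw [symF, map_sum, Finset.mul_sum, Finset.sum_mul]
    refine Finset.sum_congr rfl fun τ _ => ?_
    rw [permF_termF, emb2, liftHom_termF A Dd (emb2f n (unitVec c) k) (emb2f_inj n _ _) (fun _ => rfl), hT, permF_termF,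
      zfac_unitVec n A Dd c (IsEnum.map_permVf n hL τ), emb1, map_zpow₀, liftHom_xvr]
    simp only [List.map_cons, permVf_extPerm_emb1f, List.map_map, termF, List.zip_cons_cons,
      List.prod_cons, pairProd, Function.comp_def, permVf_extPerm_emb2f]
    ring
  rw [shufMul, h1]
  simp only [map_sum, permF_permF]
  rw [Finset.sum_comm]
  have h2 : ∀ τ : ∀ i : Fin n, Equiv.Perm (Fin (k i)),
      ∑ σ, permF n (σ * extPerm n (unitVec c) τ) T = ∑ σ, permF n σ T := fun τ =>
    Equiv.sum_comp (Equiv.mulRight (extPerm n (unitVec c) τ)) (fun σ => permF n σ T)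
  simp only [h2, Finset.sum_const, Finset.card_univ]
  have h3 : (∏ i, (unitVec c i).factorial) = 1 := by
    refine Finset.prod_eq_one fun i _ => ?_
    by_cases h : i = c <;> simp [unitVec, h]
  rw [h3, one_mul, Fintype.card_pi]
  simp only [Fintype.card_perm, Fintype.card_fin]
  rw [← Nat.cast_smul_eq_nsmul KK, smul_smul, inv_mul_cancel₀, one_smul, symF]
  exact Nat.cast_ne_zero.2 (Finset.prod_ne_zero_iff.2 fun i _ => Nat.factorial_ne_zero _)

lemma shufMul_zero_left (k l : Fin n → ℕ) (G : Fk n l) : shufMul n A Dd k l 0 G = 0 := by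
  simp [shufMul]

lemma shufMul_zero_right (k l : Fin n → ℕ) (F : Fk n k) : shufMul n A Dd k l F 0 = 0 := by
  simp [shufMul]

lemma bstar_of (k l : Fin n → ℕ) (F : Fk n k) (G : Fk n l) :
    bstar n A Dd (DirectSum.of (fun k => Fk n k) k F) (DirectSum.of (fun k => Fk n k) l G) =
      DirectSum.of (fun k => Fk n k) (k + l) (shufMul n A Dd k l F G) := by
  classical
  unfold bstar
  have h1 : ∀ (k : Fin n → ℕ) (F : Fk n k),
      DirectSum.of (fun k => Fk n k) k F = DFinsupp.single k F := fun _ _ => by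
    rfl
  rw [h1 k F, h1 l G]
  rw [DFinsupp.sum_single_index, DFinsupp.sum_single_index]
  · rw [shufMul_zero_right]
    exact map_zero _
  · refine (Finset.sum_congr rfl fun m _ => ?_).trans Finset.sum_const_zero
    beta_reduce
    rw [shufMul_zero_left]
    exact map_zero _

/-- the product of generators along a word in letters `(color, exponent)` with 1-based colors. -/
def wordProd (ω : List (ℕ × ℤ)) : UA n A Dd := (ω.map fun p => g1 n A Dd p.1 p.2).prod

lemma exists_enum_wordProd (Ψ : UA n A Dd →ₗ[KK] BigS n)
    (hmul : ∀ a b, Ψ (a * b) = bstar n A Dd (Ψ a) (Ψ b))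
    (hone : Ψ 1 = DirectSum.of (fun k => Fk n k) 0 1)
    (hgen : ∀ (i : Fin n) (r : ℤ), Ψ (ug n A Dd i r) =
        DirectSum.of (fun k => Fk n k) (unitVec i) (xvr n (default : Vars n (unitVec i)) ^ r))
    (ω : List (ℕ × ℤ)) (hω : ∀ p ∈ ω, 1 ≤ p.1 ∧ p.1 ≤ n) :
    ∃ (k : Fin n → ℕ) (L : List (Vars n k)), IsEnum L ∧
      L.map (fun u => (lab n u).1) = ω.map Prod.fst ∧
      Ψ (wordProd n A Dd ω) = DirectSum.of (fun k => Fk n k) k (symF n A Dd L (ω.map Prod.snd)) := by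
  induction ω with
  | nil =>
    refine ⟨0, [], ⟨by simp, fun u => u.2.elim0⟩, rfl, ?_⟩
    rw [wordProd, List.map_nil, List.prod_nil, hone]
    congr 1
    have : Subsingleton (∀ i : Fin n, Equiv.Perm (Fin ((0 : Fin n → ℕ) i))) :=
      ⟨fun a b => funext fun i => Equiv.ext fun x => x.elim0⟩
    rw [symF, Fintype.sum_subsingleton _ 1, permF_termF]
    simp [termF, pairProd]
  | cons p ω ih =>
    obtain ⟨k, L, hL, hc, h⟩ := ih fun q hq => hω q (by simp [hq])
    have hp := hω p (by simp)
    refine ⟨_, _, IsEnum.cons_emb n (c := ⟨p.1 - 1, by omega⟩) hL, ?_, ?_⟩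
    · simp only [List.map_cons, List.map_map, ← hc]
      refine congrArg₂ _ ?_ rfl
      show p.1 - 1 + 1 = p.1
      omega
    · rw [wordProd, List.map_cons, List.prod_cons, hmul, ← wordProd, h, g1, dif_pos hp, hgen,
        bstar_of, shufMul_gen n A Dd _ _ hL]
      rfl

lemma exists_perm_map_eq {k : Fin n → ℕ} {L L' : List (Vars n k)} (hL : IsEnum L)
    (hL' : IsEnum L') (hc : L.map (fun u => (lab n u).1) = L'.map (fun u => (lab n u).1)) :
    ∃ σ : ∀ i, Equiv.Perm (Fin (k i)), L.map (permVf n σ) = L' := by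
  have hlen : L.length = L'.length := by simpa using congrArg List.length hc
  have h0 : ∀ u, ∃ (m : ℕ) (h : m < L.length) (h' : m < L'.length), L[m] = u ∧ L'[m].1 = u.1 := by
    intro u
    obtain ⟨m, hm, rfl⟩ := List.mem_iff_getElem.1 (hL.2 u)
    refine ⟨m, hm, hlen ▸ hm, rfl, ?_⟩
    have h1 : (L.map (fun u => (lab n u).1))[m]? = (L'.map (fun u => (lab n u).1))[m]? := by rw [hc]
    rw [List.getElem?_map, List.getElem?_map, List.getElem?_eq_getElem hm,
      List.getElem?_eq_getElem (hlen ▸ hm)] at h1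
    simp only [Option.map_some, lab, Option.some.injEq, add_left_inj] at h1
    exact (Fin.ext h1).symm
  have h1 : ∀ (i : Fin n) (r : Fin (k i)), ∃ (r' : Fin (k i)) (m : ℕ) (h : m < L.length)
      (h' : m < L'.length), L[m] = ⟨i, r⟩ ∧ L'[m] = ⟨i, r'⟩ := by
    intro i r
    obtain ⟨m, h, h', h1, h2⟩ := h0 ⟨i, r⟩
    generalize hu : L'[m] = u at h2
    obtain ⟨j, s⟩ := u
    obtain rfl : j = i := h2
    exact ⟨s, m, h, h', h1, hu⟩
  choose f m hm hm' hf hf' using h1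
  have hinj : ∀ i, Function.Injective (f i) := by
    intro i r s hrs
    have h2 : L'[m i r]'(hm' i r) = L'[m i s]'(hm' i s) := by rw [hf', hf', hrs]
    have h3 := (List.Nodup.getElem_inj_iff hL'.1).1 h2
    have h4 : (⟨i, r⟩ : Vars n k) = ⟨i, s⟩ := by rw [← hf i r, ← hf i s]; simp only [h3]
    exact eq_of_heq (Sigma.mk.inj h4).2
  refine ⟨fun i => Equiv.ofBijective (f i) (Finite.injective_iff_bijective.1 (hinj i)), ?_⟩
  refine List.ext_getElem (by simpa using hlen) fun a ha ha' => ?_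
  rw [List.getElem_map]
  have ha0 : a < L.length := by simpa using ha
  generalize hu : L[a] = u
  obtain ⟨i, r⟩ := u
  have h5 : m i r = a := (List.Nodup.getElem_inj_iff hL.1).1 ((hf i r).trans hu.symm)
  simp only [permVf, Equiv.ofBijective_apply]
  rw [← hf' i r]
  simp only [h5]

lemma permVf_map_injective {k : Fin n → ℕ} {L : List (Vars n k)} (hL : IsEnum L)
    {σ τ : ∀ i, Equiv.Perm (Fin (k i))} (h : L.map (permVf n σ) = L.map (permVf n τ)) : σ = τ := by
  funext i
  ext r
  have := List.map_inj_left.1 h ⟨i, r⟩ (hL.2 _)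
  rw [permVf, permVf, Sigma.mk.inj_iff] at this
  exact congrArg Fin.val (eq_of_heq this.2)

lemma IsEnum.count_colors {k : Fin n → ℕ} {L : List (Vars n k)} (hL : IsEnum L) (i : Fin n) :
    (L.map fun u => (lab n u).1).count (i.1 + 1) = k i := by
  classical
  rw [List.count_eq_countP, List.countP_map, List.countP_eq_length_filter,
    ← List.toFinset_card_of_nodup (hL.1.filter _)]
  have : (List.filter ((fun x => x == i.1 + 1) ∘ fun u => (lab n u).1) L).toFinset =
      Finset.univ.map (Function.Embedding.sigmaMk (β := fun i : Fin n => Fin (k i)) i) := by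
    ext ⟨j, s⟩
    simp only [List.mem_toFinset, List.mem_filter, hL.2, true_and, lab, Function.comp,
      beq_iff_eq, add_left_inj, Finset.mem_map, Finset.mem_univ, Function.Embedding.sigmaMk_apply,
      Sigma.mk.inj_iff]
    constructor
    · intro h
      obtain rfl := Fin.ext h
      exact ⟨s, rfl, HEq.rfl⟩
    · rintro ⟨r, h, -⟩
      rw [h]
  rw [this, Finset.card_map, Finset.card_univ, Fintype.card_fin]

end ShuffleWords

/-! ### Polynomial numerators -/

section Numerators
open MvPolynomial
variable (n : ℕ) (A : ℕ → ℕ → ℤ) (Dd : ℕ → ℕ)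

/-- the numerator, up to a sign, of the factor `ζ` for variables with labels `x`, `y` and
values `a`, `b`; it is `1` for orthogonal colors. -/
def pairNum {R : Type} [CommRing R] [Algebra KK R] (x y : ℕ × ℕ) (a b : R) : R :=
  if A x.1 y.1 = 0 then 1
  else (if x.1 < y.1 ∨ (x.1 = y.1 ∧ x.2 < y.2) then 1 else -1) *
    (a - algebraMap KK R (vpow (-((Dd x.1 : ℤ) * A x.1 y.1))) * b)

lemma map_pairNum {R S : Type} [CommRing R] [Algebra KK R] [CommRing S] [Algebra KK S]
    (φ : R →ₐ[KK] S) (x y : ℕ × ℕ) (a b : R) :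
    φ (pairNum A Dd x y a b) = pairNum A Dd x y (φ a) (φ b) := by
  unfold pairNum
  split_ifs <;> simp

/-- the factor of the denominator of a shuffle element for variables of different colors. -/
def dTerm {k : Fin n → ℕ} (p q : Vars n k) : Pk n k :=
  if p.1 < q.1 ∧ A (p.1.1 + 1) (q.1.1 + 1) ≠ 0 then X p - X q else 1

/-- the difference of two variables of the same color. -/
def nTerm {k : Fin n → ℕ} (p q : Vars n k) : Pk n k :=
  if p.1 = q.1 ∧ p.2.1 < q.2.1 then X p - X q else 1

/-- the product of the differences of variables of the same color. -/
def Npoly (k : Fin n → ℕ) : Pk n k := ∏ p : Vars n k, ∏ q : Vars n k, nTerm n p q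

/-- the polynomial numerator of `termF`. -/
def termP {k : Fin n → ℕ} (M : ℕ) (L : List (Vars n k)) (ss : List ℤ) : Pk n k :=
  ((L.zip ss).map fun x : Vars n k × ℤ => (X x.1 : Pk n k) ^ (x.2 + (M : ℤ)).toNat).prod *
    pairProd (fun p q => pairNum A Dd (lab n p) (lab n q) (X p : Pk n k) (X q)) L

lemma Dpoly_eq (k : Fin n → ℕ) :
    Dpoly n A k = ∏ p : Vars n k, ∏ q : Vars n k, dTerm n A p q := by
  simp only [Fintype.prod_sigma, Dpoly, dTerm]
  refine Finset.prod_congr rfl fun i _ => ?_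
  rw [Finset.prod_comm]
  refine Finset.prod_congr rfl fun j _ => ?_
  split_ifs with h
  · rfl
  · simp

lemma dTerm_self {k : Fin n → ℕ} (p : Vars n k) : dTerm n A p p = 1 := by simp [dTerm]
lemma nTerm_self {k : Fin n → ℕ} (p : Vars n k) : nTerm n p p = 1 := by simp [nTerm]

lemma IsEnum.prod_prod_eq {α M : Type} [Fintype α] [CommMonoid M] {L : List α} (hL : IsEnum L)
    (d : α → α → M) (hd : ∀ p, d p p = 1) :
    ∏ p, ∏ q, d p q = pairProd (fun p q => d p q * d q p) L := by
  rw [← prod_prod_eq_pairProd d hd, ← hL.map_prod]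
  congr 1
  exact List.map_congr_left fun p _ => (hL.map_prod _).symm

lemma xvr_ne_zero {k : Fin n → ℕ} (p : Vars n k) : xvr n p ≠ 0 := by
  rw [xvr, Ne, FaithfulSMul.algebraMap_eq_zero_iff]
  exact X_ne_zero p

lemma xvr_sub_ne_zero {k : Fin n → ℕ} {p q : Vars n k} (h : p ≠ q) : xvr n p - xvr n q ≠ 0 := by
  rw [xvr, xvr, ← map_sub, Ne, FaithfulSMul.algebraMap_eq_zero_iff]
  exact X_sub_X_ne_zero h

variable {A} in
lemma zetaF_mul (hA : ∀ c c', A c c' = 0 ↔ A c' c = 0) (hA' : ∀ c, A c c ≠ 0)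
    {k : Fin n → ℕ} {p q : Vars n k} (h : p ≠ q) :
    zetaF n A Dd p q * algebraMap (Pk n k) (Fk n k) (dTerm n A p q * dTerm n A q p) *
      algebraMap (Pk n k) (Fk n k) (nTerm n p q * nTerm n q p) =
      algebraMap (Pk n k) (Fk n k)
        (pairNum A Dd (lab n p) (lab n q) (X p : Pk n k) (X q)) := by
  have h1 := xvr_sub_ne_zero n h
  have h1' := xvr_sub_ne_zero n h.symm
  have hp : algebraMap (Pk n k) (Fk n k) (X p) = xvr n p := rfl
  have hq : algebraMap (Pk n k) (Fk n k) (X q) = xvr n q := rfl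
  have hs : xvr n q - xvr n p = -(xvr n p - xvr n q) := by ring
  have hcf : ∀ a, algebraMap (Pk n k) (Fk n k) (algebraMap KK (Pk n k) a) = cf n a := fun a =>
    (cf_eq n a).symm
  by_cases h0 : A (p.1.1 + 1) (q.1.1 + 1) = 0
  · have h0' := (hA _ _).1 h0
    have hne : p.1 ≠ q.1 := by
      intro hpq
      rw [hpq] at h0
      exact hA' _ h0
    have hc1 : (cf n 1 : Fk n k) = 1 := map_one (algebraMap KK (Fk n k))
    simp [zetaF, dTerm, nTerm, pairNum, lab, h0, h0', hne, hne.symm, vpow, hc1, div_self h1]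
  · have h0' := mt (hA _ _).2 h0
    rcases lt_trichotomy p.1 q.1 with hlt | heq | hgt
    · have hn : ¬ q.1 < p.1 := not_lt.2 hlt.le
      have hlt' : p.1.1 < q.1.1 := hlt
      simp only [zetaF, dTerm, nTerm, pairNum, lab, h0, h0', hlt, hlt.ne, hlt.ne', hn, hlt',
        add_lt_add_iff_right, true_or, ne_eq, not_false_eq_true, and_true, if_true, if_false,
        false_and, mul_one, one_mul, map_sub, map_one, map_mul, hp, hq, hcf]
      field_simp
    · have hv : p.2.1 ≠ q.2.1 := by
        intro hv
        exact h (lab_injective n k (Prod.ext (by simp [lab, heq]) hv))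
      have heq1 : p.1.1 = q.1.1 := congrArg Fin.val heq
      rcases lt_or_gt_of_ne hv with hlt | hgt
      · have hn : ¬ q.2.1 < p.2.1 := not_lt.2 hlt.le
        simp only [zetaF, dTerm, nTerm, pairNum, lab, heq.symm, hlt, hn,
          lt_irrefl, false_or, and_true, if_true, if_false, true_and,
          false_and, mul_one, one_mul, map_sub, map_one, hp, hq]
        rw [if_neg (by rw [heq1.symm] at h0; exact h0)]
        field_simp
        simp only [map_sub, map_mul, hp, hq, hcf]
      · have hn : ¬ p.2.1 < q.2.1 := not_lt.2 hgt.le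
        simp only [zetaF, dTerm, nTerm, pairNum, lab, heq.symm, hgt, hn,
          lt_irrefl, false_or, and_true, if_true, if_false, and_false,
          false_and, mul_one, one_mul, map_sub, map_one, hp, hq, hs]
        rw [if_neg (by rw [heq1.symm] at h0; exact h0)]
        field_simp
        simp only [map_sub, map_mul, map_neg, map_one, hp, hq, hcf]
        ring
    · have hn : ¬ p.1 < q.1 := not_lt.2 hgt.le
      have hgt' : ¬ p.1.1 < q.1.1 := hn
      have hne : ¬ p.1.1 + 1 = q.1.1 + 1 := by
        have : q.1.1 < p.1.1 := hgt
        omega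
      simp only [zetaF, dTerm, nTerm, pairNum, lab, h0, h0', hgt, hgt.ne, hgt.ne', hn, hgt', hne,
        add_lt_add_iff_right, or_false, ne_eq, not_false_eq_true, and_true, if_true, if_false,
        false_and, mul_one, one_mul, map_sub, map_one, map_mul, map_neg, hp, hq, hcf, hs]
      field_simp

lemma zip_prod_mul_pow {k : Fin n → ℕ} (M : ℕ) (L : List (Vars n k)) (ss : List ℤ)
    (hl : ss.length = L.length) (hM : ∀ s ∈ ss, -(M : ℤ) ≤ s) :
    ((L.zip ss).map fun x : Vars n k × ℤ => xvr n x.1 ^ x.2).prod * ((L.map fun p => xvr n p).prod) ^ M =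
      ((L.zip ss).map fun x : Vars n k × ℤ => xvr n x.1 ^ (x.2 + (M : ℤ)).toNat).prod := by
  induction L generalizing ss with
  | nil => simp
  | cons p L ih =>
    cases ss with
    | nil => simp at hl
    | cons s ss =>
      have h1 := ih ss (by simpa using hl) fun t ht => hM t (by simp [ht])
      have h2 : xvr n p ^ s * xvr n p ^ M = xvr n p ^ (s + M).toNat := by
        rw [← zpow_natCast, ← zpow_natCast, ← zpow_add₀ (xvr_ne_zero n p)]
        congr 1
        have := hM s (by simp)
        omega
      simp only [List.zip_cons_cons, List.map_cons, List.prod_cons, mul_pow, ← h1, ← h2]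
      ring

variable {A} in
lemma termF_mul (hA : ∀ c c', A c c' = 0 ↔ A c' c = 0) (hA' : ∀ c, A c c ≠ 0)
    {k : Fin n → ℕ} {L : List (Vars n k)} (hL : IsEnum L) (M : ℕ) (ss : List ℤ)
    (hl : ss.length = L.length) (hM : ∀ s ∈ ss, -(M : ℤ) ≤ s) :
    termF n A Dd L ss * algebraMap (Pk n k) (Fk n k) (Dpoly n A k * Npoly n k * xProd n k ^ M) =
      algebraMap (Pk n k) (Fk n k) (termP n A Dd M L ss) := by
  have h1 : algebraMap (Pk n k) (Fk n k) (xProd n k ^ M) = ((L.map fun p => xvr n p).prod) ^ M := by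
    rw [map_pow, xProd, ← hL.map_prod, map_list_prod, List.map_map]
    rfl
  rw [Dpoly_eq, Npoly, hL.prod_prod_eq _ (dTerm_self n A), hL.prod_prod_eq _ (nTerm_self n),
    map_mul, map_mul, h1, map_pairProd, map_pairProd, termF, termP, map_mul, map_pairProd,
    map_list_prod, List.map_map]
  have h2 := zip_prod_mul_pow n M L ss hl hM
  have h3 : pairProd (zetaF n A Dd) L *
      pairProd (fun p q => algebraMap (Pk n k) (Fk n k) (dTerm n A p q * dTerm n A q p)) L *
      pairProd (fun p q => algebraMap (Pk n k) (Fk n k) (nTerm n p q * nTerm n q p)) L =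
      pairProd (fun p q => algebraMap (Pk n k) (Fk n k)
        (pairNum A Dd (lab n p) (lab n q) (X p : Pk n k) (X q))) L := by
    rw [← pairProd_mul, ← pairProd_mul]
    exact pairProd_congr hL.1 fun p _ q _ h => zetaF_mul n Dd hA hA' h
  rw [← h3]
  have h4 : ((L.zip ss).map ((algebraMap (Pk n k) (Fk n k)) ∘
      fun x : Vars n k × ℤ => (X x.1 : Pk n k) ^ (x.2 + (M : ℤ)).toNat)).prod =
      ((L.zip ss).map fun x : Vars n k × ℤ => xvr n x.1 ^ (x.2 + (M : ℤ)).toNat).prod := by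
    congr 1
    refine List.map_congr_left fun x _ => ?_
    simp [xvr]
  rw [h4, ← h2]
  ring

/-! ### Cancellation of the poles along variables of the same color -/

lemma permVf_bijective {k : Fin n → ℕ} (σ : ∀ i, Equiv.Perm (Fin (k i))) :
    Function.Bijective (permVf n σ) :=
  Finite.injective_iff_bijective.1 (permVf_inj n σ)

lemma rename_Dpoly {k : Fin n → ℕ} (σ : ∀ i, Equiv.Perm (Fin (k i))) :
    rename (permVf n σ) (Dpoly n A k) = Dpoly n A k := by
  have h : ∀ p q : Vars n k,
      rename (permVf n σ) (dTerm n A p q) = dTerm n A (permVf n σ p) (permVf n σ q) := by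
    intro p q
    by_cases hpq : p.1 < q.1 ∧ A (p.1.1 + 1) (q.1.1 + 1) ≠ 0
    · rw [dTerm, dTerm, if_pos hpq, if_pos (by exact hpq), map_sub, rename_X, rename_X]
    · rw [dTerm, dTerm, if_neg hpq, if_neg (by exact hpq), map_one]
  rw [Dpoly_eq, map_prod]
  refine Fintype.prod_bijective _ (permVf_bijective n σ) _ _ fun p => ?_
  rw [map_prod]
  exact Fintype.prod_bijective _ (permVf_bijective n σ) _ _ fun q => h p q

lemma rename_xProd {k : Fin n → ℕ} (σ : ∀ i, Equiv.Perm (Fin (k i))) :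
    rename (permVf n σ) (xProd n k) = xProd n k := by
  rw [xProd, map_prod]
  exact Fintype.prod_bijective _ (permVf_bijective n σ) _ _ fun q => rename_X _ _

variable {n} in
/-- the first variable of a color with two variables. -/
def fstVar {k : Fin n → ℕ} (c : {c : Fin n // k c = 2}) : Vars n k := ⟨c.1, ⟨0, by rw [c.2]; omega⟩⟩
variable {n} in
/-- the second variable of a color with two variables. -/
def sndVar {k : Fin n → ℕ} (c : {c : Fin n // k c = 2}) : Vars n k := ⟨c.1, ⟨1, by rw [c.2]; omega⟩⟩

lemma Npoly_eq {k : Fin n → ℕ} (hk : ∀ c, k c ≤ 2) :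
    Npoly n k = ∏ c : {c : Fin n // k c = 2}, (X (fstVar c) - X (sndVar c)) := by
  have h1 : Npoly n k = ∏ i : Fin n, ∏ r : Fin (k i), ∏ s : Fin (k i),
      if r.1 < s.1 then (X ⟨i, r⟩ - X ⟨i, s⟩ : Pk n k) else 1 := by
    rw [Npoly, Fintype.prod_sigma]
    refine Finset.prod_congr rfl fun i _ => Finset.prod_congr rfl fun r _ => ?_
    rw [Fintype.prod_sigma, Finset.prod_eq_single i]
    · simp [nTerm]
    · intro j _ hj
      simp [nTerm, hj.symm]
    · simp
  have h2 : ∀ (m : ℕ) (hm : m = 2) (f : Fin m → Pk n k),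
      (∏ r : Fin m, ∏ s : Fin m, if r.1 < s.1 then f r - f s else 1) =
        f ⟨0, by omega⟩ - f ⟨1, by omega⟩ := by
    intro m hm f
    subst hm
    simp [Fin.prod_univ_two]
  have h3 : ∀ (m : ℕ) (hm : m < 2) (f : Fin m → Pk n k),
      (∏ r : Fin m, ∏ s : Fin m, if r.1 < s.1 then f r - f s else 1) = 1 := by
    intro m hm f
    refine Finset.prod_eq_one fun r _ => Finset.prod_eq_one fun s _ => if_neg ?_
    omega
  rw [h1, ← Finset.prod_subset (Finset.subset_univ (Finset.univ.filter fun c => k c = 2))]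
  · rw [Finset.prod_subtype (p := fun c => k c = 2) _ (by simp)]
    exact Finset.prod_congr rfl fun c _ => h2 (k c) c.2 fun r => X ⟨c.1, r⟩
  · intro c _ hc
    have : k c < 2 := lt_of_le_of_ne (hk c) (by simpa using hc)
    exact h3 _ this fun r => X ⟨c, r⟩

lemma Npoly_ne_zero (k : Fin n → ℕ) : Npoly n k ≠ 0 := by
  rw [Npoly]
  refine Finset.prod_ne_zero_iff.2 fun p _ => Finset.prod_ne_zero_iff.2 fun q _ => ?_
  rw [nTerm]
  split_ifs with h
  · refine X_sub_X_ne_zero ?_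
    rintro rfl
    exact lt_irrefl _ h.2
  · exact one_ne_zero

lemma Npoly_dvd {k : Fin n → ℕ} (hk : ∀ c, k c ≤ 2) {F : Fk n k}
    (hF : ∀ σ : ∀ i, Equiv.Perm (Fin (k i)), permF n σ F = F) {M : ℕ} {G : Pk n k}
    (hG : F * algebraMap (Pk n k) (Fk n k) (Dpoly n A k * Npoly n k * xProd n k ^ M) =
      algebraMap (Pk n k) (Fk n k) G) : Npoly n k ∣ G := by
  have hoff : ∀ c : {c : Fin n // k c = 2}, ∀ c', c ≠ c' → fstVar c' ≠ fstVar c ∧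
      fstVar c' ≠ sndVar c ∧ sndVar c' ≠ fstVar c ∧ sndVar c' ≠ sndVar c := by
    intro c c' hne
    refine ⟨?_, ?_, ?_, ?_⟩ <;> intro h <;> exact hne (Subtype.ext (congrArg Sigma.fst h).symm)
  have hfs : ∀ c : {c : Fin n // k c = 2}, fstVar c ≠ sndVar c := by
    intro c h
    have := congrArg (fun u => (lab n u).2) h
    simp [lab, fstVar, sndVar] at this
  rw [Npoly_eq n hk]
  refine prod_X_sub_X_dvd_of_antisymm fstVar sndVar _ (fun c _ => hfs c)
    (fun c _ c' _ => hoff c c') G fun c _ => ?_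
  set σ : ∀ i, Equiv.Perm (Fin (k i)) := Function.update 1 c.1
    (Equiv.swap ⟨0, by rw [c.2]; omega⟩ ⟨1, by rw [c.2]; omega⟩) with hσ
  have h1 : permVf n σ = Equiv.swap (fstVar c) (sndVar c) := by
    funext ⟨i, r⟩
    by_cases hi : i = c.1
    · subst hi
      rw [permVf, hσ, Function.update_self]
      rw [Equiv.swap_apply_def, Equiv.swap_apply_def]
      simp only [fstVar, sndVar, Sigma.mk.inj_iff, heq_eq_eq, true_and]
      split_ifs <;> rfl
    · rw [Equiv.swap_apply_of_ne_of_ne]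
      · simp [permVf, hσ, hi]
      · intro h; exact hi (congrArg Sigma.fst h)
      · intro h; exact hi (congrArg Sigma.fst h)
  have h2 : rename (permVf n σ) (Npoly n k) = -Npoly n k := by
    rw [Npoly_eq n hk, map_prod, ← Finset.mul_prod_erase _ _ (Finset.mem_univ c),
      ← Finset.mul_prod_erase _ (fun c => (X (fstVar c) - X (sndVar c) : Pk n k))
        (Finset.mem_univ c), ← neg_mul]
    congr 1
    · simp [h1]
    · refine Finset.prod_congr rfl fun c' hc' => ?_
      obtain ⟨e1, e2, e3, e4⟩ := hoff c c' (Finset.ne_of_mem_erase hc').symm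
      rw [h1, map_sub, rename_X, rename_X, Equiv.swap_apply_of_ne_of_ne e1 e2,
        Equiv.swap_apply_of_ne_of_ne e3 e4]
  have h3 := congrArg (permF n σ) hG
  have h4 : rename (permVf n σ) (Dpoly n A k * Npoly n k * xProd n k ^ M) =
      -(Dpoly n A k * Npoly n k * xProd n k ^ M) := by
    rw [map_mul, map_mul, map_pow, rename_Dpoly, rename_xProd, h2]
    ring
  rw [map_mul, hF, permF, liftHom_algebraMap, liftHom_algebraMap, h4, map_neg, mul_neg, hG,
    ← map_neg] at h3
  rw [← h1]
  exact (IsFractionRing.injective (Pk n k) (Fk n k) h3).symm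

end Numerators

/-! ### Monomial scalars -/

/-- the scalars of the form `c·v^m` with `c ∈ ℚ^×` and `m ∈ ℤ`. -/
def IsMonomialScalar (u : KK) : Prop :=
  ∃ (c : ℚ) (m : ℤ), c ≠ 0 ∧ u = algebraMap ℚ KK c * vpow m

lemma vv_ne_zero : vv ≠ 0 := RatFunc.X_ne_zero

lemma vpow_ne_zero (m : ℤ) : vpow m ≠ 0 := zpow_ne_zero _ vv_ne_zero

lemma vpow_add (a b : ℤ) : vpow (a + b) = vpow a * vpow b := zpow_add₀ vv_ne_zero a b

@[simp] lemma vpow_zero : vpow 0 = 1 := zpow_zero vv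

namespace IsMonomialScalar

lemma vpow (m : ℤ) : IsMonomialScalar (vpow m) := ⟨1, m, one_ne_zero, by simp⟩

lemma one : IsMonomialScalar 1 := by simpa using vpow 0

lemma mul {a b : KK} (ha : IsMonomialScalar a) (hb : IsMonomialScalar b) :
    IsMonomialScalar (a * b) := by
  obtain ⟨c, m, hc, rfl⟩ := ha
  obtain ⟨c', m', hc', rfl⟩ := hb
  exact ⟨c * c', m + m', mul_ne_zero hc hc', by rw [vpow_add, map_mul]; ring⟩

lemma neg {a : KK} (ha : IsMonomialScalar a) : IsMonomialScalar (-a) := by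
  obtain ⟨c, m, hc, rfl⟩ := ha
  exact ⟨-c, m, neg_ne_zero.2 hc, by rw [map_neg]; ring⟩

lemma inv {a : KK} (ha : IsMonomialScalar a) : IsMonomialScalar a⁻¹ := by
  obtain ⟨c, m, hc, rfl⟩ := ha
  refine ⟨c⁻¹, -m, inv_ne_zero hc, ?_⟩
  rw [mul_inv, map_inv₀, _root_.vpow, _root_.vpow, zpow_neg]

lemma pow {a : KK} (ha : IsMonomialScalar a) (k : ℕ) : IsMonomialScalar (a ^ k) := by
  induction k with
  | zero => simpa using one
  | succ k ih => rw [pow_succ]; exact ih.mul ha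

lemma prod {ι : Type} (s : Finset ι) (f : ι → KK) (h : ∀ i ∈ s, IsMonomialScalar (f i)) :
    IsMonomialScalar (∏ i ∈ s, f i) :=
  Finset.prod_induction f IsMonomialScalar (fun _ _ => mul) one h

lemma ne_zero {a : KK} (ha : IsMonomialScalar a) : a ≠ 0 := by
  obtain ⟨c, m, hc, rfl⟩ := ha
  exact mul_ne_zero (by simpa using hc) (vpow_ne_zero m)

end IsMonomialScalar

lemma IsVpow.isMonomialScalar {l : KK} (h : IsVpow l) : IsMonomialScalar l := by
  obtain ⟨m, rfl⟩ := h
  exact .vpow m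

/-! ### Expansion of iterated brackets into words -/

section Expansion
variable (n : ℕ) (A : ℕ → ℕ → ℤ) (Dd : ℕ → ℕ)

/-- the span of the words obtained from `T` by permuting its letters. -/
def wordSpan (T : List (ℕ × ℤ)) : Submodule KK (UA n A Dd) :=
  Submodule.span KK {x | ∃ ω, ω.Perm T ∧ x = wordProd n A Dd ω}

/-- the span of the words obtained from `T` by permuting its letters, whose underlying sequence
of colors is not the reverse of that of `T`. -/
def offSpan (T : List (ℕ × ℤ)) : Submodule KK (UA n A Dd) :=
  Submodule.span KK {x | ∃ ω, ω.Perm T ∧ ω.map Prod.fst ≠ (T.map Prod.fst).reverse ∧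
    x = wordProd n A Dd ω}

lemma offSpan_le_wordSpan (T : List (ℕ × ℤ)) : offSpan n A Dd T ≤ wordSpan n A Dd T :=
  Submodule.span_mono fun _ ⟨ω, h, _, hx⟩ => ⟨ω, h, hx⟩

lemma wordProd_append (ω ω' : List (ℕ × ℤ)) :
    wordProd n A Dd (ω ++ ω') = wordProd n A Dd ω * wordProd n A Dd ω' := by
  simp [wordProd]

/-- the iterated `q`-bracket along a list of letters and parameters. -/
def bracketFold (p : ℕ × ℤ) (zs : List ((ℕ × ℤ) × KK)) : UA n A Dd :=
  zs.foldl (fun acc p => acc * g1 n A Dd p.1.1 p.1.2 - p.2 • (g1 n A Dd p.1.1 p.1.2 * acc))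
    (g1 n A Dd p.1 p.2)

lemma bracketFold_eq (p : ℕ × ℤ) (zs : List ((ℕ × ℤ) × KK)) (hz : ∀ z ∈ zs, IsVpow z.2)
    (hp : ∀ z ∈ zs, z.1.1 ≠ p.1) :
    ∃ a, IsMonomialScalar a ∧ ∃ R ∈ offSpan n A Dd (p :: zs.map Prod.fst),
      bracketFold n A Dd p zs = a • wordProd n A Dd (p :: zs.map Prod.fst).reverse + R := by
  induction zs using List.reverseRecOn with
  | nil => exact ⟨1, .one, 0, Submodule.zero_mem _, by simp [bracketFold, wordProd]⟩
  | append_singleton zs z ih =>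
    obtain ⟨a, ha, R, hR, hE⟩ := ih (fun y hy => hz y (by simp [hy])) fun y hy => hp y (by simp [hy])
    set T := p :: zs.map Prod.fst with hT
    have hT' : p :: (zs ++ [z]).map Prod.fst = T ++ [z.1] := by simp [hT]
    have hg : g1 n A Dd z.1.1 z.1.2 = wordProd n A Dd [z.1] := by simp [wordProd]
    have hfold : bracketFold n A Dd p (zs ++ [z]) = bracketFold n A Dd p zs * wordProd n A Dd [z.1] -
        z.2 • (wordProd n A Dd [z.1] * bracketFold n A Dd p zs) := by
      rw [← hg, bracketFold, List.foldl_append]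
      rfl
    have hW : bracketFold n A Dd p zs ∈ wordSpan n A Dd T := by
      rw [hE]
      refine Submodule.add_mem _ (Submodule.smul_mem _ _ (Submodule.subset_span ?_))
        (offSpan_le_wordSpan n A Dd T hR)
      exact ⟨_, List.reverse_perm T, rfl⟩
    have h1 : ∀ x ∈ wordSpan n A Dd T, x * wordProd n A Dd [z.1] ∈ offSpan n A Dd (T ++ [z.1]) := by
      intro x hx
      induction hx using Submodule.span_induction with
      | mem x hx =>
        obtain ⟨ω, hω, rfl⟩ := hx
        refine Submodule.subset_span ⟨ω ++ [z.1], hω.append_right _, ?_, by rw [wordProd_append]⟩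
        intro h
        have h := congrArg List.getLast? h
        rw [hT, List.cons_append, List.map_cons, List.reverse_cons, List.map_append, List.map_cons,
          List.map_nil, List.getLast?_concat, List.getLast?_concat] at h
        exact hp z (by simp) (Option.some.inj h)
      | zero => simp
      | add x y _ _ hx hy => rw [add_mul]; exact Submodule.add_mem _ hx hy
      | smul c x _ hx => rw [smul_mul_assoc]; exact Submodule.smul_mem _ _ hx
    have h2 : ∀ x ∈ offSpan n A Dd T, wordProd n A Dd [z.1] * x ∈ offSpan n A Dd (T ++ [z.1]) := by
      intro x hx
      induction hx using Submodule.span_induction with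
      | mem x hx =>
        obtain ⟨ω, hω, hne, rfl⟩ := hx
        refine Submodule.subset_span ⟨[z.1] ++ ω, ?_, ?_, by rw [wordProd_append]⟩
        · exact (List.perm_append_comm).trans (hω.append_right _)
        · simpa using hne
      | zero => simp
      | add x y _ _ hx hy => rw [mul_add]; exact Submodule.add_mem _ hx hy
      | smul c x _ hx => rw [mul_smul_comm]; exact Submodule.smul_mem _ _ hx
    refine ⟨-(z.2 * a), ((hz z (by simp)).isMonomialScalar.mul ha).neg,
      bracketFold n A Dd p zs * wordProd n A Dd [z.1] - z.2 • (wordProd n A Dd [z.1] * R), ?_, ?_⟩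
    · rw [hT']
      exact Submodule.sub_mem _ (h1 _ hW) (Submodule.smul_mem _ _ (h2 _ hR))
    · have h3 : wordProd n A Dd (T ++ [z.1]).reverse =
          wordProd n A Dd [z.1] * wordProd n A Dd T.reverse := by
        rw [List.reverse_append, wordProd_append, List.reverse_singleton]
      rw [hT', h3, hfold]
      conv_lhs => rw [hE]
      conv_rhs => rw [hE]
      have h4 : ∀ x : UA n A Dd, (-(z.2 * a)) • x = -((z.2 * a) • x) := fun x => neg_smul (M := UA n A Dd) _ x
      rw [mul_add, mul_smul_comm, smul_add, smul_smul, h4]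
      abel

lemma chainE_eq (i : ℕ) (w : List ℕ) (ss : List ℤ) (ls : List KK) (hi : i ∉ w)
    (hss : ss.length = (i :: w).length) (hls : ls.length + 1 = (i :: w).length)
    (hv : ∀ l ∈ ls, IsVpow l) :
    ∃ a, IsMonomialScalar a ∧ ∃ R ∈ offSpan n A Dd ((i :: w).zip ss),
      chainE (g1 n A Dd) (i :: w) ss ls =
        a • wordProd n A Dd ((i :: w).zip ss).reverse + R := by
  cases ss with
  | nil => simp at hss
  | cons s ss =>
    simp only [List.length_cons, add_left_inj] at hss hls
    have h1 : ((w.zip ss).zip ls).map Prod.fst = w.zip ss :=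
      List.map_fst_zip (by simp [hss, hls])
    have h2 := bracketFold_eq n A Dd (i, s) ((w.zip ss).zip ls)
      (fun z hz => hv _ (List.of_mem_zip hz).2)
      (fun z hz (h : z.1.1 = i) => hi (h ▸ (List.of_mem_zip (List.of_mem_zip hz).1).1))
    rw [h1] at h2
    exact h2

end Expansion

/-! ### Numerators of images of words -/

section Core
open MvPolynomial
variable (n : ℕ) {A : ℕ → ℕ → ℤ} (Dd : ℕ → ℕ)

lemma permF_symF {k : Fin n → ℕ} (τ : ∀ i, Equiv.Perm (Fin (k i))) (L : List (Vars n k))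
    (ss : List ℤ) : permF n τ (symF n A Dd L ss) = symF n A Dd L ss := by
  rw [symF, map_sum]
  simp only [permF_permF]
  exact Equiv.sum_comp (Equiv.mulLeft τ) (fun σ => permF n σ (termF n A Dd L ss))

lemma symF_mul (hA : ∀ c c', A c c' = 0 ↔ A c' c = 0) (hA' : ∀ c, A c c ≠ 0)
    {k : Fin n → ℕ} {L : List (Vars n k)} (hL : IsEnum L) (M : ℕ) (ss : List ℤ)
    (hl : ss.length = L.length) (hM : ∀ s ∈ ss, -(M : ℤ) ≤ s) :
    symF n A Dd L ss * algebraMap (Pk n k) (Fk n k) (Dpoly n A k * Npoly n k * xProd n k ^ M) =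
      algebraMap (Pk n k) (Fk n k) (∑ σ, termP n A Dd M (L.map (permVf n σ)) ss) := by
  rw [symF, Finset.sum_mul, map_sum]
  refine Finset.sum_congr rfl fun σ _ => ?_
  rw [permF_termF, termF_mul n Dd hA hA' (hL.map_permVf n σ) M ss (by simpa using hl) hM]

variable (Ψ : UA n A Dd →ₗ[KK] BigS n)
  (hmul : ∀ a b, Ψ (a * b) = bstar n A Dd (Ψ a) (Ψ b))
  (hone : Ψ 1 = DirectSum.of (fun k => Fk n k) 0 1)
  (hgen : ∀ (i : Fin n) (r : ℤ), Ψ (ug n A Dd i r) =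
    DirectSum.of (fun k => Fk n k) (unitVec i) (xvr n (default : Vars n (unitVec i)) ^ r))

include hmul hone hgen in
lemma exists_symF {k : Fin n → ℕ} {Ls : List (Vars n k)} (hLs : IsEnum Ls) (ω : List (ℕ × ℤ))
    (hω : (ω.map Prod.fst).Perm (Ls.map fun u => (lab n u).1)) :
    ∃ L : List (Vars n k), IsEnum L ∧ L.map (fun u => (lab n u).1) = ω.map Prod.fst ∧
      (Ψ (wordProd n A Dd ω)) k = symF n A Dd L (ω.map Prod.snd) := by
  obtain ⟨k', L, hL, hcol, h⟩ := exists_enum_wordProd n A Dd Ψ hmul hone hgen ω fun p hp => by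
    obtain ⟨u, -, hu⟩ := List.mem_map.1 (hω.subset (List.mem_map_of_mem hp))
    rw [← hu]
    exact ⟨Nat.succ_pos _, u.1.2⟩
  obtain rfl : k' = k := by
    funext i
    rw [← hL.count_colors n i, ← hLs.count_colors n i, hcol, hω.count_eq]
  exact ⟨L, hL, hcol, by rw [h, DirectSum.of_eq_same]⟩

variable {R : Type} [CommRing R] [Algebra KK R] {k : Fin n → ℕ} (φ : Pk n k →ₐ[KK] R)
  (I : Ideal R) (M : ℕ)

variable (A) in
/-- `G` is the numerator of `F` with respect to the full denominator. -/
def IsNumerator (F : Fk n k) (G : Pk n k) : Prop :=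
  F * algebraMap (Pk n k) (Fk n k) (Dpoly n A k * Npoly n k * xProd n k ^ M) =
    algebraMap (Pk n k) (Fk n k) G

/-- the elements whose degree `k` image is symmetric with numerator specializing into `I`. -/
def vanishingSub : Submodule KK (UA n A Dd) where
  carrier := {y | (∀ σ, permF n σ ((Ψ y) k) = (Ψ y) k) ∧
    ∃ G, IsNumerator n A M ((Ψ y) k) G ∧ φ G ∈ I}
  zero_mem' := by
    refine ⟨fun σ => ?_, 0, ?_, ?_⟩
    · rw [map_zero, DirectSum.zero_apply, map_zero]
    · rw [IsNumerator, map_zero, DirectSum.zero_apply, map_zero, zero_mul]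
    · rw [map_zero]; exact I.zero_mem
  add_mem' := by
    rintro x y ⟨hx, G, hG, hGI⟩ ⟨hy, H, hH, hHI⟩
    rw [IsNumerator] at hG hH
    refine ⟨fun σ => ?_, G + H, ?_, ?_⟩
    · rw [map_add, DirectSum.add_apply, map_add, hx, hy]
    · rw [IsNumerator, map_add, DirectSum.add_apply, add_mul, hG, hH, map_add]
    · rw [map_add]; exact I.add_mem hGI hHI
  smul_mem' := by
    rintro c x ⟨hx, G, hG, hGI⟩
    rw [IsNumerator] at hG
    refine ⟨fun σ => ?_, c • G, ?_, ?_⟩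
    · rw [map_smul, DirectSum.smul_apply, permF, liftHom_smul, ← permF, hx]
    · rw [IsNumerator, map_smul, DirectSum.smul_apply, smul_mul_assoc, hG,
        Algebra.algebraMap_eq_smul_one, Algebra.algebraMap_eq_smul_one, smul_assoc]
    · rw [map_smul, Algebra.smul_def]; exact I.mul_mem_left _ hGI

include hmul hone hgen in
/-- An element which is a multiple of a distinguished word, up to words all of whose terms
specialize into `I`, has a numerator whose specialization is determined modulo `I` by a single
term. -/
theorem exists_numerator (hA : ∀ c c', A c c' = 0 ↔ A c' c = 0) (hA' : ∀ c, A c c ≠ 0)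
    (hk : ∀ c, k c ≤ 2) (P : List ℕ → Prop) {Ls : List (Vars n k)} (hLs : IsEnum Ls)
    (hterm : ∀ (L : List (Vars n k)) (ss : List ℤ), IsEnum L → P (L.map fun u => (lab n u).1) →
      L.map (lab n) ≠ Ls.map (lab n) → φ (termP n A Dd M L ss) ∈ I)
    (ω : List (ℕ × ℤ)) (hω : ω.map Prod.fst = Ls.map fun u => (lab n u).1)
    (hP : P (ω.map Prod.fst)) (hM : ∀ p ∈ ω, -(M : ℤ) ≤ p.2) (a : KK) (y : UA n A Dd)
    (hy : y ∈ Submodule.span KK {x | ∃ ω' : List (ℕ × ℤ), ω'.Perm ω ∧ P (ω'.map Prod.fst) ∧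
      ω'.map Prod.fst ≠ ω.map Prod.fst ∧ x = wordProd n A Dd ω'}) :
    ∃ g, (Ψ (a • wordProd n A Dd ω + y)) k *
        algebraMap (Pk n k) (Fk n k) (Dpoly n A k * xProd n k ^ M) =
          algebraMap (Pk n k) (Fk n k) g ∧
      φ (Npoly n k) * φ g - algebraMap KK R a * φ (termP n A Dd M Ls (ω.map Prod.snd)) ∈ I := by
  classical
  have hlen : ∀ (ω' : List (ℕ × ℤ)) (L : List (Vars n k)),
      L.map (fun u => (lab n u).1) = ω'.map Prod.fst →
        (ω'.map Prod.snd).length = L.length := by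
    intro ω' L h
    simpa using (congrArg List.length h).symm
  have hbd : ∀ ω' : List (ℕ × ℤ), ω'.Perm ω → ∀ s ∈ ω'.map Prod.snd, -(M : ℤ) ≤ s := by
    intro ω' h s hs
    obtain ⟨p, hp, rfl⟩ := List.mem_map.1 hs
    exact hM p (h.subset hp)
  have hcolP : ∀ (L : List (Vars n k)) (σ : ∀ i, Equiv.Perm (Fin (k i))),
      (L.map (permVf n σ)).map (fun u => (lab n u).1) = L.map fun u => (lab n u).1 := by
    intro L σ
    rw [List.map_map]
    rfl
  have hyV : y ∈ vanishingSub n Dd Ψ φ I M := by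
    refine Submodule.span_le.2 ?_ hy
    rintro _ ⟨ω', hperm, hP', hne, rfl⟩
    obtain ⟨L, hL, hcol, hΨ⟩ := exists_symF n Dd Ψ hmul hone hgen hLs ω'
      (hω ▸ hperm.map Prod.fst)
    refine ⟨fun σ => ?_, ∑ σ, termP n A Dd M (L.map (permVf n σ)) (ω'.map Prod.snd), ?_, ?_⟩
    · rw [hΨ, permF_symF]
    · rw [IsNumerator, hΨ]
      exact symF_mul n Dd hA hA' hL M _ (hlen ω' L hcol) (hbd ω' hperm)
    · rw [map_sum]
      refine I.sum_mem fun σ _ => hterm _ _ (hL.map_permVf n σ) ?_ ?_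
      · rw [hcolP, hcol]; exact hP'
      · intro h
        refine hne ?_
        rw [← hcol, hω, ← hcolP L σ]
        have h := congrArg (List.map Prod.fst) h
        simp only [List.map_map] at h ⊢
        exact h
  obtain ⟨hsym, G₂, hG₂, hI₂⟩ := hyV
  obtain ⟨L, hL, hcol, hΨ⟩ := exists_symF n Dd Ψ hmul hone hgen hLs ω (hω ▸ List.Perm.refl _)
  set G₁ := ∑ σ, termP n A Dd M (L.map (permVf n σ)) (ω.map Prod.snd) with hG₁
  have hnum := symF_mul n Dd hA hA' hL M (ω.map Prod.snd) (hlen ω L hcol) (hbd ω (List.Perm.refl _))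
  obtain ⟨σ₀, hσ₀⟩ := exists_perm_map_eq n hL hLs (hcol.trans hω)
  have hI₁ : φ G₁ - φ (termP n A Dd M Ls (ω.map Prod.snd)) ∈ I := by
    rw [hG₁, ← Finset.add_sum_erase _ _ (Finset.mem_univ σ₀), hσ₀, map_add, add_sub_cancel_left,
      map_sum]
    refine I.sum_mem fun σ hσ => hterm _ _ (hL.map_permVf n σ) ?_ ?_
    · rw [hcolP, hcol]; exact hP
    · intro h
      refine Finset.ne_of_mem_erase hσ (permVf_map_injective n hL ?_)
      rw [hσ₀]
      exact (List.map_injective_iff.2 (lab_injective n k)) h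
  have hΨE : (Ψ (a • wordProd n A Dd ω + y)) k =
      a • symF n A Dd L (ω.map Prod.snd) + (Ψ y) k := by
    rw [map_add, map_smul, DirectSum.add_apply, DirectSum.smul_apply, hΨ]
  have hE : IsNumerator n A M ((Ψ (a • wordProd n A Dd ω + y)) k) (a • G₁ + G₂) := by
    rw [IsNumerator] at hG₂ ⊢
    rw [hΨE, add_mul, hG₂, smul_mul_assoc, hnum, map_add]
    congr 1
    rw [Algebra.algebraMap_eq_smul_one, Algebra.algebraMap_eq_smul_one, smul_assoc]
  obtain ⟨g, hg⟩ := Npoly_dvd n A hk (fun σ => by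
    rw [hΨE, map_add, hsym, permF, liftHom_smul, ← permF, permF_symF]) hE
  refine ⟨g, ?_, ?_⟩
  · refine mul_right_cancel₀ (b := algebraMap (Pk n k) (Fk n k) (Npoly n k)) ?_ ?_
    · rw [Ne, FaithfulSMul.algebraMap_eq_zero_iff]
      exact Npoly_ne_zero n k
    · rw [IsNumerator, hg, map_mul, map_mul, map_mul] at hE
      rw [map_mul, mul_comm (algebraMap (Pk n k) (Fk n k) g), ← hE]
      ring
  · rw [← map_mul, ← hg, map_add, map_smul, Algebra.smul_def]
    have := I.add_mem (I.mul_mem_left (algebraMap KK R a) hI₁) hI₂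
    convert this using 1
    ring

end Core

/-! ### The first specialization step in terms of labels -/

section SpecLabels
open MvPolynomial
variable {n : ℕ} (β : PosRootC n)

lemma List.flatMap_ite_eq {α γ : Type} [DecidableEq α] {L : List α} (hL : L.Nodup) {a : α}
    (ha : a ∈ L) (f : α → List γ) :
    (L.flatMap fun b => if b = a then f b else []) = f a := by
  induction L with
  | nil => simp at ha
  | cons c L ih =>
    rw [List.nodup_cons] at hL
    rw [List.flatMap_cons]
    by_cases hc : c = a
    · subst hc
      have : (L.flatMap fun b => if b = c then f b else []) = [] := by
        rw [List.flatMap_eq_nil_iff]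
        rintro x hx
        rw [if_neg]
        rintro rfl
        exact hL.1 hx
      simp [this]
    · rw [if_neg hc, ih hL.2 (List.mem_of_ne_of_mem (Ne.symm hc) ha), List.nil_append]

lemma slots_dOne (c : ℕ) :
    slots (nuC (n := n)) (dOne β) c = (List.range (nuC β c)).map fun tt => (β, 0, tt) := by
  rw [slots, ← List.flatMap_ite_eq (Finset.sort_nodup Finset.univ (· ≤ ·))
    (a := β) (by simp) (fun β' => (List.range (nuC β' c)).map fun tt => (β', 0, tt))]
  refine List.flatMap_congr fun γ _ => ?_
  by_cases h : γ = β
  · simp [dOne, h, List.range_one]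
  · simp [dOne, h]

/-- the value of the variable labelled `p` under the first specialization step. -/
def labVal (p : ℕ × ℕ) : WR2C n := specValC n β 0 p.2 p.1

lemma phi1subC_dOne (u : Vars n (nuVecC n β)) :
    phi1subC n (dOne β) u = labVal β (lab n u) := by
  have h : u.2.1 < nuC β (u.1.1 + 1) := u.2.2
  simp [phi1subC, slots_dOne, labVal, lab, h]

/-- the first specialization step attached to the single root `β`. -/
def phi1 : Pk n (nuVecC n β) →ₐ[KK] WR2C n := aeval (phi1subC n (dOne β))

lemma phi1_X (u : Vars n (nuVecC n β)) : phi1 β (X u) = labVal β (lab n u) := by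
  rw [phi1, aeval_X, phi1subC_dOne]

/-- the specialized factor attached to an ordered pair of labels. -/
def labNum (x y : ℕ × ℕ) : WR2C n := pairNum (aC n) (dC n) x y (labVal β x) (labVal β y)

lemma phi1_pairProd (L : List (Vars n (nuVecC n β))) :
    phi1 β (pairProd (fun p q => pairNum (aC n) (dC n) (lab n p) (lab n q)
      (X p : Pk n (nuVecC n β)) (X q)) L) = pairProd (labNum β) (L.map (lab n)) := by
  rw [map_pairProd, pairProd_map]
  simp only [map_pairNum, phi1_X, labNum]

lemma phi1_termP (M : ℕ) (L : List (Vars n (nuVecC n β))) (ss : List ℤ) :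
    phi1 β (termP n (aC n) (dC n) M L ss) =
      (((L.map (lab n)).zip ss).map fun x => labVal β x.1 ^ (x.2 + (M : ℤ)).toNat).prod *
        pairProd (labNum β) (L.map (lab n)) := by
  rw [termP, map_mul, phi1_pairProd, map_list_prod, List.map_map, List.zip_map_left, List.map_map]
  congr 2
  refine List.map_congr_left fun x _ => ?_
  simp [phi1_X]

lemma phi1_xProd {L : List (Vars n (nuVecC n β))} (hL : IsEnum L) :
    phi1 β (xProd n _) = ((L.map (lab n)).map (labVal β)).prod := by
  rw [xProd, ← hL.map_prod, map_list_prod, List.map_map, List.map_map]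
  congr 1
  refine List.map_congr_left fun x _ => ?_
  simp [phi1_X]

lemma BprodC_dOne : BprodC n (dOne β) = BoneC n β 0 := by
  rw [BprodC, Finset.prod_eq_single β]
  · simp [dOne]
  · intro γ _ h
    simp [dOne, h]
  · simp

lemma nuC_le_two (c : ℕ) : nuC β c ≤ 2 := by
  unfold nuC
  dsimp only
  split_ifs <;> omega

lemma exists_enum_labels {Λ : List (ℕ × ℕ)} (hΛ : Λ.Nodup)
    (hmem : ∀ p, p ∈ Λ ↔ (1 ≤ p.1 ∧ p.1 ≤ n) ∧ p.2 < nuC β p.1) :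
    ∃ L : List (Vars n (nuVecC n β)), IsEnum L ∧ L.map (lab n) = Λ := by
  have h1 : ∀ p ∈ Λ, p ∈ Set.range (lab n (k := nuVecC n β)) := by
    intro p hp
    obtain ⟨⟨h1, h2⟩, h3⟩ := (hmem p).1 hp
    refine ⟨⟨⟨p.1 - 1, by omega⟩, ⟨p.2, ?_⟩⟩, ?_⟩
    · simpa [nuVecC, Nat.sub_add_cancel h1] using h3
    · ext
      · simp only [lab]; omega
      · rfl
  obtain ⟨L, hL⟩ : Λ ∈ Set.range (List.map (lab n (k := nuVecC n β))) := by
    rw [Set.range_list_map]; exact h1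
  refine ⟨L, ⟨?_, fun u => ?_⟩, hL⟩
  · rw [← hL] at hΛ
    exact List.Nodup.of_map _ hΛ
  · have : lab n u ∈ Λ := (hmem _).2 ⟨⟨Nat.succ_pos _, u.1.2⟩, u.2.2⟩
    rw [← hL] at this
    obtain ⟨v, hv, h⟩ := List.mem_map.1 this
    rwa [← lab_injective n _ h]

lemma IsEnum.perm_map {α γ : Type} {L L' : List α} (hL : IsEnum L) (hL' : IsEnum L') (f : α → γ) :
    (L.map f).Perm (L'.map f) :=
  ((List.perm_ext_iff_of_nodup hL.1 hL'.1).2 fun u => by simp [hL.2 u, hL'.2 u]).map f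

lemma phi1_Npoly {a b : ℕ} (ha : 1 ≤ a) (hb : b ≤ n)
    (hab : ∀ c, 1 ≤ c → c ≤ n → (nuC β c = 2 ↔ a ≤ c ∧ c ≤ b)) :
    phi1 β (Npoly n _) = ∏ c ∈ Finset.Icc a b, (labVal β (c, 0) - labVal β (c, 1)) := by
  rw [Npoly_eq n (k := nuVecC n β) fun c => nuC_le_two β _, map_prod]
  refine Finset.prod_bij' (fun c _ => c.1.1 + 1)
    (fun c hc => ⟨⟨c - 1, by rw [Finset.mem_Icc] at hc; omega⟩, ?_⟩) ?_ ?_ ?_ ?_ ?_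
  · rw [Finset.mem_Icc] at hc
    simp only [nuVecC]
    rw [Nat.sub_add_cancel (by omega)]
    exact (hab c (by omega) (by omega)).2 hc
  · intro c _
    rw [Finset.mem_Icc]
    exact (hab _ (by omega) (by omega)).1 c.2
  · intro c _
    simp
  · intro c _
    rfl
  · intro c hc
    rw [Finset.mem_Icc] at hc
    simp only
    omega
  · intro c _
    rw [map_sub, phi1_X, phi1_X]
    rfl

end SpecLabels

/-! ### Equality up to monomial scalars -/

section EqMon

/-- `a = u * c` for some monomial scalar `u`. -/
def EqMon (a c : KK) : Prop := ∃ u, IsMonomialScalar u ∧ a = u * c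

lemma EqMon.refl (a : KK) : EqMon a a := ⟨1, .one, (one_mul a).symm⟩

lemma EqMon.neg {a c : KK} (h : EqMon a c) : EqMon (-a) c := by
  obtain ⟨u, hu, rfl⟩ := h
  exact ⟨-u, hu.neg, by ring⟩

lemma EqMon.mul {a c a' c' : KK} (h : EqMon a c) (h' : EqMon a' c') :
    EqMon (a * a') (c * c') := by
  obtain ⟨u, hu, rfl⟩ := h
  obtain ⟨u', hu', rfl⟩ := h'
  exact ⟨u * u', hu.mul hu', by ring⟩

lemma EqMon.symm {a c : KK} (h : EqMon a c) : EqMon c a := by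
  obtain ⟨u, hu, rfl⟩ := h
  exact ⟨u⁻¹, hu.inv, by rw [inv_mul_cancel_left₀ hu.ne_zero]⟩

lemma EqMon.trans {a b c : KK} (h : EqMon a b) (h' : EqMon b c) : EqMon a c := by
  obtain ⟨u, hu, rfl⟩ := h
  obtain ⟨u', hu', rfl⟩ := h'
  exact ⟨u * u', hu.mul hu', by ring⟩

lemma EqMon.ne_zero {a c : KK} (h : EqMon a c) (hc : c ≠ 0) : a ≠ 0 := by
  obtain ⟨u, hu, rfl⟩ := h
  exact mul_ne_zero hu.ne_zero hc

lemma EqMon.pow {a c : KK} (h : EqMon a c) (k : ℕ) : EqMon (a ^ k) (c ^ k) := by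
  obtain ⟨u, hu, rfl⟩ := h
  exact ⟨u ^ k, hu.pow k, by ring⟩

lemma vpow_sub_vpow_eqMon {a b : ℤ} (k : ℤ) (h : a = b + k ∨ b = a + k) :
    EqMon (vpow a - vpow b) (vpow k - 1) := by
  rcases h with rfl | rfl
  · exact ⟨vpow b, .vpow b, by rw [vpow_add]; ring⟩
  · exact ⟨-vpow a, (IsMonomialScalar.vpow a).neg, by rw [vpow_add]; ring⟩

lemma vpow_sub_one_eqMon (k : ℕ) : EqMon (vpow (2 * k) - 1) (qBrack k) :=
  ⟨vpow k, .vpow k, by rw [qBrack, mul_sub, ← vpow_add, ← vpow_add]; simp [two_mul]⟩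

lemma vpow_sub_vpow_qBrack {a b : ℤ} (k : ℕ) (h : a = b + 2 * k ∨ b = a + 2 * k) :
    EqMon (vpow a - vpow b) (qBrack k) :=
  (vpow_sub_vpow_eqMon (2 * k) h).trans (vpow_sub_one_eqMon k)

lemma vpow_injective : Function.Injective vpow := by
  have h1 : ∀ k : ℕ, 0 < k → vpow k ≠ 1 := by
    intro k hk h
    have h2 : (RatFunc.X : RatFunc ℚ) ^ k = 1 := by simpa [vpow, vv] using h
    rw [← RatFunc.algebraMap_X, ← map_pow, ← map_one (algebraMap (Polynomial ℚ) (RatFunc ℚ))] at h2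
    have h3 := congrArg Polynomial.natDegree (RatFunc.algebraMap_injective ℚ h2)
    simp at h3
    omega
  have h2 : ∀ a b : ℤ, vpow a = vpow b → a ≤ b := by
    intro a b h
    by_contra hab
    obtain ⟨k, hk⟩ := Int.eq_ofNat_of_zero_le (a := a - b) (by omega)
    refine h1 k (by omega) ?_
    have : vpow (b + k) = vpow b := by rw [← h]; congr 1; omega
    rw [vpow_add] at this
    exact mul_left_cancel₀ (vpow_ne_zero b) (by rw [this, mul_one])
  exact fun a b h => le_antisymm (h2 a b h) (h2 b a h.symm)

end EqMon

/-! ### Specialization of chain root vectors -/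

section ChainSpec
open MvPolynomial
variable {n : ℕ} {β : PosRootC n}

variable (n) in
/-- the exponent of `v` in the specialization of the variable labelled `p`. -/
def labExp (p : ℕ × ℕ) : ℤ :=
  if p.1 = n then -(n : ℤ) else if p.2 = 0 then 1 - p.1 else p.1 - 1 - 2 * n

variable (β) in
/-- the variable `w` of the root `β`. -/
def wVar : WR2C n := X (Sum.inl (β, 0))

lemma labVal_eq (h : ¬ isINI β) (p : ℕ × ℕ) :
    labVal β p = C (vpow (labExp n p)) * wVar β := by
  unfold labVal specValC labExp wVar
  rw [if_neg h]
  split_ifs <;> rfl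

variable (n) in
/-- the label pair whose exponents make the specialized factor vanish or not. -/
def pairExp (x y : ℕ × ℕ) : ℤ := labExp n y - (dC n x.1 : ℤ) * aC n x.1 y.1

lemma labNum_eq_one {x y : ℕ × ℕ} (ha : aC n x.1 y.1 = 0) : labNum β x y = 1 := by
  rw [labNum, pairNum, if_pos ha]

lemma labNum_eq (h : ¬ isINI β) {x y : ℕ × ℕ} (ha : aC n x.1 y.1 ≠ 0) :
    ∃ u, IsMonomialScalar u ∧
      labNum β x y = C (u * (vpow (labExp n x) - vpow (pairExp n x y))) * wVar β := by
  have h2 : vpow (pairExp n x y) =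
      vpow (-((dC n x.1 : ℤ) * aC n x.1 y.1)) * vpow (labExp n y) := by
    rw [← vpow_add, pairExp]
    congr 1
    ring
  refine ⟨if x.1 < y.1 ∨ (x.1 = y.1 ∧ x.2 < y.2) then 1 else -1, ?_, ?_⟩
  · split_ifs
    exacts [.one, .neg .one]
  · rw [labNum, pairNum, if_neg ha, labVal_eq h, labVal_eq h, h2]
    split_ifs <;> simp [algebraMap_eq] <;> ring

lemma labNum_eq_zero (h : ¬ isINI β) {x y : ℕ × ℕ} (ha : aC n x.1 y.1 ≠ 0)
    (he : labExp n x = pairExp n x y) : labNum β x y = 0 := by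
  obtain ⟨u, -, hu⟩ := labNum_eq h ha
  rw [hu, he, sub_self, mul_zero, C_0, zero_mul]

variable (β) in
/-- `p = u * c * w ^ e` for some monomial scalar `u`. -/
def SpecRel (p : WR2C n) (c : KK) (e : ℕ) : Prop :=
  ∃ u, IsMonomialScalar u ∧ p = C (u * c) * wVar β ^ e

lemma SpecRel.one : SpecRel β 1 1 0 := ⟨1, .one, by simp⟩

lemma SpecRel.mul {p q : WR2C n} {c d : KK} {e f : ℕ} (hp : SpecRel β p c e)
    (hq : SpecRel β q d f) : SpecRel β (p * q) (c * d) (e + f) := by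
  obtain ⟨u, hu, rfl⟩ := hp
  obtain ⟨u', hu', rfl⟩ := hq
  refine ⟨u * u', hu.mul hu', ?_⟩
  simp only [C_mul]
  ring

lemma labNum_specRel (h : ¬ isINI β) {x y : ℕ × ℕ} (ha : aC n x.1 y.1 ≠ 0) {c : KK}
    (hc : EqMon (vpow (labExp n x) - vpow (pairExp n x y)) c) : SpecRel β (labNum β x y) c 1 := by
  obtain ⟨u, hu, h1⟩ := labNum_eq h ha
  obtain ⟨u', hu', h2⟩ := hc
  exact ⟨u * u', hu.mul hu', by rw [h1, h2, pow_one, mul_assoc]⟩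

/-- the labels `(m,0), (m-1,0), …, (i,0)`. -/
def descLabels (i m : ℕ) : List (ℕ × ℕ) :=
  ((List.range' i (m + 1 - i)).reverse).map fun c => (c, 0)

/-- the labels `(j,1), (j+1,1), …, (m-1,1)`. -/
def ascLabels (j m : ℕ) : List (ℕ × ℕ) := (List.range' j (m - j)).map fun c => (c, 1)

lemma mem_descLabels {i m : ℕ} {p : ℕ × ℕ} :
    p ∈ descLabels i m ↔ i ≤ p.1 ∧ p.1 ≤ m ∧ p.2 = 0 := by
  obtain ⟨a, b⟩ := p
  simp only [descLabels, List.mem_map, List.mem_reverse, List.mem_range'_1, Prod.mk.injEq]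
  constructor
  · rintro ⟨c, hc, rfl, rfl⟩
    omega
  · rintro ⟨h1, h2, h3⟩
    exact ⟨a, by omega, rfl, h3.symm⟩

lemma mem_ascLabels {j m : ℕ} {p : ℕ × ℕ} :
    p ∈ ascLabels j m ↔ j ≤ p.1 ∧ p.1 < m ∧ p.2 = 1 := by
  obtain ⟨a, b⟩ := p
  simp only [ascLabels, List.mem_map, List.mem_range'_1, Prod.mk.injEq]
  constructor
  · rintro ⟨c, hc, rfl, rfl⟩
    omega
  · rintro ⟨h1, h2, h3⟩
    exact ⟨a, by omega, rfl, h3.symm⟩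

lemma nodup_ascLabels_append (i j m : ℕ) : (ascLabels j m ++ descLabels i m).Nodup := by
  refine List.Nodup.append ?_ ?_ ?_
  · exact (List.nodup_range').map fun a b h => (Prod.ext_iff.1 h).1
  · exact (List.nodup_reverse.2 (List.nodup_range')).map fun a b h => (Prod.ext_iff.1 h).1
  · intro p h1 h2
    have := (mem_ascLabels.1 h1).2.2
    have := (mem_descLabels.1 h2).2.2
    omega

lemma descLabels_succ {i m : ℕ} (h : i ≤ m + 1) :
    descLabels i (m + 1) = (m + 1, 0) :: descLabels i m := by
  have : m + 1 + 1 - i = (m + 1 - i) + 1 := by omega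
  rw [descLabels, descLabels, this, List.range'_concat, List.reverse_append]
  simp
  omega

lemma descLabels_self (i : ℕ) : descLabels i i = [(i, 0)] := by
  simp [descLabels]

lemma ascLabels_cons {l m : ℕ} (h : l < m) : ascLabels l m = (l, 1) :: ascLabels (l + 1) m := by
  have : m - l = (m - (l + 1)) + 1 := by omega
  rw [ascLabels, ascLabels, this, List.range'_succ, List.map_cons]

lemma ascLabels_self (m : ℕ) : ascLabels m m = [] := by simp [ascLabels]

lemma prod_map_eq_of_subset {M α : Type} [CommMonoid M] [DecidableEq α] {L : List α}
    (hL : L.Nodup) (f : α → M) (T : Finset α) (hT : ∀ y ∈ T, y ∈ L)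
    (h1 : ∀ y ∈ L, y ∉ T → f y = 1) : (L.map f).prod = ∏ y ∈ T, f y := by
  rw [← List.prod_toFinset f hL]
  exact (Finset.prod_subset (fun y hy => List.mem_toFinset.2 (hT y hy))
    fun y hy hyT => h1 y (List.mem_toFinset.1 hy) hyT).symm

lemma aC_eq_zero {a b : ℕ} (h : a + 1 < b ∨ b + 1 < a) : aC n a b = 0 := by
  unfold aC
  split_ifs <;> omega

lemma aC_ne_zero {a b : ℕ} (h : a = b ∨ a + 1 = b ∨ b + 1 = a) : aC n a b ≠ 0 := by
  unfold aC
  split_ifs <;> omega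

lemma dC_mul_aC_self {a : ℕ} (ha : a ≠ n) : (dC n a : ℤ) * aC n a a = 2 := by
  simp [dC, aC, ha]

lemma dC_mul_aC_adj {a b : ℕ} (h : a + 1 = b ∨ b + 1 = a) (hn : a ≠ n ∧ b ≠ n) :
    (dC n a : ℤ) * aC n a b = -1 := by
  have : a ≠ b := by omega
  simp [dC, aC, hn, this, h]

lemma dC_mul_aC_adj_last {a b : ℕ} (h : a + 1 = b ∧ b = n ∨ b + 1 = a ∧ a = n) :
    (dC n a : ℤ) * aC n a b = -2 := by
  rcases h with ⟨rfl, rfl⟩ | ⟨rfl, rfl⟩ <;> simp [dC, aC]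

lemma pairProd_descLabels (h : ¬ isINI β) {i m : ℕ} (him : i ≤ m) (hm : m ≤ n) :
    SpecRel β (pairProd (labNum β) (descLabels i m))
      (if m = n ∧ i < n then qBrack 1 ^ (m - i - 1) * qBrack 2 else qBrack 1 ^ (m - i)) (m - i) := by
  induction m, him using Nat.le_induction with
  | base =>
    rw [if_neg (by omega)]
    simpa [descLabels_self, pairProd] using SpecRel.one
  | succ m him ih =>
    rw [descLabels_succ (by omega), pairProd]
    have h1 : ((descLabels i m).map (labNum β (m + 1, 0))).prod = labNum β (m + 1, 0) (m, 0) := by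
      rw [prod_map_eq_of_subset (List.Nodup.of_append_right (nodup_ascLabels_append i m m)) _
        {(m, 0)} (by simp [mem_descLabels, him]), Finset.prod_singleton]
      intro y hy hy'
      rw [mem_descLabels] at hy
      have hy1 : y.1 ≠ m := fun hh => hy' (by simp [Prod.ext_iff, hh, hy.2.2])
      exact labNum_eq_one (aC_eq_zero (by simp only; omega))
    have h2 := ih (by omega)
    rw [if_neg (by omega)] at h2
    have h3 : SpecRel β (labNum β (m + 1, 0) (m, 0)) (if m + 1 = n then qBrack 2 else qBrack 1) 1 := by
      refine labNum_specRel h (aC_ne_zero (by simp)) ?_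
      split_ifs with hmn
      · refine vpow_sub_vpow_qBrack 2 ?_
        rw [pairExp, dC_mul_aC_adj_last (Or.inr ⟨rfl, hmn⟩)]
        simp only [labExp, if_true]
        split_ifs <;> omega
      · refine vpow_sub_vpow_qBrack 1 ?_
        rw [pairExp, dC_mul_aC_adj (by omega) (by simp only; omega)]
        simp only [labExp, if_true]
        split_ifs <;> omega
    rw [h1]
    convert h3.mul h2 using 1
    · split_ifs with h4 h5 h5
      · rw [mul_comm]; congr 2; omega
      · omega
      · omega
      · rw [← pow_succ']; congr 1; omega
    · omega

/-- the constant attached to the color `l` in the specialization of `[i,n,j]`, `j ≤ l`. -/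
def ascConst (n l : ℕ) : KK := (vpow (2 * (n : ℤ) - 2 * l) - 1) * (vpow (2 * (n : ℤ) - 2 * l + 4) - 1)

lemma labVal_sub_specRel (h : ¬ isINI β) {l : ℕ} (hl : l < n) {c : KK}
    (hc : EqMon (vpow (2 * (n : ℤ) - 2 * l + 2) - 1) c) :
    SpecRel β (labVal β (l, 0) - labVal β (l, 1)) c 1 := by
  obtain ⟨u, hu, h1⟩ : EqMon (vpow (labExp n (l, 0)) - vpow (labExp n (l, 1))) c := by
    refine (vpow_sub_vpow_eqMon (2 * (n : ℤ) - 2 * l + 2) ?_).trans hc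
    simp only [labExp, if_true, one_ne_zero, if_false]
    split_ifs <;> omega
  refine ⟨u, hu, ?_⟩
  rw [labVal_eq h, labVal_eq h, ← h1, C_sub]
  ring

lemma prod_ascLabel_last {i l : ℕ} (hil : i < l) (hl : l + 1 = n) :
    ((ascLabels (l + 1) n ++ descLabels i n).map (labNum β (l, 1))).prod =
      labNum β (l, 1) (n, 0) * labNum β (l, 1) (l, 0) * labNum β (l, 1) (l - 1, 0) := by
  rw [prod_map_eq_of_subset (nodup_ascLabels_append _ _ _) _
    {(n, 0), (l, 0), (l - 1, 0)}]
  · rw [Finset.prod_insert, Finset.prod_insert, Finset.prod_singleton, mul_assoc]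
    all_goals simp; try omega
  · simp only [Finset.mem_insert, Finset.mem_singleton, List.mem_append, mem_descLabels]
    rintro _ (rfl | rfl | rfl) <;> right <;> simp only [and_true] <;> omega
  · rintro ⟨a, b⟩ h1 h2
    simp only [List.mem_append, mem_descLabels, mem_ascLabels] at h1
    simp only [Finset.mem_insert, Finset.mem_singleton, Prod.mk.injEq] at h2
    exact labNum_eq_one (aC_eq_zero (by simp only; omega))

lemma prod_ascLabel {i l : ℕ} (hil : i < l) (hl : l + 1 < n) :
    ((ascLabels (l + 1) n ++ descLabels i n).map (labNum β (l, 1))).prod =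
      labNum β (l, 1) (l + 1, 1) * labNum β (l, 1) (l + 1, 0) *
        labNum β (l, 1) (l, 0) * labNum β (l, 1) (l - 1, 0) := by
  rw [prod_map_eq_of_subset (nodup_ascLabels_append _ _ _) _
    {(l + 1, 1), (l + 1, 0), (l, 0), (l - 1, 0)}]
  · rw [Finset.prod_insert, Finset.prod_insert, Finset.prod_insert, Finset.prod_singleton,
      mul_assoc, mul_assoc]
    all_goals simp; try omega
  · simp only [Finset.mem_insert, Finset.mem_singleton, List.mem_append, mem_descLabels,
      mem_ascLabels]
    rintro _ (rfl | rfl | rfl | rfl)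
    on_goal 1 => left
    all_goals try right
    all_goals simp only [and_true]; omega
  · rintro ⟨a, b⟩ h1 h2
    simp only [List.mem_append, mem_descLabels, mem_ascLabels] at h1
    simp only [Finset.mem_insert, Finset.mem_singleton, Prod.mk.injEq] at h2
    exact labNum_eq_one (aC_eq_zero (by simp only; omega))

lemma labNum_self_specRel (h : ¬ isINI β) {l : ℕ} (hl : l < n) :
    SpecRel β (labNum β (l, 1) (l, 0)) (vpow (2 * (n : ℤ) - 2 * l) - 1) 1 := by
  refine labNum_specRel h (aC_ne_zero (by simp)) (vpow_sub_vpow_eqMon _ ?_)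
  rw [pairExp, dC_mul_aC_self (by simp only; omega)]
  simp only [labExp, if_true, one_ne_zero, if_false]
  split_ifs <;> omega

lemma labNum_pred_specRel (h : ¬ isINI β) {l : ℕ} (hl1 : 1 ≤ l) (hl : l < n) :
    SpecRel β (labNum β (l, 1) (l - 1, 0)) (vpow (2 * (n : ℤ) - 2 * l + 4) - 1) 1 := by
  refine labNum_specRel h (aC_ne_zero (by simp only; omega)) (vpow_sub_vpow_eqMon _ ?_)
  rw [pairExp, dC_mul_aC_adj (by simp only; omega) (by simp only; omega)]
  simp only [labExp, if_true, one_ne_zero, if_false]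
  split_ifs <;> omega

lemma pairProd_labels (h : ¬ isINI β) {i j : ℕ} (hij : i < j) (hj : j < n) :
    ∃ p, SpecRel β p (qBrack 1 ^ (2 * n - i - j - 2) * qBrack 2 *
        ∏ l ∈ Finset.Icc j (n - 1), ascConst n l) (4 * n - i - 3 * j - 1) ∧
      pairProd (labNum β) (ascLabels j n ++ descLabels i n) =
        p * ∏ c ∈ Finset.Icc j (n - 1), (labVal β (c, 0) - labVal β (c, 1)) := by
  obtain ⟨m, rfl⟩ : ∃ m, n = m + 1 := ⟨n - 1, by omega⟩
  have hjm : j ≤ m := by omega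
  induction hjm using Nat.decreasingInduction with
  | self =>
    obtain ⟨u, hu, h1⟩ := labVal_sub_specRel h hj (c := qBrack 2)
      (by convert vpow_sub_one_eqMon 2 using 3; push_cast; ring)
    obtain ⟨u', hu', h2⟩ : SpecRel β (labNum β (m, 1) (m + 1, 0)) (qBrack 2) 1 := by
      refine labNum_specRel h (aC_ne_zero (by simp)) (vpow_sub_vpow_qBrack 2 ?_)
      rw [pairExp, dC_mul_aC_adj_last (by simp)]
      simp only [labExp, if_true, one_ne_zero, if_false]
      split_ifs <;> omega
    have h3 := pairProd_descLabels h (by omega : i ≤ m + 1) le_rfl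
    rw [if_pos (by omega)] at h3
    have h4 : labNum β (m, 1) (m + 1, 0) =
        C (u' * u⁻¹) * (labVal β (m, 0) - labVal β (m, 1)) := by
      rw [h1, h2, ← mul_assoc, ← C_mul]
      congr 2
      field_simp [hu.ne_zero]
    have h5 : SpecRel β (C (u' * u⁻¹)) 1 0 := ⟨_, hu'.mul hu.inv, by simp⟩
    refine ⟨C (u' * u⁻¹) * (labNum β (m, 1) (m, 0) * labNum β (m, 1) (m - 1, 0) *
      pairProd (labNum β) (descLabels i (m + 1))), ?_, ?_⟩
    rotate_left
    · rw [ascLabels_cons hj, List.cons_append, pairProd, prod_ascLabel_last hij rfl, h4,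
        ascLabels_self, List.nil_append, Nat.add_sub_cancel, Finset.Icc_self,
        Finset.prod_singleton]
      ring
    · convert h5.mul (((labNum_self_specRel h hj).mul (labNum_pred_specRel h (by omega) hj)).mul h3)
        using 1
      · rw [Nat.add_sub_cancel, Finset.Icc_self, Finset.prod_singleton, ascConst]
        have : 2 * (m + 1) - i - m - 2 = m + 1 - i - 1 := by omega
        rw [this]
        ring
      · omega
  | of_succ l hl ih =>
    obtain ⟨p, hp, hpe⟩ := ih (by omega) (by omega)
    have hq : EqMon (vpow (2 * ((m + 1 : ℕ) : ℤ) - 2 * l + 2) - 1) (vpow (2 * ((m + 1 : ℕ) : ℤ) - 2 * l + 2) - 1) :=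
      .refl _
    have hne : vpow (2 * ((m + 1 : ℕ) : ℤ) - 2 * l + 2) - 1 ≠ 0 := by
      rw [sub_ne_zero, ← vpow_zero]
      refine vpow_injective.ne ?_
      omega
    obtain ⟨u, hu, h1⟩ := labVal_sub_specRel h hj hq
    obtain ⟨u', hu', h2⟩ : SpecRel β (labNum β (l, 1) (l + 1, 0))
        (vpow (2 * ((m + 1 : ℕ) : ℤ) - 2 * l + 2) - 1) 1 := by
      refine labNum_specRel h (aC_ne_zero (by simp)) (vpow_sub_vpow_eqMon _ ?_)
      rw [pairExp, dC_mul_aC_adj (by omega) (by simp only; omega)]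
      simp only [labExp, if_true, one_ne_zero, if_false]
      split_ifs <;> omega
    have h6 : SpecRel β (labNum β (l, 1) (l + 1, 1)) (qBrack 1) 1 := by
      refine labNum_specRel h (aC_ne_zero (by simp)) (vpow_sub_vpow_qBrack 1 ?_)
      rw [pairExp, dC_mul_aC_adj (by omega) (by simp only; omega)]
      simp only [labExp, one_ne_zero, if_false]
      split_ifs <;> omega
    have h4 : labNum β (l, 1) (l + 1, 0) =
        C (u' * u⁻¹) * (labVal β (l, 0) - labVal β (l, 1)) := by
      rw [h1, h2, ← mul_assoc, ← C_mul]
      congr 2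
      field_simp [hu.ne_zero]
    have h5 : SpecRel β (C (u' * u⁻¹)) 1 0 := ⟨_, hu'.mul hu.inv, by simp⟩
    have hI : Finset.Icc l (m + 1 - 1) = insert l (Finset.Icc (l + 1) (m + 1 - 1)) := by
      ext x
      simp only [Finset.mem_insert, Finset.mem_Icc]
      omega
    have hlI : l ∉ Finset.Icc (l + 1) (m + 1 - 1) := by simp
    refine ⟨C (u' * u⁻¹) * labNum β (l, 1) (l + 1, 1) * (labNum β (l, 1) (l, 0) *
      labNum β (l, 1) (l - 1, 0)) * p, ?_, ?_⟩
    rotate_left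
    · rw [ascLabels_cons hj, List.cons_append, pairProd, prod_ascLabel hij (by omega), h4, hpe, hI,
        Finset.prod_insert hlI]
      ring
    · convert ((h5.mul h6).mul
        ((labNum_self_specRel h hj).mul (labNum_pred_specRel h (by omega) hj))).mul hp using 1
      · rw [hI, Finset.prod_insert hlI, ascConst]
        have : 2 * (m + 1) - i - l - 2 = 2 * (m + 1) - i - (l + 1) - 2 + 1 := by omega
        rw [this]
        ring
      · omega

end ChainSpec

section ChainFinal
open MvPolynomial
variable {n : ℕ} {β : PosRootC n}

lemma algebraMap_C_eq_cwC (a : KK) : algebraMap (WRC n) (FWC n) (C a) = cwC n a :=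
  (IsScalarTower.algebraMap_apply KK (WRC n) (FWC n) a).symm

lemma wXC_ne_zero (p : PosRootC n × ℕ) : wXC n p ≠ 0 := by
  rw [wXC, Ne, FaithfulSMul.algebraMap_eq_zero_iff]
  exact X_ne_zero p

lemma phiRelC_of_specializations {F : Fk n (nuVecC n β)} {M : ℕ} {g : Pk n (nuVecC n β)}
    {q : WR2C n} {c x u : KK} {a b : ℕ} {t : ℤ}
    (hg : F * algebraMap (Pk n (nuVecC n β)) (Fk n (nuVecC n β)) (Dpoly n (aC n) _ * xProd n _ ^ M) =
      algebraMap (Pk n (nuVecC n β)) (Fk n (nuVecC n β)) g)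
    (hq : phi1 β g = BoneC n β 0 * q) (hx : IsMonomialScalar x)
    (hx' : psi2C n (phi1 β (xProd n _ ^ M)) = C x * X (β, 0) ^ a)
    (hu : IsMonomialScalar u) (hu' : psi2C n q = C (u * c) * X (β, 0) ^ b) (ht : (b : ℤ) = t + a) :
    ∃ (c' : ℚ) (m : ℤ), c' ≠ 0 ∧ PhiRelC n (dOne β) F
      (cwC n (algebraMap ℚ KK c' * vpow m * c) * wXC n (β, 0) ^ t) := by
  obtain ⟨c', m, hc', h⟩ := hu.mul hx.inv
  refine ⟨c', m, hc', M, g, q, hg, by rw [BprodC_dOne]; exact hq, ?_⟩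
  change _ * algebraMap (WRC n) (FWC n) (psi2C n (phi1 β (xProd n _ ^ M))) = _
  rw [hx', hu', map_mul, map_mul, map_pow, map_pow, algebraMap_C_eq_cwC, algebraMap_C_eq_cwC, ← h]
  change _ * _ * (_ * wXC n (β, 0) ^ a) = _ * wXC n (β, 0) ^ b
  rw [← zpow_natCast (wXC n (β, 0)) b, ht, zpow_add₀ (wXC_ne_zero _), zpow_natCast]
  have h1 : cwC n (u * c) = cwC n (u * x⁻¹ * c) * cwC n x := by
    rw [cwC, cwC, cwC, ← map_mul]
    congr 1
    field_simp [hx.ne_zero]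
  rw [h1]
  ring

lemma exists_neg_natCast_le (ss : List ℤ) : ∃ M : ℕ, ∀ s ∈ ss, -(M : ℤ) ≤ s := by
  induction ss with
  | nil => exact ⟨0, by simp⟩
  | cons s ss ih =>
    obtain ⟨M, hM⟩ := ih
    refine ⟨M + s.natAbs, ?_⟩
    simp only [List.mem_cons]
    rintro t (rfl | ht)
    · omega
    · have := hM t ht
      omega

lemma zip_labVal_prod (h : ¬ isINI β) (M : ℕ) (Λ : List (ℕ × ℕ)) (ss : List ℤ)
    (hl : ss.length = Λ.length) (hM : ∀ s ∈ ss, -(M : ℤ) ≤ s) :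
    ∃ e, SpecRel β ((Λ.zip ss).map fun x => labVal β x.1 ^ (x.2 + (M : ℤ)).toNat).prod 1 e ∧
      (e : ℤ) = ss.sum + M * Λ.length := by
  induction Λ generalizing ss with
  | nil =>
    obtain rfl := List.length_eq_zero_iff.1 hl
    exact ⟨0, by simpa using SpecRel.one, by simp⟩
  | cons p Λ ih =>
    obtain ⟨s, ss, rfl⟩ := List.exists_cons_of_length_eq_add_one hl
    simp only [List.mem_cons, forall_eq_or_imp] at hM
    obtain ⟨e, he, he'⟩ := ih ss (by simpa using hl) hM.2
    refine ⟨(s + M).toNat + e, ?_, ?_⟩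
    · rw [List.zip_cons_cons, List.map_cons, List.prod_cons]
      have h1 : SpecRel β (labVal β p ^ (s + (M : ℤ)).toNat) 1 (s + (M : ℤ)).toNat :=
        ⟨_, (IsMonomialScalar.vpow (labExp n p)).pow _, by
          rw [labVal_eq h, mul_pow, mul_one, C_pow]⟩
      simpa using h1.mul he
    · have := hM.1
      push_cast
      rw [he', List.sum_cons, List.length_cons, Int.toNat_of_nonneg (by omega)]
      push_cast
      ring

lemma prod_labVal (h : ¬ isINI β) (Λ : List (ℕ × ℕ)) :
    SpecRel β (Λ.map (labVal β)).prod 1 Λ.length := by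
  induction Λ with
  | nil => exact SpecRel.one
  | cons p Λ ih =>
    have h1 : SpecRel β (labVal β p) 1 1 := ⟨_, .vpow (labExp n p), by rw [labVal_eq h]; simp⟩
    simpa [add_comm] using h1.mul ih

lemma labNum_desc_eq_zero (h : ¬ isINI β) {c : ℕ} (hc : c + 1 ≤ n) :
    labNum β (c, 0) (c + 1, 0) = 0 := by
  refine labNum_eq_zero h (aC_ne_zero (by simp)) ?_
  by_cases hn : c + 1 = n
  · rw [pairExp, dC_mul_aC_adj_last (by simp only [true_and]; omega)]
    simp only [labExp, if_true]
    split_ifs <;> omega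
  · rw [pairExp, dC_mul_aC_adj (by omega) (by simp only; omega)]
    simp only [labExp, if_true]
    split_ifs <;> omega

lemma labNum_asc_eq_zero (h : ¬ isINI β) {c : ℕ} (hc : c + 1 < n) :
    labNum β (c + 1, 1) (c, 1) = 0 := by
  refine labNum_eq_zero h (aC_ne_zero (by simp)) ?_
  rw [pairExp, dC_mul_aC_adj (by omega) (by simp only; omega)]
  simp only [labExp, one_ne_zero, if_false]
  split_ifs <;> omega

lemma labNum_turn_eq_zero (h : ¬ isINI β) {c : ℕ} (hc : c + 1 = n) :
    labNum β (n, 0) (c, 1) = 0 := by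
  refine labNum_eq_zero h (aC_ne_zero (by simp only; omega)) ?_
  rw [pairExp, dC_mul_aC_adj_last (Or.inr ⟨hc, rfl⟩)]
  simp only [labExp, if_true, one_ne_zero, if_false]
  split_ifs <;> omega

lemma labNum_chain (h : ¬ isINI β) {i j m : ℕ} (him : i ≤ m) (hm : m ≤ n)
    (hjn : j < m → m = n) :
    (ascLabels j m ++ descLabels i m).IsChain fun a b => ¬ labNum β b a ≠ 0 := by
  rw [List.isChain_append]
  refine ⟨?_, ?_, ?_⟩
  · rw [ascLabels, List.isChain_map]
    refine (List.isChain_range' _ _ _).imp_of_mem_imp ?_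
    rintro a b - hb rfl
    rw [List.mem_range'_1] at hb
    exact not_not.2 (labNum_asc_eq_zero h (by omega))
  · rw [descLabels, List.isChain_map, List.isChain_reverse]
    refine (List.isChain_range' _ _ _).imp_of_mem_imp ?_
    rintro a b - hb rfl
    rw [List.mem_range'_1] at hb
    exact not_not.2 (labNum_desc_eq_zero h (by omega))
  · have h2 : (descLabels i m).head? = some (m, 0) := by
      obtain rfl | hlt := him.eq_or_lt
      · rw [descLabels_self, List.head?_cons]
      · obtain ⟨m, rfl⟩ : ∃ m', m = m' + 1 := ⟨m - 1, by omega⟩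
        rw [descLabels_succ him, List.head?_cons]
    intro x hx y hy
    obtain rfl : (m, 0) = y := by simpa [h2] using hy
    have hx' := mem_ascLabels.1 (List.mem_of_mem_getLast? hx)
    have hmj : m - j = (m - 1 - j) + 1 := by omega
    obtain rfl : (m - 1, 1) = x := by
      rw [ascLabels, hmj, List.range'_concat] at hx
      simp only [List.map_append, List.map_cons, List.map_nil, List.getLast?_concat,
        Option.mem_some_iff] at hx
      rw [← hx]
      simp only [Prod.mk.injEq, and_true]
      omega
    obtain rfl := hjn (by omega)
    exact not_not.2 (labNum_turn_eq_zero h (by simp only at hx'; omega))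

lemma SpecRel.psi2C {p : WR2C n} {c : KK} {e : ℕ} (h : SpecRel β p c e) :
    ∃ u, IsMonomialScalar u ∧ psi2C n p = C (u * c) * X (β, 0) ^ e := by
  obtain ⟨u, hu, rfl⟩ := h
  refine ⟨u, hu, ?_⟩
  rw [map_mul, map_pow, wVar, _root_.psi2C, aeval_X, algHom_C, algebraMap_eq]

lemma aC_eq_zero_comm (c c' : ℕ) : aC n c c' = 0 ↔ aC n c' c = 0 := by
  have h : ∀ a b, aC n a b = 0 → aC n b a = 0 := by
    intro a b hab
    by_contra h
    refine aC_ne_zero ?_ hab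
    by_contra h'
    exact h (aC_eq_zero (by omega))
  exact ⟨h c c', h c' c⟩

lemma aC_self_ne_zero (c : ℕ) : aC n c c ≠ 0 := aC_ne_zero (Or.inl rfl)

lemma phi1_Npoly_labels {Λ : List (ℕ × ℕ)} {a b : ℕ} (ha : 1 ≤ a) (hb : b ≤ n)
    (hmem : ∀ p, p ∈ Λ ↔ (1 ≤ p.1 ∧ p.1 ≤ n) ∧ p.2 < nuC β p.1)
    (hab : ∀ c, (c, 1) ∈ Λ ↔ a ≤ c ∧ c ≤ b) :
    phi1 β (Npoly n (nuVecC n β)) =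
      ∏ c ∈ Finset.Icc a b, (labVal β (c, 0) - labVal β (c, 1)) := by
  refine phi1_Npoly β ha hb fun c h1 h2 => ?_
  rw [← hab, hmem]
  have := nuC_le_two β c
  simp only
  omega

section
variable (Ψ : UC n →ₗ[KK] BigS n)
    (hmul : ∀ a b, Ψ (a * b) = bstar n (aC n) (dC n) (Ψ a) (Ψ b))
    (hone : Ψ 1 = DirectSum.of (fun k => Fk n k) 0 1)
    (hgen : ∀ (i : Fin n) (r : ℤ), Ψ (ug n (aC n) (dC n) i r) =
      DirectSum.of (fun k => Fk n k) (unitVec i) (xvr n (default : Vars n (unitVec i)) ^ r))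

include hmul hone hgen in
lemma exists_phiRelC_of_chain (h : ¬ isINI β) {i j m : ℕ} (hi : 1 ≤ i) (him : i ≤ m) (hm : m ≤ n)
    (hij : i ≤ j) (hjn : j < m → m = n ∧ i < j)
    (hmem : ∀ p, p ∈ ascLabels j m ++ descLabels i m ↔ (1 ≤ p.1 ∧ p.1 ≤ n) ∧ p.2 < nuC β p.1)
    (hword : wordC β = List.range' i (m + 1 - i) ++ (List.range' j (m - j)).reverse)
    {p : WR2C n} {c : KK} {e : ℕ} (hp : SpecRel β p c e)
    (hprod : pairProd (labNum β) (ascLabels j m ++ descLabels i m) =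
      p * ∏ c ∈ Finset.Icc j (m - 1), (labVal β (c, 0) - labVal β (c, 1)))
    {s : ℤ} {E : UC n} (hE : IsRVCchain β s E) :
    ∃ (c' : ℚ) (m : ℤ), c' ≠ 0 ∧ PhiRelC n (dOne β) ((Ψ E) (nuVecC n β))
      (cwC n (algebraMap ℚ KK c' * vpow m * c) * wXC n (β, 0) ^ (s + e)) := by
  obtain ⟨ss, ls, hss, hls, hsum, hv, rfl⟩ := hE
  obtain ⟨w, hw, hiw⟩ : ∃ w, wordC β = i :: w ∧ i ∉ w := by
    refine ⟨List.range' (i + 1) (m - i) ++ (List.range' j (m - j)).reverse, ?_, ?_⟩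
    · rw [hword, show m + 1 - i = (m - i) + 1 by omega, List.range'_succ, List.cons_append]
    · simp only [List.mem_append, List.mem_reverse, List.mem_range'_1]
      omega
  rw [hw] at hss hls ⊢
  obtain ⟨a, ha, y, hy, hE⟩ := chainE_eq n (aC n) (dC n) i w ss ls hiw hss hls hv
  obtain ⟨M, hM⟩ := exists_neg_natCast_le ss
  set Λ := ascLabels j m ++ descLabels i m with hΛ
  obtain ⟨Ls, hLs, hLsΛ⟩ : ∃ L : List (Vars n (nuVecC n β)), IsEnum L ∧ L.map (lab n) = Λ :=
    exists_enum_labels β (nodup_ascLabels_append i j m) hmem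
  have hfst : ((i :: w).zip ss).map Prod.fst = i :: w := List.map_fst_zip hss.ge
  have hsnd : ((i :: w).zip ss).map Prod.snd = ss := List.map_snd_zip hss.le
  have hΛw : Λ.map Prod.fst = (i :: w).reverse := by
    rw [← hw, hword, hΛ, List.reverse_append, List.reverse_reverse, List.map_append, ascLabels,
      descLabels, List.map_map, List.map_map]
    simp [Function.comp_def]
  obtain ⟨g, hg, hgI⟩ := exists_numerator n (dC n) Ψ hmul hone hgen (phi1 β) ⊥ M aC_eq_zero_comm
    aC_self_ne_zero (fun c => nuC_le_two β _) (fun _ => True) hLs (by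
      intro L ss' hL _ hne
      rw [Ideal.mem_bot, phi1_termP]
      by_contra h0
      rw [hLsΛ] at hne
      have hpr := pairwise_of_pairProd_ne_zero (right_ne_zero_of_mul h0)
      have hperm : (L.map (lab n)).Perm Λ := by
        rw [← hLsΛ]
        exact hL.perm_map hLs (lab n)
      exact hne (List.eq_of_perm_of_isChain hperm (nodup_ascLabels_append i j m) hpr
        (labNum_chain h him hm fun hh => (hjn hh).1)))
    ((i :: w).zip ss).reverse
    (by
      have h1 : (Ls.map fun u => (lab n u).1) = (Ls.map (lab n)).map Prod.fst := by
        rw [List.map_map]; rfl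
      rw [h1, hLsΛ, hΛw, List.map_reverse, hfst]) trivial
    (fun q hq => hM _ (List.of_mem_zip (List.mem_reverse.1 hq)).2) a y
    (by
      refine Submodule.span_mono ?_ hy
      rintro x ⟨ω, h1, h2, rfl⟩
      exact ⟨ω, h1.trans (List.reverse_perm _).symm, trivial, by rwa [List.map_reverse], rfl⟩)
  rw [Ideal.mem_bot, sub_eq_zero, phi1_termP, hLsΛ, hprod,
    phi1_Npoly_labels (a := j) (b := m - 1) (by omega) (by omega) hmem (by
      intro c
      rw [hΛ, List.mem_append, mem_ascLabels, mem_descLabels]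
      simp only [and_true, one_ne_zero, and_false, or_false]
      omega)] at hgI
  have hlen : Λ.length = (i :: w).length := by
    rw [← List.length_map (f := Prod.fst), hΛw, List.length_reverse]
  obtain ⟨e', he', hee⟩ := zip_labVal_prod h M Λ ss.reverse (by simp [hlen, hss])
    (fun s hs => hM s (List.mem_reverse.1 hs))
  have hN : ∏ c ∈ Finset.Icc j (m - 1), (labVal β (c, 0) - labVal β (c, 1)) ≠ 0 := by
    refine Finset.prod_ne_zero_iff.2 fun c hc => ?_
    rw [Finset.mem_Icc] at hc
    obtain ⟨u, hu, hu'⟩ := labVal_sub_specRel h (l := c) (by omega) (.refl _)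
    rw [hu']
    refine mul_ne_zero ?_ (pow_ne_zero _ (X_ne_zero _))
    rw [Ne, C_eq_zero]
    refine mul_ne_zero hu.ne_zero ?_
    rw [sub_ne_zero, ← vpow_zero]
    refine vpow_injective.ne ?_
    omega
  rw [List.map_reverse, hsnd] at hgI
  have hq : SpecRel β (phi1 β g) (1 * c) (e' + e) := by
    obtain ⟨u, hu, hu'⟩ := he'.mul hp
    refine ⟨a * u, ha.mul hu, ?_⟩
    rw [mul_assoc a, C_mul, mul_assoc (C a), ← hu']
    refine mul_left_cancel₀ hN (hgI.trans ?_)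
    rw [algebraMap_eq]
    ring
  have hx : SpecRel β (phi1 β (xProd n (nuVecC n β) ^ M)) 1 (Λ.length * M) := by
    obtain ⟨u, hu, hu'⟩ := prod_labVal h Λ
    refine ⟨u ^ M, hu.pow M, ?_⟩
    rw [map_pow, phi1_xProd β hLs, hLsΛ, hu', mul_pow, ← C_pow, mul_one, mul_one, ← pow_mul]
  obtain ⟨u, hu, hu'⟩ := hq.psi2C
  obtain ⟨x, hx, hx'⟩ := hx.psi2C
  rw [mul_one] at hx'
  rw [one_mul] at hu'
  rw [genC, hE]
  refine phiRelC_of_specializations hg ?_ hx hx' hu hu' ?_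
  · rw [BoneC, if_neg h, one_mul]
  · push_cast
    rw [hee, List.sum_reverse, hsum]
    ring
end

end ChainFinal

section NonSymmetric
open MvPolynomial
variable {n : ℕ}

lemma posRootC_bounds (β : PosRootC n) :
    1 ≤ ri β ∧ ri β ≤ n ∧ (ri β = n → rt β = 0) ∧ rt β + 2 * ri β ≤ 2 * n := by
  obtain ⟨h1, h2, h3⟩ := β.2
  exact ⟨h1, Nat.lt_succ_iff.1 (ofLex β.1).1.2, h2, h3⟩

variable {β : PosRootC n} (Ψ : UC n →ₗ[KK] BigS n)
    (hmul : ∀ a b, Ψ (a * b) = bstar n (aC n) (dC n) (Ψ a) (Ψ b))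
    (hone : Ψ 1 = DirectSum.of (fun k => Fk n k) 0 1)
    (hgen : ∀ (i : Fin n) (r : ℤ), Ψ (ug n (aC n) (dC n) i r) =
      DirectSum.of (fun k => Fk n k) (unitVec i) (xvr n (default : Vars n (unitVec i)) ^ r))

include hmul hone hgen in
lemma exists_phiRelC_of_not_isINI (h : ¬ isINI β) {s : ℤ} {E : UC n} (hE : IsRVCchain β s E) :
    ∃ (c' : ℚ) (m : ℤ), c' ≠ 0 ∧ PhiRelC n (dOne β) ((Ψ E) (nuVecC n β))
      (cwC n (algebraMap ℚ KK c' * vpow m * cBetaC β) * wXC n (β, 0) ^ (s + kappaC β)) := by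
  obtain ⟨hi1, hin, hin', hit⟩ := posRootC_bounds β
  have hini : ¬ (ri β + rt β = n ∧ ri β < n) := h
  have hmem : ∀ j m, m ≤ n →
      (∀ c, 1 ≤ c → c ≤ n → nuC β c = (if ri β ≤ c ∧ c ≤ m then if j ≤ c ∧ c < m then 2 else 1 else 0)) →
      ri β ≤ j → ∀ p, p ∈ ascLabels j m ++ descLabels (ri β) m ↔
        (1 ≤ p.1 ∧ p.1 ≤ n) ∧ p.2 < nuC β p.1 := by
    intro j m hm hnu hij p
    rw [List.mem_append, mem_ascLabels, mem_descLabels]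
    constructor
    · intro hp
      have h1 : 1 ≤ p.1 ∧ p.1 ≤ n := by omega
      refine ⟨h1, ?_⟩
      rw [hnu _ h1.1 h1.2]
      split_ifs <;> omega
    · rintro ⟨h1, h2⟩
      rw [hnu _ h1.1 h1.2] at h2
      split_ifs at h2 <;> omega
  by_cases hA : ri β + rt β < n ∨ ri β = n
  · have hm : ri β + rt β ≤ n := by omega
    have hw : wordC β = List.range' (ri β) (rt β + 1) := by rw [wordC]; simp only [if_pos hA]
    have hspec := pairProd_descLabels h (Nat.le_add_right (ri β) (rt β)) hm
    rw [if_neg (by omega), Nat.add_sub_cancel_left] at hspec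
    have := exists_phiRelC_of_chain Ψ hmul hone hgen h hi1 (Nat.le_add_right _ (rt β)) hm
      (Nat.le_add_right _ (rt β)) (by omega) (hmem _ _ hm (by
        intro c h1 h2
        rw [nuC]
        simp only [if_pos hA]
        split_ifs <;> omega) (Nat.le_add_right _ _))
      (by rw [hw]; simp; omega) hspec (by
        rw [ascLabels_self, List.nil_append, Finset.Icc_eq_empty (by omega), Finset.prod_empty,
          mul_one]) hE
    convert this using 7
    · rw [cBetaC, if_neg h, if_neg (by omega), if_neg (by omega), heightC, hw, List.length_range',
        Nat.add_sub_cancel]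
    · rw [kappaC, if_neg h, if_neg (by omega), if_neg (by omega)]
  by_cases hB : ri β + rt β = n + 1
  · have hw : wordC β = List.range' (ri β) (n - ri β + 1) := by
      rw [wordC]; simp only [if_neg hA, if_pos hB]; rw [if_neg (by omega)]
    have hspec := pairProd_descLabels h hin le_rfl
    rw [if_pos (by omega)] at hspec
    have := exists_phiRelC_of_chain Ψ hmul hone hgen h hi1 hin le_rfl hin (by omega)
      (hmem _ _ le_rfl (by
        intro c h1 h2
        rw [nuC]
        simp only [if_neg hA, if_pos hB]
        split_ifs <;> omega) hin)
      (by rw [hw]; simp; omega) hspec (by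
        rw [ascLabels_self, List.nil_append, Finset.Icc_eq_empty (by omega), Finset.prod_empty,
          mul_one]) hE
    convert this using 7
    · rw [cBetaC, if_neg h, if_pos (by omega), heightC, hw, List.length_range']
      congr 2
    · rw [kappaC, if_neg h, if_neg (by omega), if_pos (by omega)]
      congr 2
      omega
  · obtain ⟨j, hj⟩ : ∃ j, j = 2 * n + 1 - ri β - rt β := ⟨_, rfl⟩
    have hij : ri β < j := by omega
    have hjn : j < n := by omega
    have hw : wordC β = List.range' (ri β) (n - ri β + 1) ++ (List.range' j (n - j)).reverse := by
      rw [wordC]; simp only [if_neg hA, if_neg hB]; rw [if_neg (by omega), ← hj]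
    obtain ⟨p, hp, hpe⟩ := pairProd_labels h hij hjn
    have := exists_phiRelC_of_chain Ψ hmul hone hgen h hi1 hin le_rfl hij.le (by omega)
      (hmem _ _ le_rfl (by
        intro c h1 h2
        rw [nuC]
        simp only [if_neg hA, if_neg hB]
        split_ifs <;> omega) hij.le)
      (by rw [hw, Nat.sub_add_comm hin]) hp hpe hE
    convert this using 7
    · rw [cBetaC, if_neg h, if_neg (by omega), if_pos (by omega), heightC, hw, List.length_append,
        List.length_reverse, List.length_range', List.length_range']
      rw [← hj, show n - ri β + 1 + (n - j) - 3 = 2 * n - ri β - j - 2 by omega]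
      rfl
    · rw [kappaC, if_neg h, if_pos (by omega)]
      congr 2
      omega

end NonSymmetric

section BracketExpansion
variable {n : ℕ} {A : ℕ → ℕ → ℤ} {Dd : ℕ → ℕ}

lemma mul_mem_of_mem_span {S T : Set (UA n A Dd)} {V : Submodule KK (UA n A Dd)}
    (h : ∀ x ∈ S, ∀ y ∈ T, x * y ∈ V) {x y : UA n A Dd} (hx : x ∈ Submodule.span KK S)
    (hy : y ∈ Submodule.span KK T) : x * y ∈ V := by
  induction hx using Submodule.span_induction with
  | mem x hx =>
    induction hy using Submodule.span_induction with
    | mem y hy => exact h x hx y hy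
    | zero => simp
    | add y z _ _ hy hz => rw [mul_add]; exact V.add_mem hy hz
    | smul c y _ hy => rw [mul_smul_comm]; exact V.smul_mem _ hy
  | zero => simp
  | add x z _ _ hx hz => rw [add_mul]; exact V.add_mem hx hz
  | smul c x _ hx => rw [smul_mul_assoc]; exact V.smul_mem _ hx

lemma qcm_sub_word_mem {T₁ T₂ : List (ℕ × ℤ)} {V : Submodule KK (UA n A Dd)}
    (h₁₂ : ∀ ω₁ ω₂ : List (ℕ × ℤ), ω₁.Perm T₁ → ω₂.Perm T₂ → wordProd n A Dd (ω₁ ++ ω₂) ∈ V)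
    (h₂₁ : ∀ ω₁ ω₂ : List (ℕ × ℤ), ω₁.Perm T₁ → ω₂.Perm T₂ →
      (ω₁.map Prod.fst ≠ (T₁.map Prod.fst).reverse ∨ ω₂.map Prod.fst ≠ (T₂.map Prod.fst).reverse) →
        wordProd n A Dd (ω₂ ++ ω₁) ∈ V)
    (lam a₁ a₂ : KK) {R₁ R₂ : UA n A Dd} (hR₁ : R₁ ∈ offSpan n A Dd T₁)
    (hR₂ : R₂ ∈ offSpan n A Dd T₂) :
    qcm lam (a₁ • wordProd n A Dd T₁.reverse + R₁) (a₂ • wordProd n A Dd T₂.reverse + R₂) -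
      (-(lam * (a₂ * a₁))) • wordProd n A Dd (T₂.reverse ++ T₁.reverse) ∈ V := by
  have hW : ∀ T, wordProd n A Dd T.reverse ∈ wordSpan n A Dd T := fun T =>
    Submodule.subset_span ⟨_, List.reverse_perm T, rfl⟩
  have hE : ∀ T a R, R ∈ offSpan n A Dd T →
      a • wordProd n A Dd T.reverse + R ∈ wordSpan n A Dd T := fun T a R hR =>
    Submodule.add_mem _ (Submodule.smul_mem _ _ (hW T)) (offSpan_le_wordSpan n A Dd T hR)
  have h1 := mul_mem_of_mem_span (V := V) (by
    rintro _ ⟨ω₁, hω₁, rfl⟩ _ ⟨ω₂, hω₂, rfl⟩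
    rw [← wordProd_append]
    exact h₁₂ ω₁ ω₂ hω₁ hω₂) (hE T₁ a₁ R₁ hR₁) (hE T₂ a₂ R₂ hR₂)
  have h2 := mul_mem_of_mem_span (V := V) (by
    rintro _ ⟨ω₂, hω₂, rfl⟩ _ ⟨ω₁, hω₁, hne, rfl⟩
    rw [← wordProd_append]
    exact h₂₁ ω₁ ω₂ hω₁ hω₂ (Or.inl hne)) (hE T₂ a₂ R₂ hR₂) hR₁
  have h3 := mul_mem_of_mem_span (V := V) (by
    rintro _ ⟨ω₂, hω₂, hne, rfl⟩ _ ⟨ω₁, hω₁, rfl⟩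
    rw [← wordProd_append]
    exact h₂₁ ω₁ ω₂ hω₁ hω₂ (Or.inr hne)) hR₂ (hW T₁)
  have h4 : ∀ (c : KK) (x : UA n A Dd), (-c) • x = -(c • x) := fun c x =>
    neg_smul (M := UA n A Dd) c x
  convert V.sub_mem h1 (V.smul_mem lam (V.add_mem h2 (V.smul_mem a₁ h3))) using 1
  rw [qcm, h4, wordProd_append]
  generalize wordProd n A Dd T₁.reverse = W₁
  generalize wordProd n A Dd T₂.reverse = W₂
  simp only [mul_add, add_mul, smul_add, smul_smul, smul_mul_assoc, mul_smul_comm]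
  rw [mul_comm a₂ a₁]
  abel

end BracketExpansion

/-! ### Specialization of root vectors of type `[i,n,i]` -/

section DoubledSpec
open MvPolynomial
variable {n : ℕ} {β : PosRootC n}

/-- equality up to a monomial scalar. -/
def MonEq (p q : WR2C n) : Prop := ∃ u, IsMonomialScalar u ∧ p = C u * q

lemma MonEq.refl (p : WR2C n) : MonEq p p := ⟨1, .one, by simp⟩

lemma MonEq.mul {p q p' q' : WR2C n} (h : MonEq p q) (h' : MonEq p' q') :
    MonEq (p * p') (q * q') := by
  obtain ⟨u, hu, rfl⟩ := h
  obtain ⟨u', hu', rfl⟩ := h'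
  exact ⟨u * u', hu.mul hu', by rw [C_mul]; ring⟩

lemma MonEq.trans {p q r : WR2C n} (h : MonEq p q) (h' : MonEq q r) : MonEq p r := by
  obtain ⟨u, hu, rfl⟩ := h
  obtain ⟨u', hu', rfl⟩ := h'
  exact ⟨u * u', hu.mul hu', by rw [C_mul]; ring⟩

lemma MonEq.pow {p q : WR2C n} (h : MonEq p q) (k : ℕ) : MonEq (p ^ k) (q ^ k) := by
  obtain ⟨u, hu, rfl⟩ := h
  exact ⟨u ^ k, hu.pow k, by rw [mul_pow, C_pow]⟩

lemma MonEq.prod_const {s : Finset ℕ} {f : ℕ → WR2C n} {q : WR2C n}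
    (h : ∀ c ∈ s, MonEq (f c) q) : MonEq (∏ c ∈ s, f c) (q ^ s.card) := by
  induction s using Finset.cons_induction with
  | empty => simpa using MonEq.refl _
  | cons a s ha ih =>
    rw [Finset.prod_cons, Finset.card_cons, pow_succ']
    exact (h a (by simp)).mul (ih fun c hc => h c (by simp [hc]))

lemma MonEq.symm {p q : WR2C n} (h : MonEq p q) : MonEq q p := by
  obtain ⟨u, hu, rfl⟩ := h
  refine ⟨u⁻¹, hu.inv, ?_⟩
  rw [← mul_assoc, ← C_mul, inv_mul_cancel₀ hu.ne_zero, C_1, one_mul]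

lemma MonEq.dvd {p q : WR2C n} (h : MonEq p q) : q ∣ p := by
  obtain ⟨u, -, rfl⟩ := h
  exact dvd_mul_left _ _

variable (β) in
/-- the two variables `w`, `w'` attached to the root `β`. -/
def wPair (t : ℕ) : WR2C n := X (if t = 0 then Sum.inl (β, 0) else Sum.inr (β, 0))

variable (n) in
/-- the exponent of `v` in the specialization of the variables of color `c`. -/
def doubledExp (c : ℕ) : ℤ := if c = n then -(n : ℤ) else 1 - c

lemma labVal_doubled (h : isINI β) (p : ℕ × ℕ) :
    labVal β p = C (vpow (doubledExp n p.1)) * wPair β (if p.1 = n then 1 else p.2) := by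
  unfold labVal specValC doubledExp wPair
  rw [if_pos h]
  split_ifs <;> simp_all

lemma labNum_doubled (h : isINI β) {x y : ℕ × ℕ} {e : ℤ} (ha : aC n x.1 y.1 ≠ 0)
    (he : doubledExp n y.1 - (dC n x.1 : ℤ) * aC n x.1 y.1 - doubledExp n x.1 = e) :
    MonEq (labNum β x y) (wPair β (if x.1 = n then 1 else x.2) -
      C (vpow e) * wPair β (if y.1 = n then 1 else y.2)) := by
  have h2 : vpow (-((dC n x.1 : ℤ) * aC n x.1 y.1)) * vpow (doubledExp n y.1) =
      vpow (doubledExp n x.1) * vpow e := by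
    rw [← vpow_add, ← vpow_add, ← he]
    congr 1
    ring
  refine ⟨(if x.1 < y.1 ∨ (x.1 = y.1 ∧ x.2 < y.2) then 1 else -1) * vpow (doubledExp n x.1), ?_, ?_⟩
  · refine IsMonomialScalar.mul ?_ (.vpow _)
    split_ifs
    exacts [.one, .neg .one]
  · rw [labNum, pairNum, if_neg ha, labVal_doubled h, labVal_doubled h, algebraMap_eq,
      ← mul_assoc (C _) (C _), ← C_mul, h2]
    split_ifs <;> simp <;> ring

lemma labNum_doubled_self (h : isINI β) {c : ℕ} (hc : c < n) (t t' : ℕ) :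
    MonEq (labNum β (c, t) (c, t')) (wPair β t - C (vpow (-2)) * wPair β t') := by
  have := labNum_doubled h (x := (c, t)) (y := (c, t')) (aC_ne_zero (Or.inl rfl)) rfl
  simp only [if_neg hc.ne, dC_mul_aC_self hc.ne] at this
  convert this using 5
  ring

lemma labNum_doubled_up (h : isINI β) {c : ℕ} (hc : c + 1 < n) (t t' : ℕ) :
    MonEq (labNum β (c, t) (c + 1, t')) (wPair β t - wPair β t') := by
  have h1 := labNum_doubled h (x := (c, t)) (y := (c + 1, t')) (e := 0) (aC_ne_zero (by simp)) (by
    simp only [doubledExp]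
    rw [dC_mul_aC_adj (Or.inl rfl) (by omega), if_neg (by omega), if_neg (by omega)]
    push_cast
    ring)
  simpa only [if_neg hc.ne, if_neg (show c ≠ n by omega), vpow_zero, C_1, one_mul] using h1

lemma labNum_doubled_down (h : isINI β) {c : ℕ} (hc : c + 1 < n) (t t' : ℕ) :
    MonEq (labNum β (c + 1, t) (c, t')) (wPair β t - C (vpow 2) * wPair β t') := by
  have h1 := labNum_doubled h (x := (c + 1, t)) (y := (c, t')) (e := 2) (aC_ne_zero (by simp)) (by
    simp only [doubledExp]
    rw [dC_mul_aC_adj (Or.inr rfl) (by omega), if_neg (by omega), if_neg (by omega)]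
    push_cast
    ring)
  simpa only [if_neg hc.ne, if_neg (show c ≠ n by omega)] using h1

lemma labNum_doubled_last (h : isINI β) {c : ℕ} (hc : c + 1 = n) (t : ℕ) :
    MonEq (labNum β (n, 0) (c, t)) (wPair β 1 - C (vpow 4) * wPair β t) := by
  have h1 := labNum_doubled h (x := (n, 0)) (y := (c, t)) (e := 4)
    (aC_ne_zero (by simp only; omega)) (by
    simp only [doubledExp]
    rw [dC_mul_aC_adj_last (Or.inr ⟨hc, rfl⟩), if_true, if_neg (by omega)]
    subst hc
    push_cast
    ring)
  simpa only [if_true, if_neg (show c ≠ n by omega)] using h1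

lemma labNum_doubled_to_last (h : isINI β) {c : ℕ} (hc : c + 1 = n) (t : ℕ) :
    MonEq (labNum β (c, t) (n, 0)) (wPair β t - wPair β 1) := by
  have h1 := labNum_doubled h (x := (c, t)) (y := (n, 0)) (e := 0)
    (aC_ne_zero (by simp only; omega)) (by
    simp only [doubledExp]
    rw [dC_mul_aC_adj_last (Or.inl ⟨hc, rfl⟩), if_true, if_neg (by omega)]
    subst hc
    push_cast
    ring)
  simpa only [if_true, if_neg (show c ≠ n by omega), vpow_zero, C_1, one_mul] using h1

lemma MonEq.eq_zero {p q : WR2C n} (h : MonEq p q) (hq : q = 0) : p = 0 := by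
  obtain ⟨u, -, rfl⟩ := h
  rw [hq, mul_zero]

lemma wPair_swap (e : ℤ) (t t' : ℕ) :
    MonEq (wPair β t - C (vpow e) * wPair β t') (wPair β t' - C (vpow (-e)) * wPair β t) := by
  refine ⟨-vpow e, IsMonomialScalar.neg (.vpow e), ?_⟩
  have h1 : (C (vpow e) * C (vpow (-e)) : WR2C n) = 1 := by
    rw [← C_mul, ← vpow_add, add_neg_cancel, vpow_zero, C_1]
  rw [C_neg]
  linear_combination -wPair β t * h1

/-- the labels `(m,t), (m-1,t), …, (i,t)`. -/
def sheetLabels (t i m : ℕ) : List (ℕ × ℕ) :=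
  ((List.range' i (m + 1 - i)).reverse).map fun c => (c, t)

lemma mem_sheetLabels {t i m : ℕ} {p : ℕ × ℕ} :
    p ∈ sheetLabels t i m ↔ i ≤ p.1 ∧ p.1 ≤ m ∧ p.2 = t := by
  obtain ⟨a, b⟩ := p
  simp only [sheetLabels, List.mem_map, List.mem_reverse, List.mem_range'_1, Prod.mk.injEq]
  constructor
  · rintro ⟨c, hc, rfl, rfl⟩
    omega
  · rintro ⟨h1, h2, h3⟩
    exact ⟨a, by omega, rfl, h3.symm⟩

lemma nodup_sheetLabels (t i m : ℕ) : (sheetLabels t i m).Nodup :=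
  (List.nodup_reverse.2 List.nodup_range').map fun _ _ h => (Prod.ext_iff.1 h).1

lemma sheetLabels_succ {t i m : ℕ} (h : i ≤ m + 1) :
    sheetLabels t i (m + 1) = (m + 1, t) :: sheetLabels t i m := by
  have : m + 1 + 1 - i = (m + 1 - i) + 1 := by omega
  rw [sheetLabels, sheetLabels, this, List.range'_concat, List.reverse_append]
  simp
  omega

lemma prod_sheetLabels {M : Type} [CommMonoid M] (t i m : ℕ) (f : ℕ × ℕ → M) :
    ((sheetLabels t i m).map f).prod = ∏ c ∈ Finset.Icc i m, f (c, t) := by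
  rw [sheetLabels, List.map_map, ← List.prod_toFinset _ (List.nodup_reverse.2 List.nodup_range')]
  refine Finset.prod_congr ?_ fun _ _ => rfl
  ext c
  simp
  omega

lemma prod_tridiagonal {M : Type} [CommMonoid M] (f : ℕ → ℕ → M)
    (hf : ∀ c c', c + 1 < c' ∨ c' + 1 < c → f c c' = 1) {i m : ℕ} (him : i ≤ m) :
    ∏ c ∈ Finset.Icc i m, ∏ c' ∈ Finset.Icc i m, f c c' =
      (∏ c ∈ Finset.Icc i m, f c c) * (∏ c ∈ Finset.Ico i m, f c (c + 1)) *
        ∏ c ∈ Finset.Ico i m, f (c + 1) c := by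
  induction m, him using Nat.le_induction with
  | base => simp
  | succ m him ih =>
    have hI : ∀ g : ℕ → M, ∏ c ∈ Finset.Icc i (m + 1), g c = (∏ c ∈ Finset.Icc i m, g c) * g (m + 1) :=
      fun g => Finset.prod_Icc_succ_top (by omega) g
    have h1 : ∏ c ∈ Finset.Icc i m, f c (m + 1) = f m (m + 1) := by
      refine Finset.prod_eq_single_of_mem m (by simp [him]) fun c hc hcm => hf _ _ ?_
      rw [Finset.mem_Icc] at hc
      omega
    have h2 : ∏ c ∈ Finset.Icc i m, f (m + 1) c = f (m + 1) m := by
      refine Finset.prod_eq_single_of_mem m (by simp [him]) fun c hc hcm => hf _ _ ?_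
      rw [Finset.mem_Icc] at hc
      omega
    simp only [hI, Finset.prod_Ico_succ_top him, Finset.prod_mul_distrib, ih, h1, h2]
    simp only [mul_assoc, mul_left_comm, mul_comm]

lemma cross_sheets (h : isINI β) {i m : ℕ} (him : i ≤ m) (hm : m < n) (t t' : ℕ) :
    MonEq (∏ c ∈ Finset.Icc i m, ∏ c' ∈ Finset.Icc i m, labNum β (c, t) (c', t'))
      ((wPair β t - C (vpow (-2)) * wPair β t') ^ (m - i + 1) *
        (wPair β t - wPair β t') ^ (m - i) *
          (wPair β t - C (vpow 2) * wPair β t') ^ (m - i)) := by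
  rw [prod_tridiagonal (fun c c' => labNum β (c, t) (c', t'))
    (fun c c' hc => labNum_eq_one (aC_eq_zero hc)) him]
  have h1 : (Finset.Icc i m).card = m - i + 1 := by rw [Nat.card_Icc]; omega
  have h2 : (Finset.Ico i m).card = m - i := by rw [Nat.card_Ico]
  refine MonEq.mul (MonEq.mul ?_ ?_) ?_
  · rw [← h1]
    refine MonEq.prod_const fun c hc => labNum_doubled_self h ?_ _ _
    rw [Finset.mem_Icc] at hc
    omega
  · rw [← h2]
    refine MonEq.prod_const fun c hc => labNum_doubled_up h ?_ _ _
    rw [Finset.mem_Ico] at hc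
    omega
  · rw [← h2]
    refine MonEq.prod_const fun c hc => labNum_doubled_down h ?_ _ _
    rw [Finset.mem_Ico] at hc
    omega

lemma pairProd_sheetLabels (h : isINI β) {i m : ℕ} (him : i ≤ m) (hm : m < n) (t : ℕ) :
    MonEq (pairProd (labNum β) (sheetLabels t i m))
      ((wPair β t - C (vpow 2) * wPair β t) ^ (m - i)) := by
  induction m, him using Nat.le_induction with
  | base => simpa [sheetLabels, pairProd] using MonEq.refl _
  | succ m him ih =>
    have h1 : ∏ c ∈ Finset.Icc i m, labNum β (m + 1, t) (c, t) = labNum β (m + 1, t) (m, t) := by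
      refine Finset.prod_eq_single_of_mem m (by simp [him]) fun c hc hcm =>
        labNum_eq_one (aC_eq_zero ?_)
      rw [Finset.mem_Icc] at hc
      simp only
      omega
    rw [sheetLabels_succ (by omega), pairProd, prod_sheetLabels, h1, Nat.sub_add_comm him, pow_succ']
    exact (labNum_doubled_down h hm t t).mul (ih (by omega))

end DoubledSpec

section DoubledOrder
open MvPolynomial
variable {n : ℕ} {β : PosRootC n}

lemma sheetLabels_isChain (h : isINI β) {i m : ℕ} (hm : m < n) (t : ℕ) :
    (sheetLabels t i m).IsChain fun a b => ¬ labNum β b a ≠ 0 := by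
  rw [sheetLabels, List.isChain_map, List.isChain_reverse]
  refine (List.isChain_range' _ _ _).imp_of_mem_imp ?_
  rintro a b - hb rfl
  rw [List.mem_range'_1] at hb
  exact not_not.2 ((labNum_doubled_up h (by omega) t t).eq_zero (sub_self _))

lemma cons_sheetLabels_isChain (h : isINI β) {i m : ℕ} (him : i ≤ m) (hm : m + 1 = n) :
    ((n, 0) :: sheetLabels 1 i m).IsChain fun a b => ¬ labNum β b a ≠ 0 := by
  refine List.isChain_cons.2 ⟨fun y hy => ?_, sheetLabels_isChain h (by omega) 1⟩
  obtain rfl : (m, 1) = y := by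
    obtain rfl | hlt := him.eq_or_lt
    · simpa [sheetLabels] using hy
    · obtain ⟨m, rfl⟩ : ∃ m', m = m' + 1 := ⟨m - 1, by omega⟩
      simpa [sheetLabels_succ him] using hy
  exact not_not.2 ((labNum_doubled_to_last h hm 1).eq_zero (sub_self _))

lemma nodup_cons_sheetLabels {i m : ℕ} (hm : m < n) : ((n, 0) :: sheetLabels 1 i m).Nodup := by
  refine List.nodup_cons.2 ⟨fun h => ?_, nodup_sheetLabels 1 i m⟩
  rw [mem_sheetLabels] at h
  simp only at h
  omega

/-- The only orders of the labels of `[i,n,i]`, split into two halves each containing all colors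
below `n`, for which no specialized factor vanishes: either the first half contains one sheet and
the second half the other one, or the order is the distinguished one. -/
lemma doubled_dichotomy (h : isINI β) {i m : ℕ} (him : i ≤ m) (hm : m + 1 = n)
    {La Lb : List (ℕ × ℕ)} (hnd : (La ++ Lb).Nodup)
    (hmem : ∀ p, p ∈ La ++ Lb ↔ (i ≤ p.1 ∧ p.1 ≤ m ∧ p.2 < 2) ∨ p = (n, 0))
    (hcol : ∀ c, i ≤ c → c ≤ m → c ∈ La.map Prod.fst ∧ c ∈ Lb.map Prod.fst)
    (hpw : (La ++ Lb).Pairwise fun a b => labNum β a b ≠ 0) :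
    (∀ c, i ≤ c → c ≤ m → (c, 0) ∈ La ∧ (c, 1) ∈ Lb) ∨
      (La = (n, 0) :: sheetLabels 1 i m ∧ Lb = sheetLabels 0 i m) := by
  obtain ⟨hnda, hndb, hdisj⟩ := List.nodup_append'.1 hnd
  have hprec : ∀ p q, labNum β p q = 0 → p ∈ La → q ∈ La ++ Lb → q ∈ La := by
    intro p q hpq hp hq
    by_contra hq'
    exact (List.pairwise_append.1 hpw).2.2 p hp q ((List.mem_append.1 hq).resolve_left hq') hpq
  have hone : ∀ c, i ≤ c → c ≤ m →
      ((c, 0) ∈ La ∧ (c, 1) ∈ Lb) ∨ ((c, 1) ∈ La ∧ (c, 0) ∈ Lb) := by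
    intro c h1 h2
    obtain ⟨ha, hb⟩ := hcol c h1 h2
    obtain ⟨⟨_, t⟩, hp, rfl⟩ := List.mem_map.1 ha
    obtain ⟨⟨c', t'⟩, hq, hc'⟩ := List.mem_map.1 hb
    obtain rfl : c' = _ := hc'
    have ht := (hmem _).1 (List.mem_append_left Lb hp)
    have ht' := (hmem _).1 (List.mem_append_right La hq)
    have hne : t ≠ t' := by
      rintro rfl
      exact hdisj hp hq
    simp only [Prod.mk.injEq] at ht ht' h1 h2
    have h3 : (t = 0 ∧ t' = 1) ∨ (t = 1 ∧ t' = 0) := by omega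
    obtain ⟨rfl, rfl⟩ | ⟨rfl, rfl⟩ := h3
    exacts [Or.inl ⟨hp, hq⟩, Or.inr ⟨hp, hq⟩]
  have hup : ∀ t < 2, (i, t) ∈ La → ∀ c, i ≤ c → c ≤ m → (c, t) ∈ La := by
    intro t ht hi c hc
    induction c, hc using Nat.le_induction with
    | base => exact fun _ => hi
    | succ c hc ih =>
      intro hcm
      exact hprec (c, t) (c + 1, t) ((labNum_doubled_up h (by omega) t t).eq_zero (sub_self _))
        (ih (by omega)) ((hmem _).2 (Or.inl ⟨by simp only; omega, hcm, ht⟩))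
  rcases hone i le_rfl him with ⟨hi, -⟩ | ⟨hi, -⟩
  · refine Or.inl fun c h1 h2 => ?_
    have h3 := hup 0 (by omega) hi c h1 h2
    rcases hone c h1 h2 with h4 | ⟨-, h4⟩
    exacts [h4, (hdisj h3 h4).elim]
  · right
    have ha : ∀ c, i ≤ c → c ≤ m → (c, 1) ∈ La ∧ (c, 0) ∈ Lb := by
      intro c h1 h2
      have h3 := hup 1 (by omega) hi c h1 h2
      rcases hone c h1 h2 with ⟨-, h4⟩ | h4
      exacts [(hdisj h3 h4).elim, h4]
    have hn : (n, 0) ∈ La := hprec (m, 1) (n, 0)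
      ((labNum_doubled_to_last h hm 1).eq_zero (sub_self _)) (ha m him le_rfl).1
      ((hmem _).2 (Or.inr rfl))
    have hLa : La.Perm ((n, 0) :: sheetLabels 1 i m) := by
      refine (List.perm_ext_iff_of_nodup hnda (nodup_cons_sheetLabels (by omega))).2 ?_
      rintro ⟨c, t⟩
      rw [List.mem_cons, mem_sheetLabels]
      constructor
      · intro hp
        rcases (hmem _).1 (List.mem_append_left Lb hp) with ⟨h1, h2, h3⟩ | h1
        · refine Or.inr ⟨h1, h2, ?_⟩
          by_contra ht
          obtain rfl : t = 0 := by simp only at h3 ht; omega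
          exact hdisj hp (ha c h1 h2).2
        · exact Or.inl h1
      · rintro (hp | ⟨h1, h2, rfl⟩)
        · exact hp ▸ hn
        · exact (ha c h1 h2).1
    have hLb : Lb.Perm (sheetLabels 0 i m) := by
      refine (List.perm_ext_iff_of_nodup hndb (nodup_sheetLabels 0 i m)).2 ?_
      rintro ⟨c, t⟩
      rw [mem_sheetLabels]
      constructor
      · intro hp
        rcases (hmem _).1 (List.mem_append_right La hp) with ⟨h1, h2, h3⟩ | h1
        · refine ⟨h1, h2, ?_⟩
          by_contra ht
          obtain rfl : t = 1 := by simp only at h3 ht; omega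
          exact hdisj (ha c h1 h2).1 hp
        · exact (hdisj hn (h1 ▸ hp)).elim
      · rintro ⟨h1, h2, rfl⟩
        exact (ha c h1 h2).2
    have hpw' := List.pairwise_append.1 hpw
    exact ⟨List.eq_of_perm_of_isChain hLa (nodup_cons_sheetLabels (by omega)) hpw'.1 (cons_sheetLabels_isChain h him hm),
      List.eq_of_perm_of_isChain hLb (nodup_sheetLabels 0 i m) hpw'.2.1 (sheetLabels_isChain h (by omega) 0)⟩

end DoubledOrder

section DoubledProducts
open MvPolynomial
variable {n : ℕ} {β : PosRootC n}

variable (β) in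
/-- the difference `w - vᵉ w'` of the two variables attached to `β`. -/
def wDiff (e : ℤ) : WR2C n := wPair β 0 - C (vpow e) * wPair β 1

lemma wDiff_zero : wDiff β 0 = wPair β 0 - wPair β 1 := by
  rw [wDiff, vpow_zero, C_1, one_mul]

lemma list_prod_dvd_of_subset {α M : Type} [CommMonoid M] (f : α → M) {L L' : List α}
    (hL : L.Nodup) (h : L ⊆ L') : (L.map f).prod ∣ (L'.map f).prod := by
  have h1 : ((L : Multiset α).map f).prod ∣ ((L' : Multiset α).map f).prod :=
    Multiset.prod_dvd_prod_of_le (Multiset.map_le_map (Multiset.coe_le.2 (hL.subperm h)))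
  simpa using h1

lemma cross_dvd_pairProd (h : isINI β) {i m : ℕ} (him : i ≤ m) (hm : m < n) {La Lb : List (ℕ × ℕ)}
    (hL : ∀ c, i ≤ c → c ≤ m → (c, 0) ∈ La ∧ (c, 1) ∈ Lb) :
    wDiff β (-2) ^ (m - i + 1) * wDiff β 0 ^ (m - i) * wDiff β 2 ^ (m - i) ∣
      pairProd (labNum β) (La ++ Lb) := by
  have ha : sheetLabels 0 i m ⊆ La := by
    rintro ⟨c, t⟩ hp
    obtain ⟨h1, h2, rfl⟩ := mem_sheetLabels.1 hp
    exact (hL c h1 h2).1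
  have hb : sheetLabels 1 i m ⊆ Lb := by
    rintro ⟨c, t⟩ hp
    obtain ⟨h1, h2, rfl⟩ := mem_sheetLabels.1 hp
    exact (hL c h1 h2).2
  rw [wDiff_zero]
  refine (cross_sheets h him hm 0 1).dvd.trans ?_
  rw [pairProd_append]
  refine dvd_mul_of_dvd_right (dvd_trans ?_
    (list_prod_dvd_of_subset _ (nodup_sheetLabels 0 i m) ha)) _
  rw [prod_sheetLabels]
  refine Finset.prod_dvd_prod_of_dvd _ _ fun c _ => ?_
  rw [← prod_sheetLabels 1 i m (labNum β (c, 0))]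
  exact list_prod_dvd_of_subset _ (nodup_sheetLabels 1 i m) hb

lemma prod_labNum_last (h : isINI β) {i m : ℕ} (him : i ≤ m) (hm : m + 1 = n) (t : ℕ) :
    MonEq (((sheetLabels t i m).map (labNum β (n, 0))).prod)
      (wPair β 1 - C (vpow 4) * wPair β t) := by
  rw [prod_sheetLabels, Finset.prod_eq_single_of_mem m (by simp [him])]
  · exact labNum_doubled_last h hm t
  · intro c hc hcm
    rw [Finset.mem_Icc] at hc
    refine labNum_eq_one (aC_eq_zero ?_)
    simp only
    omega

variable (β) in
/-- the part of the distinguished specialized product not divisible by the differences `w - w'`,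
`w - v⁻² w'`, up to one factor `w - v² w'`. -/
def doubledCofactor (k : ℕ) : WR2C n :=
  wDiff β 2 * (wPair β 1 - C (vpow 4) * wPair β 0) * (wPair β 1 - C (vpow 4) * wPair β 1) *
    ((wPair β 1 - C (vpow 2) * wPair β 1) ^ k * (wPair β 0 - C (vpow 2) * wPair β 0) ^ k)

lemma pairProd_doubled (h : isINI β) {i m : ℕ} (him : i ≤ m) (hm : m + 1 = n) :
    MonEq (pairProd (labNum β) (((n, 0) :: sheetLabels 1 i m) ++ sheetLabels 0 i m))
      ((wDiff β (-2) * wDiff β 2) ^ (m - i) * wDiff β 0 ^ (m - i) * doubledCofactor β (m - i)) := by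
  have hc : MonEq (((sheetLabels 1 i m).map fun p =>
      ((sheetLabels 0 i m).map (labNum β p)).prod).prod)
      (wDiff β 2 ^ (m - i + 1) * wDiff β 0 ^ (m - i) * wDiff β (-2) ^ (m - i)) := by
    have h0 : MonEq (wPair β 1 - wPair β 0) (wDiff β 0) := by
      have := wPair_swap (n := n) (β := β) 0 1 0
      rwa [neg_zero, vpow_zero, C_1, one_mul, one_mul, ← wDiff_zero] at this
    rw [prod_sheetLabels]
    simp only [prod_sheetLabels]
    exact (cross_sheets h him (by omega) 1 0).trans
      ((((wPair_swap (-2) 1 0).pow _).mul (h0.pow _)).mul ((wPair_swap 2 1 0).pow _))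
  rw [pairProd_append, pairProd, List.map_cons, List.prod_cons]
  have := (((prod_labNum_last h him hm 1).mul (pairProd_sheetLabels h him (by omega) 1)).mul
    (pairProd_sheetLabels h him (by omega) 0)).mul ((prod_labNum_last h him hm 0).mul hc)
  convert this using 1
  rw [doubledCofactor, pow_succ, mul_pow]
  ring

/-- `ψ₂ p` equals `c w^e` up to a monomial scalar. -/
def PsiRel (p : WR2C n) (β : PosRootC n) (c : KK) (e : ℕ) : Prop :=
  ∃ u, IsMonomialScalar u ∧ psi2C n p = C (u * c) * X (β, 0) ^ e

lemma PsiRel.mul {p p' : WR2C n} {c c' : KK} {e e' : ℕ} (h : PsiRel p β c e)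
    (h' : PsiRel p' β c' e') : PsiRel (p * p') β (c * c') (e + e') := by
  obtain ⟨u, hu, h⟩ := h
  obtain ⟨u', hu', h'⟩ := h'
  refine ⟨u * u', hu.mul hu', ?_⟩
  rw [map_mul, h, h', pow_add]
  simp only [C_mul]
  ring

lemma PsiRel.one : PsiRel (1 : WR2C n) β 1 0 := ⟨1, .one, by simp⟩

lemma PsiRel.pow {p : WR2C n} {c : KK} {e : ℕ} (h : PsiRel p β c e) (k : ℕ) :
    PsiRel (p ^ k) β (c ^ k) (e * k) := by
  induction k with
  | zero => simpa using PsiRel.one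
  | succ k ih =>
    rw [pow_succ, pow_succ, mul_add_one]
    exact ih.mul h

lemma psi2C_wPair (t : ℕ) :
    psi2C n (wPair β t) = C (vpow (if t = 0 then 0 else 2)) * X (β, 0) := by
  rw [wPair, psi2C, aeval_X]
  split_ifs
  · rw [vpow_zero, C_1, one_mul]
  · rfl

lemma psiRel_wPair_sub {t t' : ℕ} {e : ℤ} (k : ℕ)
    (hk : (if t = 0 then 0 else 2) = e + (if t' = 0 then 0 else 2) + 2 * k ∨
      e + (if t' = 0 then 0 else 2) = (if t = 0 then 0 else 2) + 2 * (k : ℤ)) :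
    PsiRel (wPair β t - C (vpow e) * wPair β t') β (qBrack k) 1 := by
  obtain ⟨u, hu, h⟩ := vpow_sub_vpow_qBrack k hk
  refine ⟨u, hu, ?_⟩
  rw [← h, map_sub, map_mul, psi2C_wPair, psi2C_wPair, algHom_C, algebraMap_eq, C_sub, vpow_add,
    C_mul]
  ring

lemma psi2C_wDiff_neg_two : psi2C n (wDiff β (-2)) = 0 := by
  rw [wDiff, map_sub, map_mul, psi2C_wPair, psi2C_wPair, algHom_C, algebraMap_eq, ← mul_assoc,
    ← C_mul, ← vpow_add, sub_eq_zero]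
  simp

lemma psiRel_wDiff_zero : PsiRel (wDiff β 0) β (qBrack 1) 1 := by
  exact psiRel_wPair_sub 1 (by simp)

lemma psiRel_doubledCofactor (k : ℕ) :
    PsiRel (doubledCofactor β k) β (qBrack 1 * (qBrack 1 ^ (2 * k) * qBrack 2 ^ 2)) (2 * k + 3) := by
  have h1 : PsiRel (wDiff β 2) β (qBrack 2) 1 := psiRel_wPair_sub 2 (by simp)
  have h2 : PsiRel (wPair β 1 - C (vpow 4) * wPair β 0) β (qBrack 1) 1 :=
    psiRel_wPair_sub 1 (by simp)
  have h3 : PsiRel (wPair β 1 - C (vpow 4) * wPair β 1) β (qBrack 2) 1 :=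
    psiRel_wPair_sub 2 (by simp)
  have h4 : ∀ t, PsiRel (wPair β t - C (vpow 2) * wPair β t) β (qBrack 1) 1 := fun t =>
    psiRel_wPair_sub 1 (by simp [add_comm])
  convert ((h1.mul h2).mul h3).mul (((h4 1).pow k).mul ((h4 0).pow k)) using 1
  · rw [doubledCofactor]
  · ring
  · ring

lemma psiRel_labVal (h : isINI β) (p : ℕ × ℕ) : PsiRel (labVal β p) β 1 1 := by
  refine ⟨_, (IsMonomialScalar.vpow (doubledExp n p.1)).mul
    (.vpow (if (if p.1 = n then 1 else p.2) = 0 then 0 else 2)), ?_⟩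
  rw [labVal_doubled h, map_mul, algHom_C, algebraMap_eq, psi2C_wPair, mul_one, C_mul, pow_one,
    mul_assoc]

lemma psiRel_zip_labVal_prod (h : isINI β) (M : ℕ) (Λ : List (ℕ × ℕ)) (ss : List ℤ)
    (hl : ss.length = Λ.length) (hM : ∀ s ∈ ss, -(M : ℤ) ≤ s) :
    ∃ e, PsiRel ((Λ.zip ss).map fun x => labVal β x.1 ^ (x.2 + (M : ℤ)).toNat).prod β 1 e ∧
      (e : ℤ) = ss.sum + M * Λ.length := by
  induction Λ generalizing ss with
  | nil =>
    obtain rfl := List.length_eq_zero_iff.1 hl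
    exact ⟨0, by simpa using PsiRel.one, by simp⟩
  | cons p Λ ih =>
    obtain ⟨s, ss, rfl⟩ := List.exists_cons_of_length_eq_add_one hl
    simp only [List.mem_cons, forall_eq_or_imp] at hM
    obtain ⟨e, he, he'⟩ := ih ss (by simpa using hl) hM.2
    refine ⟨(s + M).toNat + e, ?_, ?_⟩
    · simpa using ((psiRel_labVal h p).pow (s + M).toNat).mul he
    · have := hM.1
      push_cast
      rw [he', List.sum_cons, List.length_cons, Int.toNat_of_nonneg (by omega)]
      push_cast
      ring

lemma psiRel_prod_labVal (h : isINI β) (Λ : List (ℕ × ℕ)) :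
    PsiRel (Λ.map (labVal β)).prod β 1 Λ.length := by
  induction Λ with
  | nil => exact PsiRel.one
  | cons p Λ ih => simpa [add_comm] using (psiRel_labVal h p).mul ih

lemma wDiff_zero_ne_zero : wDiff β 0 ≠ 0 := by
  rw [wDiff_zero]
  exact X_sub_X_ne_zero (by simp)

lemma BoneC_eq_wDiff (h : isINI β) :
    BoneC n β 0 = (wDiff β (-2) * wDiff β 2) ^ (n - ri β - 1) := by
  rw [BoneC, if_pos h]
  rfl

open Classical in
/-- exact division by `w - w'` of a multiple of the normalizing factor. -/
lemma exists_quotient (h : isINI β) {f Q : WR2C n} (hf : wDiff β 0 * f = BoneC n β 0 * Q) :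
    ∃ q, f = BoneC n β 0 * q ∧ wDiff β 0 * q = Q := by
  have hρ : ∀ e, rename (Function.update id (Sum.inl (β, 0)) (Sum.inr (β, 0))) (wDiff β e) =
      C (1 - vpow e) * X (Sum.inr (β, 0)) := by
    intro e
    simp only [wDiff, wPair, map_sub, map_mul, rename_X, rename_C, if_true, one_ne_zero, if_false,
      Function.update_self, C_1]
    rw [Function.update_of_ne (by simp), id_eq, sub_mul, one_mul]
  set ρ := rename (R := KK)
    (Function.update id (Sum.inl (β, 0)) (Sum.inr (β, 0) : (PosRootC n × ℕ) ⊕ (PosRootC n × ℕ)))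
  have hB : ρ (BoneC n β 0) ≠ 0 := by
    rw [BoneC_eq_wDiff h, map_pow, map_mul, hρ, hρ]
    refine pow_ne_zero _ (mul_ne_zero (mul_ne_zero ?_ (X_ne_zero _)) (mul_ne_zero ?_ (X_ne_zero _)))
    all_goals
      rw [Ne, C_eq_zero, sub_eq_zero, ← vpow_zero]
      exact fun h => absurd (vpow_injective h) (by norm_num)
  have hQ : ρ Q = 0 := by
    have := congrArg ρ hf
    rw [map_mul, map_mul, hρ, vpow_zero, sub_self, C_0, zero_mul, zero_mul] at this
    exact (mul_eq_zero.1 this.symm).resolve_left hB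
  obtain ⟨q, hq⟩ : wDiff β 0 ∣ Q := by
    have := X_sub_X_dvd_sub_rename (Sum.inl (β, 0)) (Sum.inr (β, 0)) Q
    rw [wDiff_zero]
    rwa [show rename _ Q = 0 from hQ, sub_zero] at this
  refine ⟨q, mul_left_cancel₀ (wDiff_zero_ne_zero (β := β)) ?_, hq.symm⟩
  rw [hf, hq]
  ring

lemma PsiRel.of_mul {p q : WR2C n} {c c' : KK} {e : ℕ} (hp : PsiRel p β c 1) (hc : c ≠ 0)
    (h : PsiRel (p * q) β (c * c') (e + 1)) : PsiRel q β c' e := by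
  obtain ⟨u, hu, hp⟩ := hp
  obtain ⟨u', hu', h⟩ := h
  refine ⟨u⁻¹ * u', hu.inv.mul hu', ?_⟩
  rw [map_mul, hp] at h
  refine mul_left_cancel₀ (a := C (u * c) * X (β, 0) ^ 1) ?_ (h.trans ?_)
  · exact mul_ne_zero (by simpa using ⟨hu.ne_zero, hc⟩) (pow_ne_zero _ (X_ne_zero _))
  · rw [mul_mul_mul_comm (C (u * c)), ← C_mul, ← pow_add, add_comm 1 e]
    congr 2
    have := hu.ne_zero
    field_simp

lemma MonEq.psiRel {p q : WR2C n} {c : KK} {e : ℕ} (h : MonEq p q) (hq : PsiRel q β c e) :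
    PsiRel p β c e := by
  obtain ⟨u, hu, rfl⟩ := h
  obtain ⟨u', hu', hq⟩ := hq
  refine ⟨u * u', hu.mul hu', ?_⟩
  rw [map_mul, hq, algHom_C, algebraMap_eq, mul_assoc u, C_mul (a := u)]
  ring

lemma phi1_Npoly_doubled (h : isINI β) :
    MonEq (phi1 β (Npoly n (nuVecC n β))) (wDiff β 0 ^ (n - ri β)) := by
  obtain ⟨hi1, -⟩ := posRootC_bounds β
  have h1 : (Finset.Icc (ri β) (n - 1)).card = n - ri β := by
    rw [Nat.card_Icc]
    have := h.2
    omega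
  rw [phi1_Npoly β hi1 (Nat.sub_le n 1), ← h1]
  · refine MonEq.prod_const fun c hc => ⟨_, .vpow (doubledExp n c), ?_⟩
    rw [Finset.mem_Icc] at hc
    rw [labVal_doubled h, labVal_doubled h, wDiff_zero]
    simp only [if_neg (show c ≠ n by omega)]
    ring
  · intro c h2 h3
    obtain ⟨h4, h5⟩ := h
    rw [nuC]
    simp only [if_neg (show ¬ (ri β + rt β < n ∨ ri β = n) by omega), if_pos h4]
    by_cases h6 : ri β ≤ c ∧ c ≤ n - 1
    · simp [h6]
    · rw [if_neg h6]
      refine iff_of_false ?_ h6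
      split_ifs <;> simp

end DoubledProducts

section DoubledRoot
open MvPolynomial
variable {n : ℕ} {β : PosRootC n}

/-- the color sequence `c` is a concatenation of two sequences containing all colors in `[i,n-1]`. -/
def IsSplit (n i : ℕ) (c : List ℕ) : Prop :=
  ∃ c₁ c₂, c = c₁ ++ c₂ ∧ ∀ x, i ≤ x → x < n → x ∈ c₁ ∧ x ∈ c₂

/-- the labels `(n,0), (n-1,1), …, (i,1), (n-1,0), …, (i,0)`. -/
def doubledLabels (n i : ℕ) : List (ℕ × ℕ) :=
  ((n, 0) :: sheetLabels 1 i (n - 1)) ++ sheetLabels 0 i (n - 1)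

lemma nodup_doubledLabels {i : ℕ} (hi : i < n) : (doubledLabels n i).Nodup := by
  refine List.nodup_append'.2
    ⟨nodup_cons_sheetLabels (by omega), nodup_sheetLabels 0 i _, fun p hp hp' => ?_⟩
  rw [mem_sheetLabels] at hp'
  rcases List.mem_cons.1 hp with rfl | hp
  · simp only at hp'
    omega
  · rw [mem_sheetLabels] at hp
    omega

lemma mem_doubledLabels {i : ℕ} {p : ℕ × ℕ} :
    p ∈ doubledLabels n i ↔ (i ≤ p.1 ∧ p.1 ≤ n - 1 ∧ p.2 < 2) ∨ p = (n, 0) := by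
  rw [doubledLabels, List.mem_append, List.mem_cons, mem_sheetLabels, mem_sheetLabels]
  have : p.2 < 2 ↔ p.2 = 1 ∨ p.2 = 0 := by omega
  tauto

lemma map_fst_sheetLabels (t i m : ℕ) :
    (sheetLabels t i m).map Prod.fst = (List.range' i (m + 1 - i)).reverse := by
  rw [sheetLabels, List.map_map]
  exact List.map_id _

lemma mem_doubledLabels_iff_lt_nuC (h : isINI β) (p : ℕ × ℕ) :
    p ∈ doubledLabels n (ri β) ↔ (1 ≤ p.1 ∧ p.1 ≤ n) ∧ p.2 < nuC β p.1 := by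
  obtain ⟨hi1, -⟩ := posRootC_bounds β
  obtain ⟨h4, h5⟩ := h
  obtain ⟨c, t⟩ := p
  rw [mem_doubledLabels, nuC]
  simp only [if_neg (show ¬ (ri β + rt β < n ∨ ri β = n) by omega), if_pos h4, Prod.mk.injEq]
  split_ifs <;> omega

/-- every specialized summand with a color sequence of the form `IsSplit`, other than the
distinguished one, lies in the ideal generated by `B_β (w - w')^h (w - v⁻² w')`. -/
lemma phi1_termP_mem (h : isINI β) (M : ℕ) {L : List (Vars n (nuVecC n β))} (ss : List ℤ)
    (hL : IsEnum L) (hs : IsSplit n (ri β) (L.map fun u => (lab n u).1))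
    (hne : L.map (lab n) ≠ doubledLabels n (ri β)) :
    phi1 β (termP n (aC n) (dC n) M L ss) ∈
      Ideal.span {wDiff β 0 ^ (n - 1 - ri β) * (BoneC n β 0 * wDiff β (-2))} := by
  have hin := h.2
  have hm : n - 1 + 1 = n := by omega
  rw [phi1_termP]
  refine Ideal.mul_mem_left _ _ ?_
  by_cases h0 : pairProd (labNum β) (L.map (lab n)) = 0
  · rw [h0]
    exact zero_mem _
  obtain ⟨c₁, c₂, hc, hcol⟩ := hs
  have hc' : (L.map (lab n)).map Prod.fst = c₁ ++ c₂ := by rw [← hc, List.map_map]; rfl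
  obtain ⟨La, Lb, hLab, rfl, rfl⟩ := List.map_eq_append_iff.1 hc'
  obtain ⟨Ls, hLs, hLs'⟩ := exists_enum_labels β (nodup_doubledLabels hin)
    (mem_doubledLabels_iff_lt_nuC h)
  have hperm : (L.map (lab n)).Perm (doubledLabels n (ri β)) := by
    rw [← hLs']
    exact hL.perm_map hLs (lab n)
  rw [hLab] at hne h0 hperm ⊢
  rcases doubled_dichotomy h (show ri β ≤ n - 1 by omega) hm
    (hperm.nodup_iff.2 (nodup_doubledLabels hin))
    (fun p => (hperm.mem_iff).trans mem_doubledLabels) (fun c h1 h2 => hcol c h1 (by omega))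
    (pairwise_of_pairProd_ne_zero h0) with h1 | ⟨rfl, rfl⟩
  · rw [Ideal.mem_span_singleton]
    convert cross_dvd_pairProd h (show ri β ≤ n - 1 by omega) (by omega) h1 using 1
    rw [BoneC_eq_wDiff h, show n - ri β - 1 = n - 1 - ri β by omega, mul_pow]
    ring
  · exact (hne rfl).elim

variable (Ψ : UC n →ₗ[KK] BigS n)
    (hmul : ∀ a b, Ψ (a * b) = bstar n (aC n) (dC n) (Ψ a) (Ψ b))
    (hone : Ψ 1 = DirectSum.of (fun k => Fk n k) 0 1)
    (hgen : ∀ (i : Fin n) (r : ℤ), Ψ (ug n (aC n) (dC n) i r) =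
      DirectSum.of (fun k => Fk n k) (unitVec i) (xvr n (default : Vars n (unitVec i)) ^ r))

include hmul hone hgen in
lemma exists_phiRelC_of_split_words (h : isINI β) {ω : List (ℕ × ℤ)}
    (hω : ω.map Prod.fst = (doubledLabels n (ri β)).map Prod.fst) {a : KK}
    (ha : IsMonomialScalar a) {y : UC n}
    (hy : y ∈ Submodule.span KK {x | ∃ ω' : List (ℕ × ℤ), ω'.Perm ω ∧
      IsSplit n (ri β) (ω'.map Prod.fst) ∧ ω'.map Prod.fst ≠ ω.map Prod.fst ∧
        x = wordProd n (aC n) (dC n) ω'}) :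
    ∃ (c' : ℚ) (m : ℤ), c' ≠ 0 ∧
      PhiRelC n (dOne β) ((Ψ (a • wordProd n (aC n) (dC n) ω + y)) (nuVecC n β))
        (cwC n (algebraMap ℚ KK c' * vpow m * (qBrack 1 ^ (2 * (n - 1 - ri β)) * qBrack 2 ^ 2)) *
          wXC n (β, 0) ^ ((ω.map Prod.snd).sum + (2 * (n : ℤ) - 2 * ri β))) := by
  have hin := h.2
  have hm : n - 1 + 1 = n := by omega
  set k := n - 1 - ri β with hk
  have hB : BoneC n β 0 = (wDiff β (-2) * wDiff β 2) ^ k := by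
    rw [BoneC_eq_wDiff h, show n - ri β - 1 = k by omega]
  obtain ⟨Ls, hLs, hLs'⟩ := exists_enum_labels β (nodup_doubledLabels hin)
    (mem_doubledLabels_iff_lt_nuC h)
  obtain ⟨M, hM⟩ := exists_neg_natCast_le (ω.map Prod.snd)
  have hfst : (Ls.map fun u => (lab n u).1) = (doubledLabels n (ri β)).map Prod.fst := by
    rw [← hLs', List.map_map]
    rfl
  obtain ⟨g, hg, hgI⟩ := exists_numerator n (dC n) Ψ hmul hone hgen (phi1 β) _ M aC_eq_zero_comm
    aC_self_ne_zero (fun c => nuC_le_two β _) (IsSplit n (ri β)) hLs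
    (fun L ss hL hs hne => phi1_termP_mem h M ss hL hs (hLs' ▸ hne)) ω (hω.trans hfst.symm)
    ⟨_, _, by rw [hω, doubledLabels, List.map_append], fun x h1 h2 => by
      simp only [List.map_cons, List.mem_cons, map_fst_sheetLabels, List.mem_reverse,
        List.mem_range'_1]
      omega⟩ (fun p hp => hM _ (List.mem_map_of_mem hp)) a y hy
  obtain ⟨J, hJ⟩ := Ideal.mem_span_singleton'.1 hgI
  have hlen : (doubledLabels n (ri β)).length = (ω.map Prod.snd).length := by
    simpa using (congrArg List.length hω).symm
  obtain ⟨e, he, hee⟩ := psiRel_zip_labVal_prod h M (doubledLabels n (ri β)) (ω.map Prod.snd)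
    hlen.symm hM
  obtain ⟨u₁, hu₁, hN⟩ := phi1_Npoly_doubled h
  obtain ⟨u₂, hu₂, hT⟩ := pairProd_doubled h (show ri β ≤ n - 1 by omega) hm
  rw [phi1_termP, hLs', hN, show n - ri β = k + 1 by omega] at hJ
  rw [← doubledLabels, ← hB, ← hk] at hT
  rw [hT] at hJ
  set Z := (((doubledLabels n (ri β)).zip (ω.map Prod.snd)).map
    fun x => labVal β x.1 ^ (x.2 + (M : ℤ)).toNat).prod
  obtain ⟨q, hq, hq'⟩ := exists_quotient h (f := C u₁ * phi1 β g)
    (Q := C (a * u₂) * (Z * doubledCofactor β k) + wDiff β (-2) * J) (by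
      refine mul_left_cancel₀ (pow_ne_zero k (wDiff_zero_ne_zero (β := β))) ?_
      rw [algebraMap_eq] at hJ
      rw [C_mul]
      linear_combination -hJ)
  have hg' : phi1 β g = BoneC n β 0 * (C u₁⁻¹ * q) := by
    rw [mul_left_comm, ← hq, ← mul_assoc, ← C_mul, inv_mul_cancel₀ hu₁.ne_zero, C_1, one_mul]
  have hq₁ : PsiRel q β (qBrack 1 ^ (2 * k) * qBrack 2 ^ 2) (e + (2 * k + 2)) := by
    refine psiRel_wDiff_zero.of_mul ?_ ?_
    · rw [qBrack, sub_ne_zero]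
      exact vpow_injective.ne (by norm_num)
    · obtain ⟨u, hu, hu'⟩ := he.mul (psiRel_doubledCofactor k)
      refine ⟨a * u₂ * u, (ha.mul hu₂).mul hu, ?_⟩
      rw [hq', map_add, map_mul _ (wDiff β (-2)), psi2C_wDiff_neg_two, zero_mul, add_zero, map_mul,
        hu', algHom_C, algebraMap_eq, one_mul, mul_assoc (a * u₂), C_mul (a := a * u₂)]
      ring
  obtain ⟨u, hu, hu'⟩ := MonEq.psiRel ⟨_, hu₁.inv, rfl⟩ hq₁
  obtain ⟨x, hx, hx'⟩ := (psiRel_prod_labVal h (doubledLabels n (ri β))).pow M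
  rw [one_pow, mul_one] at hx'
  refine phiRelC_of_specializations hg hg' hx ?_ hu hu' (a := (doubledLabels n (ri β)).length * M) ?_
  · rw [map_pow, phi1_xProd β hLs, hLs', hx']
  · push_cast
    rw [hee]
    have : (k : ℤ) = n - 1 - ri β := by omega
    rw [this]
    ring

end DoubledRoot

section DoubledWords
variable {n : ℕ}

lemma map_fst_doubledLabels {i : ℕ} (hi : i < n) :
    (doubledLabels n i).map Prod.fst =
      (List.range' i (n - i + 1)).reverse ++ (List.range' i (n - i)).reverse := by
  rw [doubledLabels, List.map_append, List.map_cons, map_fst_sheetLabels, map_fst_sheetLabels,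
    List.range'_concat, List.reverse_append, show n - 1 + 1 - i = n - i by omega,
    show i + 1 * (n - i) = n by omega]
  rfl

lemma qcm_sub_doubled_word_mem {i : ℕ} (hi : i < n) {T₁ T₂ : List (ℕ × ℤ)}
    (h₁ : T₁.map Prod.fst = List.range' i (n - i))
    (h₂ : T₂.map Prod.fst = List.range' i (n - i + 1)) (lam a₁ a₂ : KK) {R₁ R₂ : UC n}
    (hR₁ : R₁ ∈ offSpan n (aC n) (dC n) T₁) (hR₂ : R₂ ∈ offSpan n (aC n) (dC n) T₂) :
    qcm lam (a₁ • wordProd n (aC n) (dC n) T₁.reverse + R₁)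
        (a₂ • wordProd n (aC n) (dC n) T₂.reverse + R₂) -
      (-(lam * (a₂ * a₁))) • wordProd n (aC n) (dC n) (T₂.reverse ++ T₁.reverse) ∈
    Submodule.span KK {x | ∃ ω' : List (ℕ × ℤ), ω'.Perm (T₂.reverse ++ T₁.reverse) ∧
      IsSplit n i (ω'.map Prod.fst) ∧
        ω'.map Prod.fst ≠ (T₂.reverse ++ T₁.reverse).map Prod.fst ∧
          x = wordProd n (aC n) (dC n) ω'} := by
  have hm₁ : ∀ ω : List (ℕ × ℤ), ω.Perm T₁ → ∀ x, x ∈ ω.map Prod.fst ↔ i ≤ x ∧ x < n := by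
    intro ω hω x
    rw [(hω.map Prod.fst).mem_iff, h₁, List.mem_range'_1]
    omega
  have hm₂ : ∀ ω : List (ℕ × ℤ), ω.Perm T₂ → ∀ x, x ∈ ω.map Prod.fst ↔ i ≤ x ∧ x ≤ n := by
    intro ω hω x
    rw [(hω.map Prod.fst).mem_iff, h₂, List.mem_range'_1]
    omega
  have hp : ∀ ω₁ ω₂ : List (ℕ × ℤ), ω₁.Perm T₁ → ω₂.Perm T₂ →
      (ω₂ ++ ω₁).Perm (T₂.reverse ++ T₁.reverse) := fun ω₁ ω₂ h h' =>
    (h'.trans (List.reverse_perm T₂).symm).append (h.trans (List.reverse_perm T₁).symm)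
  refine qcm_sub_word_mem (fun ω₁ ω₂ hω₁ hω₂ => Submodule.subset_span ?_)
    (fun ω₁ ω₂ hω₁ hω₂ hne => Submodule.subset_span ?_) lam a₁ a₂ hR₁ hR₂
  · refine ⟨_, List.perm_append_comm.trans (hp ω₁ ω₂ hω₁ hω₂), ⟨_, _, List.map_append,
      fun x h h' => ⟨(hm₁ _ hω₁ x).2 ⟨h, h'⟩, (hm₂ _ hω₂ x).2 ⟨h, h'.le⟩⟩⟩, fun heq => ?_, rfl⟩
    rw [List.map_append, List.map_append, List.map_reverse, h₂, List.range'_concat,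
      List.reverse_append, show i + 1 * (n - i) = n by omega] at heq
    obtain ⟨c, l, hcl⟩ := List.exists_cons_of_ne_nil
      (List.ne_nil_of_mem ((hm₁ ω₁ hω₁ i).2 ⟨le_rfl, hi⟩))
    have hc := (hm₁ ω₁ hω₁ c).1 (hcl ▸ List.mem_cons_self)
    rw [hcl] at heq
    have := (List.cons.inj heq).1
    omega
  · refine ⟨_, hp ω₁ ω₂ hω₁ hω₂, ⟨_, _, List.map_append,
      fun x h h' => ⟨(hm₂ _ hω₂ x).2 ⟨h, h'.le⟩, (hm₁ _ hω₁ x).2 ⟨h, h'⟩⟩⟩, fun heq => ?_, rfl⟩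
    rw [List.map_append, List.map_append, List.map_reverse, List.map_reverse] at heq
    obtain ⟨h, h'⟩ := List.append_inj heq (by simp [hω₂.length_eq])
    exact hne.elim (fun hne => hne h') fun hne => hne h

lemma exists_expansion_of_isRVCchain {γ : PosRootC n} {i m : ℕ} (hw : wordC γ = List.range' i (m + 1))
    {s : ℤ} {E : UC n} (hE : IsRVCchain γ s E) :
    ∃ T : List (ℕ × ℤ), T.map Prod.fst = List.range' i (m + 1) ∧ (T.map Prod.snd).sum = s ∧
      ∃ a, IsMonomialScalar a ∧ ∃ R ∈ offSpan n (aC n) (dC n) T,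
        E = a • wordProd n (aC n) (dC n) T.reverse + R := by
  obtain ⟨ss, ls, hss, hls, hsum, hv, rfl⟩ := hE
  rw [hw, List.range'_succ] at *
  obtain ⟨a, ha, R, hR, hE⟩ := chainE_eq n (aC n) (dC n) i _ ss ls
    (by simp) hss hls hv
  exact ⟨_, List.map_fst_zip hss.ge, by rw [List.map_snd_zip hss.le, hsum], a, ha, R, hR, hE⟩

variable {β : PosRootC n} (Ψ : UC n →ₗ[KK] BigS n)
    (hmul : ∀ a b, Ψ (a * b) = bstar n (aC n) (dC n) (Ψ a) (Ψ b))
    (hone : Ψ 1 = DirectSum.of (fun k => Fk n k) 0 1)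
    (hgen : ∀ (i : Fin n) (r : ℤ), Ψ (ug n (aC n) (dC n) i r) =
      DirectSum.of (fun k => Fk n k) (unitVec i) (xvr n (default : Vars n (unitVec i)) ^ r))

include hmul hone hgen in
lemma exists_phiRelC_of_isINI (h : isINI β) {s : ℤ} {E : UC n} (hE : IsRVC β s E) :
    ∃ (c' : ℚ) (m : ℤ), c' ≠ 0 ∧ PhiRelC n (dOne β) ((Ψ E) (nuVecC n β))
      (cwC n (algebraMap ℚ KK c' * vpow m * cBetaC β) * wXC n (β, 0) ^ (s + kappaC β)) := by
  rw [IsRVC, if_pos h] at hE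
  obtain ⟨β₁, β₂, s₁, s₂, lam, E₁, E₂, ⟨hi₁, ht₁⟩, ⟨hi₂, ht₂⟩, hlam, hE₁, hE₂, rfl, rfl⟩ := hE
  obtain ⟨hb, hin⟩ := h
  have hw₁ : wordC β₁ = List.range' (ri β) (n - 1 - ri β + 1) := by
    rw [wordC, if_pos (show ri β₁ + rt β₁ < n ∨ ri β₁ = n by omega), hi₁,
      show rt β₁ + 1 = n - 1 - ri β + 1 by omega]
  have hw₂ : wordC β₂ = List.range' (ri β) (n - ri β + 1) := by
    rw [wordC, if_neg (show ¬ (ri β₂ + rt β₂ < n ∨ ri β₂ = n) by omega),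
      if_neg (show ¬ ri β₂ + rt β₂ = n by omega), if_pos ht₂, hi₂]
  obtain ⟨T₁, hT₁, hs₁, a₁, ha₁, R₁, hR₁, rfl⟩ := exists_expansion_of_isRVCchain hw₁ hE₁
  obtain ⟨T₂, hT₂, hs₂, a₂, ha₂, R₂, hR₂, rfl⟩ := exists_expansion_of_isRVCchain hw₂ hE₂
  rw [show n - 1 - ri β + 1 = n - ri β by omega] at hT₁
  have := exists_phiRelC_of_split_words Ψ hmul hone hgen ⟨hb, hin⟩
    (ω := T₂.reverse ++ T₁.reverse)
    (by rw [map_fst_doubledLabels hin, List.map_append, List.map_reverse, List.map_reverse, hT₁, hT₂])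
    (hlam.isMonomialScalar.mul (ha₂.mul ha₁)).neg
    (qcm_sub_doubled_word_mem hin hT₁ hT₂ lam a₁ a₂ hR₁ hR₂)
  rw [add_sub_cancel] at this
  convert this using 7
  · rw [cBetaC, if_pos ⟨hb, hin⟩, heightC, wordC]
    simp only [if_neg (show ¬ (ri β + rt β < n ∨ ri β = n) by omega), if_pos hb,
      List.length_append, List.length_range', List.length_singleton]
    rw [show n - ri β + (n - ri β) + 1 - 3 = 2 * (n - 1 - ri β) by omega]
  · rw [kappaC, if_pos ⟨hb, hin⟩, List.map_append, List.map_reverse, List.map_reverse,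
      List.sum_append, List.sum_reverse, List.sum_reverse, hs₁, hs₂, add_comm s₁ s₂]

end DoubledWords

/-- **Specialization of quantum root vectors (type `C_n`)**: for every `β ∈ Δ⁺`, `s ∈ ℤ` and
any choices of the parameters `λ ∈ v^ℤ` and of decompositions defining the quantum root
vector `E_{β,s}`, there are `c ∈ ℚ^×` and `m ∈ ℤ` with
`φ_β(Ψ(E_{β,s})) = c·v^m·c_β·w_{β,1}^{s+κ_β}`.  Here `Ψ` is the homomorphism to the shuffle
algebra determined by `e_{i,r} ↦ x_{i,1}^r` and `φ_β` is the specialization map (encoded by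
the graph relation `PhiRelC`). -/
theorem specialization_root_vectors_typeC (n : ℕ) (hn : 2 ≤ n)
    (Ψ : UA n (aC n) (dC n) →ₗ[KK] BigS n)
    (hmul : ∀ a b, Ψ (a * b) = bstar n (aC n) (dC n) (Ψ a) (Ψ b))
    (hone : Ψ 1 = DirectSum.of (fun k => Fk n k) 0 1)
    (hgen : ∀ (i : Fin n) (r : ℤ),
      Ψ (ug n (aC n) (dC n) i r) =
        DirectSum.of (fun k => Fk n k) (unitVec i)
          (xvr n (⟨i, ⟨0, by simp [unitVec]⟩⟩ : Vars n (unitVec i)) ^ r))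
    (β : PosRootC n) (s : ℤ) (E : UC n) (hE : IsRVC β s E) :
    ∃ (c : ℚ) (m : ℤ), c ≠ 0 ∧
      PhiRelC n (dOne β) ((Ψ E) (nuVecC n β))
        (cwC n (algebraMap ℚ KK c * vpow m * cBetaC β) * wXC n (β, 0) ^ (s + kappaC β)) := by
  have hgen' : ∀ (i : Fin n) (r : ℤ), Ψ (ug n (aC n) (dC n) i r) =
      DirectSum.of (fun k => Fk n k) (unitVec i) (xvr n (default : Vars n (unitVec i)) ^ r) := by
    intro i r
    rw [hgen, Subsingleton.elim (⟨i, ⟨0, by simp [unitVec]⟩⟩ : Vars n (unitVec i)) default]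
  by_cases h : isINI β
  · exact exists_phiRelC_of_isINI Ψ hmul hone hgen' h hE
  · rw [IsRVC, if_neg h] at hE
    exact exists_phiRelC_of_not_isINI Ψ hmul hone hgen' h hE
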